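/- arXiv:2511.06553 — 2 statements merged into one kernel-verified Lean document; each statement's English description precedes it below -/
import Mathlib

section
/- Let 1 < p ≤ 3/2, Θ₀ > 0, T > 0, and let v : ℝ × (0,T) → ℝ be a smooth, strictly positive solution of the nonlocal rescaled equation ∂_τ v = −(1/I_p(v(·,τ))) ∂_y²( v^p ∂_y²(ln_p v) ) + (2p/Θ₀) ∂_y( y v ), such that for every τ the function v(·,τ) is a probability density which, together with all its spatial derivatives, decays faster than any polynomial as |y| → ∞, with I_p(v(·,τ)) > 0, ∫_ℝ v(·,τ)^p dy ∈ (0,∞), and second moment ∫_ℝ y² v(y,τ) dy = Θ₀ for all τ. Let B_p be the Barenblatt profile of unit mass and second moment Θ₀, with half-width parameter σ satisfying σ = √Θ₀ / ( p √(2 I_p(B_p)) ). Then for every τ ∈ (0,T): (d/dτ) [ R_p(B_p) − R_p(v(·,τ)) ] ≤ −(2p/Θ₀) ( exp( 2 ( R_p(B_p) − R_p(v(·,τ)) ) ) − 1 ). -/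
open MeasureTheory Filter Set

/-- The `p`-logarithm: `ln_p u = (u^(p-1) - 1)/(p-1)` for `p ≠ 1`, and `ln u` for `p = 1`. -/
noncomputable def lnp (p : ℝ) (u : ℝ) : ℝ :=
  if p = 1 then Real.log u else (u ^ (p - 1) - 1) / (p - 1)

/-- Generalized Fisher information `I_p(f) = (1/2) ∫ f ((ln_p f)')²`. -/
noncomputable def fisherP (p : ℝ) (f : ℝ → ℝ) : ℝ :=
  (1 / 2) * ∫ x : ℝ, f x * (deriv (fun y => lnp p (f y)) x) ^ 2

/-- Rényi entropy of order `p ≠ 1`: `R_p(f) = (1/(1-p)) ln ∫ f^p`. -/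
noncomputable def renyi (p : ℝ) (f : ℝ → ℝ) : ℝ :=
  (1 / (1 - p)) * Real.log (∫ x : ℝ, f x ^ p)

/-- `f`, together with all its derivatives, decays faster than any polynomial at infinity. -/
def RapidDecay (f : ℝ → ℝ) : Prop :=
  ∀ n k : ℕ, Tendsto (fun x => x ^ n * iteratedDeriv k f x) (cocompact ℝ) (nhds 0)

/-- Pressure variables of a positive density `v` at a fixed time: `u = v^(p-1)`, `g = ∂_y ln_p v`
and the successive derivatives of `g`. -/
structure IsPressureProfile (p : ℝ) (v u g g₁ g₂ g₃ : ℝ → ℝ) : Prop where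
  v_pos : ∀ y, 0 < v y
  u_pos : ∀ y, 0 < u y
  hasDerivAt_v : ∀ y, HasDerivAt v (v y * g y / u y) y
  hasDerivAt_u : ∀ y, HasDerivAt u ((p - 1) * g y) y
  hasDerivAt_g : ∀ y, HasDerivAt g (g₁ y) y
  hasDerivAt_g₁ : ∀ y, HasDerivAt g₁ (g₂ y) y
  hasDerivAt_g₂ : ∀ y, HasDerivAt g₂ (g₃ y) y
  continuous_g₃ : Continuous g₃

/-- The parabolic cutoff `1 - (y/R)²`, used on `[-R, R]`. -/
noncomputable def parabolicCutoff (R y : ℝ) : ℝ := 1 - y ^ 2 / R ^ 2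

theorem hasDerivAt_parabolicCutoff (R y : ℝ) :
    HasDerivAt (parabolicCutoff R) (-(2 * y / R ^ 2)) y := by
  unfold parabolicCutoff
  exact (((hasDerivAt_pow 2 y).div_const (R ^ 2)).const_sub 1).congr_deriv (by norm_num)

@[fun_prop]
theorem continuous_parabolicCutoff (R : ℝ) : Continuous (parabolicCutoff R) := by
  unfold parabolicCutoff
  fun_prop

theorem parabolicCutoff_self {R : ℝ} (hR : 0 < R) : parabolicCutoff R R = 0 := by
  unfold parabolicCutoff; field_simp; ring

theorem parabolicCutoff_neg_self {R : ℝ} (hR : 0 < R) : parabolicCutoff R (-R) = 0 := by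
  unfold parabolicCutoff; field_simp; ring

theorem sq_div_sq_le_one {R y : ℝ} (hR : 0 < R) (hy : y ∈ Icc (-R) R) : y ^ 2 / R ^ 2 ≤ 1 := by
  rw [div_le_one (by positivity)]
  nlinarith [hy.1, hy.2]

theorem parabolicCutoff_mem {R y : ℝ} (hR : 0 < R) (hy : y ∈ Icc (-R) R) :
    0 ≤ parabolicCutoff R y ∧ parabolicCutoff R y ≤ 1 := by
  have h1 := sq_div_sq_le_one hR hy
  have h2 : 0 ≤ y ^ 2 / R ^ 2 := by positivity
  unfold parabolicCutoff
  constructor <;> linarith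

theorem abs_two_mul_div_sq_le {R y : ℝ} (hR : 1 ≤ R) (hy : y ∈ Icc (-R) R) :
    |2 * y / R ^ 2| ≤ 2 / R := by
  have hR0 : 0 < R := by linarith
  have : |y| ≤ R := abs_le.2 hy
  rw [abs_div, abs_mul, abs_of_pos (by norm_num : (0 : ℝ) < 2), abs_of_pos (by positivity :
    0 < R ^ 2), div_le_div_iff₀ (by positivity) hR0]
  nlinarith

/-- Integration by parts on `[-R, R]` without boundary terms. -/
theorem integral_eq_neg_of_hasDerivAt_add {R : ℝ} {f a b : ℝ → ℝ}
    (hf : ∀ y, HasDerivAt f (a y + b y) y) (ha : Continuous a) (hb : Continuous b)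
    (h1 : f R = 0) (h2 : f (-R) = 0) :
    ∫ y in (-R)..R, a y = -∫ y in (-R)..R, b y := by
  have h := intervalIntegral.integral_eq_sub_of_hasDerivAt (a := -R) (b := R) (fun y _ => hf y)
    ((ha.add hb).intervalIntegrable _ _)
  rw [intervalIntegral.integral_add (ha.intervalIntegrable _ _) (hb.intervalIntegrable _ _),
    h1, h2] at h
  linarith

theorem intervalIntegral_mono_of_continuous {R : ℝ} (hR : 0 ≤ R) {a b : ℝ → ℝ}
    (ha : Continuous a) (hb : Continuous b) (h : ∀ y ∈ Icc (-R) R, a y ≤ b y) :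
    ∫ y in (-R)..R, a y ≤ ∫ y in (-R)..R, b y :=
  intervalIntegral.integral_mono_on (by linarith) (ha.intervalIntegrable _ _)
    (hb.intervalIntegrable _ _) h

theorem intervalIntegral_le_integral {R : ℝ} (hR : 0 ≤ R) {f : ℝ → ℝ} (hf : Integrable f)
    (h0 : ∀ y, 0 ≤ f y) : ∫ y in (-R)..R, f y ≤ ∫ y, f y := by
  rw [intervalIntegral.integral_of_le (by linarith)]
  exact setIntegral_le_integral hf (Eventually.of_forall h0)

namespace IsPressureProfile

variable {p : ℝ} {v u g g₁ g₂ g₃ : ℝ → ℝ}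

theorem continuous_v (h : IsPressureProfile p v u g g₁ g₂ g₃) : Continuous v :=
  continuous_iff_continuousAt.2 fun y => (h.hasDerivAt_v y).continuousAt

theorem continuous_u (h : IsPressureProfile p v u g g₁ g₂ g₃) : Continuous u :=
  continuous_iff_continuousAt.2 fun y => (h.hasDerivAt_u y).continuousAt

theorem continuous_g (h : IsPressureProfile p v u g g₁ g₂ g₃) : Continuous g :=
  continuous_iff_continuousAt.2 fun y => (h.hasDerivAt_g y).continuousAt

theorem continuous_g₁ (h : IsPressureProfile p v u g g₁ g₂ g₃) : Continuous g₁ :=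
  continuous_iff_continuousAt.2 fun y => (h.hasDerivAt_g₁ y).continuousAt

theorem continuous_g₂ (h : IsPressureProfile p v u g g₁ g₂ g₃) : Continuous g₂ :=
  continuous_iff_continuousAt.2 fun y => (h.hasDerivAt_g₂ y).continuousAt

theorem hasDerivAt_vu (h : IsPressureProfile p v u g g₁ g₂ g₃) (y : ℝ) :
    HasDerivAt (fun y => v y * u y) (p * (v y * g y)) y := by
  have := (h.u_pos y).ne'
  exact ((h.hasDerivAt_v y).mul (h.hasDerivAt_u y)).congr_deriv (by field_simp; ring)

theorem hasDerivAt_vug₁ (h : IsPressureProfile p v u g g₁ g₂ g₃) (y : ℝ) :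
    HasDerivAt (fun y => v y * u y * g₁ y) (v y * (p * g y * g₁ y + u y * g₂ y)) y := by
  exact ((h.hasDerivAt_vu y).mul (h.hasDerivAt_g₁ y)).congr_deriv (by ring)

/-- `∫ η² v u g₁² ≤ 2ε ∫ η⁴ v j² + (1/ε + 32 U) I` for the velocity `j = p g g₁ + u g₂`. -/
theorem integral_sq_g₁_le (h : IsPressureProfile p v u g g₁ g₂ g₃) {R U I ε : ℝ} (hR : 1 ≤ R)
    (hU : ∀ y, u y ≤ U) (hε : 0 < ε)
    (hint : Integrable fun y => v y * g y ^ 2) (hI : ∫ y, v y * g y ^ 2 = 2 * I) :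
    ∫ y in (-R)..R, parabolicCutoff R y ^ 2 * (v y * u y * g₁ y ^ 2) ≤
      2 * ε * (∫ y in (-R)..R, parabolicCutoff R y ^ 4 *
        (v y * (p * g y * g₁ y + u y * g₂ y) ^ 2)) + (1 / ε + 32 * U) * I := by
  have hR0 : 0 < R := by linarith
  have hv := h.continuous_v
  have hu := h.continuous_u
  have hg := h.continuous_g
  have hg1 := h.continuous_g₁
  have hg2 := h.continuous_g₂
  have hη := continuous_parabolicCutoff R
  have hkey := integral_eq_neg_of_hasDerivAt_add (R := R)
    (f := fun y => parabolicCutoff R y ^ 2 * (v y * u y * g₁ y * g y))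
    (a := fun y => parabolicCutoff R y ^ 2 * (v y * u y * g₁ y ^ 2))
    (b := fun y => parabolicCutoff R y ^ 2 * (v y * (p * g y * g₁ y + u y * g₂ y) * g y) -
      2 * parabolicCutoff R y * (2 * y / R ^ 2) * (v y * u y * g₁ y * g y))
    (fun y => (((hasDerivAt_parabolicCutoff R y).pow 2).mul
        ((h.hasDerivAt_vug₁ y).mul (h.hasDerivAt_g y))).congr_deriv (by
          simp only [Pi.mul_apply, Pi.pow_apply]; norm_num; ring)) (by fun_prop) (by fun_prop)
    (by simp [parabolicCutoff_self hR0]) (by simp [parabolicCutoff_neg_self hR0])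
  have hmono := intervalIntegral_mono_of_continuous (R := R) hR0.le
    (a := fun y => -(parabolicCutoff R y ^ 2 * (v y * (p * g y * g₁ y + u y * g₂ y) * g y) -
      2 * parabolicCutoff R y * (2 * y / R ^ 2) * (v y * u y * g₁ y * g y)))
    (b := fun y => (1 / 2) * (parabolicCutoff R y ^ 2 * (v y * u y * g₁ y ^ 2)) +
      (ε * (parabolicCutoff R y ^ 4 * (v y * (p * g y * g₁ y + u y * g₂ y) ^ 2)) +
      (1 / (4 * ε) + 8 * U) * (v y * g y ^ 2))) (by fun_prop) (by fun_prop)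
    (fun y hy => by
      have hv0 := h.v_pos y
      have hu0 := h.u_pos y
      set j := p * g y * g₁ y + u y * g₂ y
      set e := parabolicCutoff R y
      set d := 2 * y / R ^ 2
      have hd : |d| ≤ 2 := (abs_two_mul_div_sq_le hR hy).trans (by
        rw [div_le_iff₀ hR0]; linarith)
      have hd2 : d ^ 2 ≤ 4 := by nlinarith [abs_le.1 hd, sq_abs d, abs_nonneg d]
      have e1 : -(e ^ 2 * (v y * j * g y)) ≤ ε * (e ^ 4 * (v y * j ^ 2)) +
          1 / (4 * ε) * (v y * g y ^ 2) := by
        have : 0 ≤ v y * (1 / ε) * (ε * e ^ 2 * j + g y / 2) ^ 2 := by positivity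
        have h2 : v y * (1 / ε) * (ε * e ^ 2 * j + g y / 2) ^ 2 = ε * (e ^ 4 * (v y * j ^ 2)) +
          1 / (4 * ε) * (v y * g y ^ 2) + (e ^ 2 * (v y * j * g y)) := by field_simp; ring
        linarith
      have e2 : 2 * e * d * (v y * u y * g₁ y * g y) ≤
          (1 / 2) * (e ^ 2 * (v y * u y * g₁ y ^ 2)) + 8 * U * (v y * g y ^ 2) := by
        have : 0 ≤ v y * u y * (e * g₁ y - 2 * d * g y) ^ 2 := by positivity
        have h3 : v y * u y * d ^ 2 * g y ^ 2 ≤ v y * U * 4 * g y ^ 2 := by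
          have := hU y
          have : 0 < U := by linarith
          gcongr
        nlinarith
      nlinarith)
  rw [intervalIntegral.integral_neg, ← hkey] at hmono
  rw [intervalIntegral.integral_add (Continuous.intervalIntegrable (by fun_prop) _ _)
      (Continuous.intervalIntegrable (by fun_prop) _ _),
    intervalIntegral.integral_add (Continuous.intervalIntegrable (by fun_prop) _ _)
      (Continuous.intervalIntegrable (by fun_prop) _ _), intervalIntegral.integral_const_mul,
    intervalIntegral.integral_const_mul, intervalIntegral.integral_const_mul] at hmono
  have hle := intervalIntegral_le_integral hR0.le hint
    fun y => mul_nonneg (h.v_pos y).le (sq_nonneg _)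
  rw [hI] at hle
  have hU0 : 0 < U := (h.u_pos 0).trans_le (hU 0)
  have := mul_le_mul_of_nonneg_left hle (show 0 ≤ 1 / (4 * ε) + 8 * U by positivity)
  have h4 : (1 / (4 * ε) + 8 * U) * (2 * I) * 2 = (1 / ε + 32 * U) * I := by field_simp; ring
  linarith

/-- `∫ η² v g⁴ ≤ 18 U ∫ η² v u g₁² + 64 U² I`. -/
theorem integral_g_pow_four_le (h : IsPressureProfile p v u g g₁ g₂ g₃) {R U I : ℝ} (hp : 1 < p)
    (hR : 1 ≤ R) (hU : ∀ y, u y ≤ U)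
    (hint : Integrable fun y => v y * g y ^ 2) (hI : ∫ y, v y * g y ^ 2 = 2 * I) :
    ∫ y in (-R)..R, parabolicCutoff R y ^ 2 * (v y * g y ^ 4) ≤
      18 * U * (∫ y in (-R)..R, parabolicCutoff R y ^ 2 * (v y * u y * g₁ y ^ 2)) +
        64 * U ^ 2 * I := by
  have hR0 : 0 < R := by linarith
  have hv := h.continuous_v
  have hu := h.continuous_u
  have hg := h.continuous_g
  have hg1 := h.continuous_g₁
  have hη := continuous_parabolicCutoff R
  have hkey := integral_eq_neg_of_hasDerivAt_add (R := R)
    (f := fun y => parabolicCutoff R y ^ 2 * (v y * u y * g y ^ 3))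
    (a := fun y => p * (parabolicCutoff R y ^ 2 * (v y * g y ^ 4)))
    (b := fun y => 3 * parabolicCutoff R y ^ 2 * (v y * u y * g y ^ 2 * g₁ y) -
      2 * parabolicCutoff R y * (2 * y / R ^ 2) * (v y * u y * g y ^ 3))
    (fun y => (((hasDerivAt_parabolicCutoff R y).pow 2).mul
        ((h.hasDerivAt_vu y).mul ((h.hasDerivAt_g y).pow 3))).congr_deriv (by
          simp only [Pi.mul_apply, Pi.pow_apply]; norm_num; ring)) (by fun_prop) (by fun_prop)
    (by simp [parabolicCutoff_self hR0]) (by simp [parabolicCutoff_neg_self hR0])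
  have hmono := intervalIntegral_mono_of_continuous (R := R) hR0.le
    (a := fun y => -(3 * parabolicCutoff R y ^ 2 * (v y * u y * g y ^ 2 * g₁ y) -
      2 * parabolicCutoff R y * (2 * y / R ^ 2) * (v y * u y * g y ^ 3)))
    (b := fun y => (1 / 2) * (parabolicCutoff R y ^ 2 * (v y * g y ^ 4)) +
      (9 * U * (parabolicCutoff R y ^ 2 * (v y * u y * g₁ y ^ 2)) +
      16 * U ^ 2 * (v y * g y ^ 2))) (by fun_prop) (by fun_prop)
    (fun y hy => by
      have hv0 := h.v_pos y
      have hu0 := h.u_pos y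
      have hUy := hU y
      set e := parabolicCutoff R y
      set d := 2 * y / R ^ 2
      have hd : |d| ≤ 2 := (abs_two_mul_div_sq_le hR hy).trans (by
        rw [div_le_iff₀ hR0]; linarith)
      have hd2 : d ^ 2 ≤ 4 := by nlinarith [abs_le.1 hd, sq_abs d, abs_nonneg d]
      have e1 : -(3 * e ^ 2 * (v y * u y * g y ^ 2 * g₁ y)) ≤ (1 / 4) * (e ^ 2 * (v y * g y ^ 4)) +
          9 * U * (e ^ 2 * (v y * u y * g₁ y ^ 2)) := by
        have : 0 ≤ v y * e ^ 2 * (g y ^ 2 / 2 + 3 * u y * g₁ y) ^ 2 := by positivity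
        have h3 : e ^ 2 * v y * u y * g₁ y ^ 2 * u y ≤ e ^ 2 * v y * u y * g₁ y ^ 2 * U := by
          gcongr
        nlinarith
      have e2 : 2 * e * d * (v y * u y * g y ^ 3) ≤
          (1 / 4) * (e ^ 2 * (v y * g y ^ 4)) + 16 * U ^ 2 * (v y * g y ^ 2) := by
        have : 0 ≤ v y * g y ^ 2 * (e * g y / 2 - 2 * d * u y) ^ 2 := by positivity
        have h3 : v y * u y ^ 2 * d ^ 2 * g y ^ 2 ≤ v y * U ^ 2 * 4 * g y ^ 2 := by
          gcongr
        nlinarith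
      nlinarith)
  rw [intervalIntegral.integral_neg, ← hkey] at hmono
  rw [intervalIntegral.integral_add (Continuous.intervalIntegrable (by fun_prop) _ _)
      (Continuous.intervalIntegrable (by fun_prop) _ _),
    intervalIntegral.integral_add (Continuous.intervalIntegrable (by fun_prop) _ _)
      (Continuous.intervalIntegrable (by fun_prop) _ _), intervalIntegral.integral_const_mul,
    intervalIntegral.integral_const_mul, intervalIntegral.integral_const_mul,
    intervalIntegral.integral_const_mul] at hmono
  have hle := intervalIntegral_le_integral hR0.le hint
    fun y => mul_nonneg (h.v_pos y).le (sq_nonneg _)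
  rw [hI] at hle
  have hA : 0 ≤ ∫ y in (-R)..R, parabolicCutoff R y ^ 2 * (v y * g y ^ 4) :=
    intervalIntegral.integral_nonneg (by linarith) fun y _ =>
      mul_nonneg (sq_nonneg _) (mul_nonneg (h.v_pos y).le (by positivity))
  have := mul_le_mul_of_nonneg_left hle (show 0 ≤ 16 * U ^ 2 by positivity)
  nlinarith

end IsPressureProfile

theorem cutoff_error_sq_le {p e d k u g g₁ z : ℝ} (hp : 1 < p) (hp2 : p ≤ 3 / 2)
    (he0 : 0 ≤ e) (he1 : e ≤ 1) (hd2 : d ^ 2 ≤ 4) (hdd : |k| ≤ 2)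
    (hz : z = 4 * e * (-d) * ((p - 1 / 2) * g ^ 2 + 2 * (u * g₁)) +
      (12 * d ^ 2 - 4 * e * k) * (u * g)) :
    z ^ 2 ≤ 192 * (e ^ 2 * g ^ 4) + 768 * (e ^ 2 * (u ^ 2 * g₁ ^ 2)) +
      9408 * (u ^ 2 * g ^ 2) := by
  have hab : |(12 * d ^ 2 - 4 * e * k)| ≤ 56 := by
    rw [abs_le] at hdd ⊢
    constructor <;> nlinarith
  set a1 := 4 * e * (-d) * ((p - 1 / 2) * g ^ 2)
  set a2 := 4 * e * (-d) * (2 * (u * g₁))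
  set a3 := (12 * d ^ 2 - 4 * e * k) * (u * g)
  have hza : z = a1 + a2 + a3 := by simp only [hz, a1, a2, a3]; ring
  have h1 : a1 ^ 2 ≤ 64 * (e ^ 2 * g ^ 4) := by
    have : a1 ^ 2 = 16 * (d ^ 2 * (p - 1 / 2) ^ 2) * (e ^ 2 * g ^ 4) := by
      simp only [a1]; ring
    rw [this]
    have : d ^ 2 * (p - 1 / 2) ^ 2 ≤ 4 * 1 := by
      gcongr
      nlinarith
    have h0 : 0 ≤ e ^ 2 * g ^ 4 := by positivity
    nlinarith
  have h2 : a2 ^ 2 ≤ 256 * (e ^ 2 * (u ^ 2 * g₁ ^ 2)) := by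
    have : a2 ^ 2 = 64 * d ^ 2 * (e ^ 2 * (u ^ 2 * g₁ ^ 2)) := by
      simp only [a2]; ring
    rw [this]
    have h0 : 0 ≤ e ^ 2 * (u ^ 2 * g₁ ^ 2) := by positivity
    nlinarith
  have h3 : a3 ^ 2 ≤ 3136 * (u ^ 2 * g ^ 2) := by
    have : a3 ^ 2 = |(12 * d ^ 2 - 4 * e * k)| ^ 2 * (u ^ 2 * g ^ 2) := by
      rw [sq_abs]; simp only [a3]; ring
    rw [this]
    have h0 : 0 ≤ u ^ 2 * g ^ 2 := by positivity
    have : |(12 * d ^ 2 - 4 * e * k)| ^ 2 ≤ 56 ^ 2 := by gcongr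
    nlinarith
  rw [hza]
  nlinarith [sq_nonneg (a1 - a2), sq_nonneg (a1 - a3), sq_nonneg (a2 - a3)]

theorem mul_cutoff_error_le {p e d k y u g g₁ z : ℝ} (hp : 1 < p) (hp2 : p ≤ 3 / 2)
    (he0 : 0 ≤ e) (he1 : e ≤ 1) (hu0 : 0 < u) (hd1 : |d| ≤ 2) (hyd : |y * d| ≤ 2)
    (hydd : |y * k| ≤ 2)
    (hz : z = 4 * e * (-d) * ((p - 1 / 2) * g ^ 2 + 2 * (u * g₁)) +
      (12 * d ^ 2 - 4 * e * k) * (u * g)) :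
    y * (e ^ 2 * z) ≤ 36 * g ^ 2 + 8 * (e ^ 2 * (u * g₁ ^ 2)) + (8 * u + 28 * u ^ 2) := by
  have q1 : y * e ^ 2 * (4 * e * (-d) * ((p - 1 / 2) * g ^ 2)) ≤ 8 * g ^ 2 := by
    have : y * e ^ 2 * (4 * e * (-d) * ((p - 1 / 2) * g ^ 2)) =
      4 * (e ^ 3 * (p - 1 / 2) * (-(y * d))) * g ^ 2 := by ring
    rw [this]
    have h5 : e ^ 3 * (p - 1 / 2) ≤ 1 * 1 := by
      gcongr
      · linarith
      · exact pow_le_one₀ he0 he1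
      · linarith
    have h6 : 0 ≤ e ^ 3 * (p - 1 / 2) := mul_nonneg (by positivity) (by linarith)
    have h7 : e ^ 3 * (p - 1 / 2) * (-(y * d)) ≤ 2 := by
      have := (abs_le.1 hyd).1
      nlinarith
    have h8 := mul_le_mul_of_nonneg_right h7 (sq_nonneg (g))
    linarith
  have q2 : y * e ^ 2 * (4 * e * (-d) * (2 * (u * g₁))) ≤
      8 * (e ^ 2 * (u * g₁ ^ 2)) + 8 * u := by
    have h5 : |8 * e ^ 2 * (-(y * d))| ≤ 16 := by
      rw [abs_mul, abs_neg, abs_of_nonneg (by positivity : 0 ≤ 8 * e ^ 2)]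
      have : e ^ 2 ≤ 1 := pow_le_one₀ he0 he1
      nlinarith [abs_nonneg (y * d), sq_nonneg e]
    have h6 : y * e ^ 2 * (4 * e * (-d) * (2 * (u * g₁))) =
      u * (8 * e ^ 2 * (-(y * d)) * (e * g₁)) := by ring
    have h7 : 8 * e ^ 2 * (-(y * d)) * (e * g₁) ≤ 16 * |e * g₁| := by
      refine (le_abs_self _).trans ?_
      rw [abs_mul]
      gcongr
    have h8 : 16 * |e * g₁| ≤ 8 * (e * g₁) ^ 2 + 8 := by
      nlinarith [sq_nonneg (|e * g₁| - 1), sq_abs (e * g₁)]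
    rw [h6]
    nlinarith
  have q3 : y * e ^ 2 * ((12 * d ^ 2 - 4 * e * k) * (u * g)) ≤
      28 * u ^ 2 + 28 * g ^ 2 := by
    have h5 : |e ^ 2 * (12 * (y * d) * d - 4 * e * (y * k))| ≤ 56 := by
      rw [abs_mul, abs_of_nonneg (by positivity : 0 ≤ e ^ 2)]
      have : e ^ 2 ≤ 1 := pow_le_one₀ he0 he1
      have h6 : |12 * (y * d) * d - 4 * e * (y * k)| ≤ 56 := by
        have h7 : |y * d * d| ≤ 2 * 2 := by rw [abs_mul]; gcongr
        have h8 : |e * (y * k)| ≤ 1 * 2 := by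
          rw [abs_mul, abs_of_nonneg he0]; gcongr
        rw [abs_le] at h7 h8 ⊢
        constructor <;> linarith [h7.1, h7.2, h8.1, h8.2]
      nlinarith [abs_nonneg (12 * (y * d) * d - 4 * e * (y * k))]
    have h6 : y * e ^ 2 * ((12 * d ^ 2 - 4 * e * k) * (u * g)) =
      e ^ 2 * (12 * (y * d) * d - 4 * e * (y * k)) * (u * g) := by ring
    have h7 : e ^ 2 * (12 * (y * d) * d - 4 * e * (y * k)) * (u * g) ≤
        56 * |u * g| := by
      refine (le_abs_self _).trans ?_
      rw [abs_mul]
      gcongr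
    have h8 : |u * g| ≤ (u ^ 2 + g ^ 2) / 2 := by
      rw [abs_le]
      constructor <;> nlinarith [sq_nonneg (u - g), sq_nonneg (u + g)]
    rw [h6]
    linarith
  have : y * (e ^ 2 * z) = y * e ^ 2 * (4 * e * (-d) * ((p - 1 / 2) * g ^ 2)) +
    y * e ^ 2 * (4 * e * (-d) * (2 * (u * g₁))) +
    y * e ^ 2 * ((12 * d ^ 2 - 4 * e * k) * (u * g)) := by rw [hz]; ring
  linarith

theorem dissipation_integrand_le {c e I U j v u g g₁ y z : ℝ} (hc : 0 ≤ c) (hI0 : 0 < I)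
    (he0 : 0 ≤ e) (he1 : e ≤ 1) (hv0 : 0 < v) (hu0 : 0 < u) (hUy : u ≤ U)
    (hz2 : z ^ 2 ≤ 192 * (e ^ 2 * g ^ 4) + 768 * (e ^ 2 * (u ^ 2 * g₁ ^ 2)) +
      9408 * (u ^ 2 * g ^ 2))
    (hyz : y * (e ^ 2 * z) ≤ 36 * g ^ 2 + 8 * (e ^ 2 * (u * g₁ ^ 2)) + (8 * u + 28 * u ^ 2)) :
    -(v * (j / I - c * y) * (e ^ 4 * j + e ^ 2 * z)) ≤
      -(1 / (2 * I)) * (e ^ 4 * (v * j ^ 2)) + (192 / I * (e ^ 2 * (v * g ^ 4)) +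
      ((768 * U / I + 8 * c) * (e ^ 2 * (v * u * g₁ ^ 2)) +
      ((9408 * U ^ 2 / I + 36 * c) * (v * g ^ 2) +
      (c ^ 2 * I * (y ^ 2 * v) + c * (8 * U + 28 * U ^ 2) * v)))) := by
  have he4 : e ^ 4 ≤ 1 := pow_le_one₀ he0 he1
  have t1 : -(j / I * (e ^ 2 * z)) ≤ 1 / (4 * I) * (e ^ 4 * j ^ 2) + 1 / I * z ^ 2 := by
    have : 0 ≤ 1 / I * (e ^ 2 * j / 2 + z) ^ 2 := by positivity
    have h2 : 1 / I * (e ^ 2 * j / 2 + z) ^ 2 = 1 / (4 * I) * (e ^ 4 * j ^ 2) + 1 / I * z ^ 2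
      + j / I * (e ^ 2 * z) := by field_simp; ring
    linarith
  have t2 : c * y * (e ^ 4 * j) ≤ 1 / (4 * I) * (e ^ 4 * j ^ 2) + c ^ 2 * I * y ^ 2 := by
    have : 0 ≤ e ^ 4 * (1 / I) * (j / 2 - c * I * y) ^ 2 := by positivity
    have h2 : e ^ 4 * (1 / I) * (j / 2 - c * I * y) ^ 2 = 1 / (4 * I) * (e ^ 4 * j ^ 2) +
      e ^ 4 * (c ^ 2 * I * y ^ 2) - c * y * (e ^ 4 * j) := by field_simp; ring
    have h3 : 0 ≤ c ^ 2 * I * y ^ 2 := by positivity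
    nlinarith
  have t3 : c * (y * (e ^ 2 * z)) ≤ c * (36 * g ^ 2 + 8 * (e ^ 2 * (u * g₁ ^ 2)) +
      (8 * U + 28 * U ^ 2)) := by
    refine mul_le_mul_of_nonneg_left (hyz.trans ?_) hc
    gcongr
  have t4 : 1 / I * z ^ 2 ≤ 1 / I * (192 * (e ^ 2 * g ^ 4) +
      768 * (e ^ 2 * (U * u * g₁ ^ 2)) + 9408 * (U ^ 2 * g ^ 2)) := by
    refine mul_le_mul_of_nonneg_left (hz2.trans ?_) (by positivity)
    rw [show u ^ 2 * g₁ ^ 2 = u * u * g₁ ^ 2 by ring]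
    gcongr
  have key : -((j / I - c * y) * (e ^ 4 * j + e ^ 2 * z)) ≤
      -(1 / (2 * I)) * (e ^ 4 * j ^ 2) +
      (1 / I * (192 * (e ^ 2 * g ^ 4) +
      768 * (e ^ 2 * (U * u * g₁ ^ 2)) + 9408 * (U ^ 2 * g ^ 2)) +
      (c ^ 2 * I * y ^ 2 + c * (36 * g ^ 2 + 8 * (e ^ 2 * (u * g₁ ^ 2)) +
      (8 * U + 28 * U ^ 2)))) := by
    have h2 : -((j / I - c * y) * (e ^ 4 * j + e ^ 2 * z)) = -(1 / I) * (e ^ 4 * j ^ 2)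
      + -(j / I * (e ^ 2 * z)) + c * y * (e ^ 4 * j) + c * (y * (e ^ 2 * z)) := by ring
    have h3 : -(1 / (2 * I)) * (e ^ 4 * j ^ 2) = -(1 / I) * (e ^ 4 * j ^ 2) +
      1 / (4 * I) * (e ^ 4 * j ^ 2) + 1 / (4 * I) * (e ^ 4 * j ^ 2) := by
      field_simp; ring
    linarith
  have := mul_le_mul_of_nonneg_left key hv0.le
  refine (le_of_eq ?_).trans (this.trans (le_of_eq ?_)) <;> ring

namespace IsPressureProfile

variable {p : ℝ} {v u g g₁ g₂ g₃ : ℝ → ℝ}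

theorem hasDerivAt_velocity (h : IsPressureProfile p v u g g₁ g₂ g₃) (y : ℝ) :
    HasDerivAt (fun y => p * g y * g₁ y + u y * g₂ y)
      (p * g₁ y ^ 2 + (2 * p - 1) * (g y * g₂ y) + u y * g₃ y) y :=
  ((((h.hasDerivAt_g y).const_mul p).mul (h.hasDerivAt_g₁ y)).add
    ((h.hasDerivAt_u y).mul (h.hasDerivAt_g₂ y))).congr_deriv (by ring)

theorem hasDerivAt_momentum (h : IsPressureProfile p v u g g₁ g₂ g₃) (y : ℝ) :
    HasDerivAt (fun y => v y * (p * g y * g₁ y + u y * g₂ y))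
      (v y * g y / u y * (p * g y * g₁ y + u y * g₂ y) +
        v y * (p * g₁ y ^ 2 + (2 * p - 1) * (g y * g₂ y) + u y * g₃ y)) y :=
  (h.hasDerivAt_v y).mul (h.hasDerivAt_velocity y)

/-- Integrated form of the time derivative of the localized Fisher information. -/
theorem integral_fisher_variation (h : IsPressureProfile p v u g g₁ g₂ g₃) {R I c : ℝ}
    (hR0 : 0 < R) {m ℓ₁ : ℝ → ℝ}
    (hm : ∀ y, HasDerivAt
      (fun y => v y * ((p * g y * g₁ y + u y * g₂ y) / I - c * y)) (-m y) y)
    (hmc : Continuous m)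
    (hℓ : ∀ y, HasDerivAt (fun y => u y * m y / v y) (ℓ₁ y) y) (hℓc : Continuous ℓ₁) :
    ∫ y in (-R)..R, parabolicCutoff R y ^ 4 * (m y * g y ^ 2 / 2 + v y * g y * ℓ₁ y) =
      -∫ y in (-R)..R, v y * ((p * g y * g₁ y + u y * g₂ y) / I - c * y) *
        (parabolicCutoff R y ^ 4 * (p * g y * g₁ y + u y * g₂ y) +
          (4 * parabolicCutoff R y ^ 3 * (-(2 * y / R ^ 2)) *
            ((p - 1 / 2) * g y ^ 2 + 2 * (u y * g₁ y)) +
          (12 * parabolicCutoff R y ^ 2 * (2 * y / R ^ 2) ^ 2 -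
            4 * parabolicCutoff R y ^ 3 * (2 / R ^ 2)) * (u y * g y))) := by
  have hv := h.continuous_v
  have hu := h.continuous_u
  have hg := h.continuous_g
  have hg1 := h.continuous_g₁
  have hg2 := h.continuous_g₂
  have hη := continuous_parabolicCutoff R
  refine integral_eq_neg_of_hasDerivAt_add (R := R)
    (f := fun y => parabolicCutoff R y ^ 4 * (v y * g y * (u y * m y / v y)) -
      v y * ((p * g y * g₁ y + u y * g₂ y) / I - c * y) *
      (parabolicCutoff R y ^ 4 * (-(g y ^ 2 / 2 + u y * g₁ y)) -
        4 * parabolicCutoff R y ^ 3 * (-(2 * y / R ^ 2)) * (u y * g y)))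
    (fun y => ?_) (by fun_prop) (by fun_prop)
    (by simp [parabolicCutoff_self hR0]) (by simp [parabolicCutoff_neg_self hR0])
  have hη' := hasDerivAt_parabolicCutoff R y
  have hv' := h.hasDerivAt_v y
  have hu' := h.hasDerivAt_u y
  have hg' := h.hasDerivAt_g y
  have hg1' := h.hasDerivAt_g₁ y
  have hd : HasDerivAt (fun y : ℝ => -(2 * y / R ^ 2)) (-(2 / R ^ 2)) y := by
    exact ((((hasDerivAt_id y).const_mul 2).div_const (R ^ 2)).neg).congr_deriv (by simp)
  have hf1 : HasDerivAt (fun y => parabolicCutoff R y ^ 4 * (v y * g y * (u y * m y / v y)))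
      (4 * parabolicCutoff R y ^ 3 * (-(2 * y / R ^ 2)) * (g y * u y * m y) +
        parabolicCutoff R y ^ 4 * (m y * (g y ^ 2 + u y * g₁ y) + v y * g y * ℓ₁ y)) y :=
    ((hη'.pow 4).mul ((hv'.mul hg').mul (hℓ y))).congr_deriv (by
      have := (h.u_pos y).ne'
      have := (h.v_pos y).ne'
      simp only [Pi.mul_apply, Pi.pow_apply]; norm_num; field_simp)
  have hΨ : HasDerivAt (fun y => parabolicCutoff R y ^ 4 * (-(g y ^ 2 / 2 + u y * g₁ y)) -
        4 * parabolicCutoff R y ^ 3 * (-(2 * y / R ^ 2)) * (u y * g y))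
      (-(parabolicCutoff R y ^ 4 * (p * g y * g₁ y + u y * g₂ y) +
          (4 * parabolicCutoff R y ^ 3 * (-(2 * y / R ^ 2)) *
            ((p - 1 / 2) * g y ^ 2 + 2 * (u y * g₁ y)) +
          (12 * parabolicCutoff R y ^ 2 * (2 * y / R ^ 2) ^ 2 -
            4 * parabolicCutoff R y ^ 3 * (2 / R ^ 2)) * (u y * g y)))) y :=
    (((hη'.pow 4).mul ((((hg'.pow 2).div_const 2).add (hu'.mul hg1')).neg)).sub
      ((((hη'.pow 3).const_mul 4).mul hd).mul (hu'.mul hg'))).congr_deriv (by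
      simp only [Pi.mul_apply, Pi.pow_apply, Pi.neg_apply, Pi.add_apply]; norm_num; ring)
  exact (hf1.sub ((hm y).mul hΨ)).congr_deriv (by ring)

/-- The localized Fisher information dissipates `η⁴ v j²`, up to a constant which does not depend
on the cutoff radius. -/
theorem integral_fisher_variation_le (h : IsPressureProfile p v u g g₁ g₂ g₃)
    {R U I I₁ c Θ : ℝ} (hp : 1 < p) (hp2 : p ≤ 3 / 2)
    (hR : 1 ≤ R) (hU : ∀ y, u y ≤ U) (hU1 : 1 ≤ U) (hI0 : 0 < I) (hI1 : I ≤ I₁) (hc : 0 ≤ c)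
    (hint : Integrable fun y => v y * g y ^ 2) (hI : ∫ y, v y * g y ^ 2 = 2 * I)
    (hmass : Integrable v) (hmass1 : ∫ y, v y = 1)
    (hmom : Integrable fun y => y ^ 2 * v y) (hmomΘ : ∫ y, y ^ 2 * v y = Θ)
    {m ℓ₁ : ℝ → ℝ}
    (hm : ∀ y, HasDerivAt
      (fun y => v y * ((p * g y * g₁ y + u y * g₂ y) / I - c * y)) (-m y) y)
    (hmc : Continuous m)
    (hℓ : ∀ y, HasDerivAt (fun y => u y * m y / v y) (ℓ₁ y) y) (hℓc : Continuous ℓ₁) :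
    ∫ y in (-R)..R, parabolicCutoff R y ^ 4 * (m y * g y ^ 2 / 2 + v y * g y * ℓ₁ y) ≤
      -(1 / (4 * I₁)) * (∫ y in (-R)..R, parabolicCutoff R y ^ 4 *
        (v y * (p * g y * g₁ y + u y * g₂ y) ^ 2)) +
      ((4224 * U + 8 * c * I₁) * (8 * (4224 * U + 8 * c * I₁) + 32 * U) + 31104 * U ^ 2 +
        c ^ 2 * I₁ * Θ + c * (72 * I₁ + 8 * U + 28 * U ^ 2)) := by
  have hR0 : 0 < R := by linarith
  have hv := h.continuous_v
  have hu := h.continuous_u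
  have hg := h.continuous_g
  have hg1 := h.continuous_g₁
  have hg2 := h.continuous_g₂
  have hη := continuous_parabolicCutoff R
  rw [h.integral_fisher_variation hR0 hm hmc hℓ hℓc, ← intervalIntegral.integral_neg]
  have hmono := intervalIntegral_mono_of_continuous (R := R) hR0.le
    (a := fun y => -(v y * ((p * g y * g₁ y + u y * g₂ y) / I - c * y) *
        (parabolicCutoff R y ^ 4 * (p * g y * g₁ y + u y * g₂ y) +
          (4 * parabolicCutoff R y ^ 3 * (-(2 * y / R ^ 2)) *
            ((p - 1 / 2) * g y ^ 2 + 2 * (u y * g₁ y)) +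
          (12 * parabolicCutoff R y ^ 2 * (2 * y / R ^ 2) ^ 2 -
            4 * parabolicCutoff R y ^ 3 * (2 / R ^ 2)) * (u y * g y)))))
    (b := fun y => -(1 / (2 * I)) * (parabolicCutoff R y ^ 4 *
        (v y * (p * g y * g₁ y + u y * g₂ y) ^ 2)) +
      (192 / I * (parabolicCutoff R y ^ 2 * (v y * g y ^ 4)) +
      ((768 * U / I + 8 * c) * (parabolicCutoff R y ^ 2 * (v y * u y * g₁ y ^ 2)) +
      ((9408 * U ^ 2 / I + 36 * c) * (v y * g y ^ 2) +
      (c ^ 2 * I * (y ^ 2 * v y) + c * (8 * U + 28 * U ^ 2) * v y)))))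
    (by fun_prop) (by fun_prop)
    (fun y hy => by
      have hv0 := h.v_pos y
      have hu0 := h.u_pos y
      have hUy := hU y
      obtain ⟨he0, he1⟩ := parabolicCutoff_mem hR0 hy
      have hd := (abs_two_mul_div_sq_le hR hy)
      have hyR : |y| ≤ R := abs_le.2 hy
      set j := p * g y * g₁ y + u y * g₂ y
      set e := parabolicCutoff R y
      set d := 2 * y / R ^ 2
      have hd1 : |d| ≤ 2 := hd.trans (by rw [div_le_iff₀ hR0]; linarith)
      have hyd : |y * d| ≤ 2 := by
        rw [abs_mul]
        calc |y| * |d| ≤ R * (2 / R) := by gcongr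
          _ = 2 := by field_simp
      have hd2 : d ^ 2 ≤ 4 := by nlinarith [abs_le.1 hd1, sq_abs d, abs_nonneg d]
      have hdd : |2 / R ^ 2| ≤ 2 := by
        rw [abs_of_pos (by positivity), div_le_iff₀ (by positivity)]; nlinarith
      have hydd : |y * (2 / R ^ 2)| ≤ 2 := by
        rw [show y * (2 / R ^ 2) = d by simp only [d]; ring]; exact hd1
      set k := 2 / R ^ 2
      set z := 4 * e * (-d) * ((p - 1 / 2) * g y ^ 2 + 2 * (u y * g₁ y)) +
          (12 * d ^ 2 - 4 * e * k) * (u y * g y) with hz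
      have hZ : 4 * e ^ 3 * (-d) * ((p - 1 / 2) * g y ^ 2 + 2 * (u y * g₁ y)) +
          (12 * e ^ 2 * d ^ 2 - 4 * e ^ 3 * k) * (u y * g y) = e ^ 2 * z := by
        rw [hz]; ring
      rw [hZ]
      exact dissipation_integrand_le hc hI0 he0 he1 hv0 hu0 hUy
        (cutoff_error_sq_le hp hp2 he0 he1 hd2 hdd hz)
        (mul_cutoff_error_le hp hp2 he0 he1 hu0 hd1 hyd hydd hz))
  refine hmono.trans ?_
  have hvi : ∀ {f : ℝ → ℝ}, Continuous f → IntervalIntegrable f volume (-R) R :=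
    fun hf => hf.intervalIntegrable _ _
  rw [intervalIntegral.integral_add (hvi (by fun_prop)) (hvi (by fun_prop)),
    intervalIntegral.integral_add (hvi (by fun_prop)) (hvi (by fun_prop)),
    intervalIntegral.integral_add (hvi (by fun_prop)) (hvi (by fun_prop)),
    intervalIntegral.integral_add (hvi (by fun_prop)) (hvi (by fun_prop)),
    intervalIntegral.integral_add (hvi (by fun_prop)) (hvi (by fun_prop))]
  simp only [intervalIntegral.integral_const_mul]
  set P := 4224 * U + 8 * c * I₁ with hP
  have hP0 : 0 < P := by
    have := mul_nonneg hc (hI0.le.trans hI1)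
    rw [hP]; nlinarith
  have hD := h.integral_sq_g₁_le hR hU (show 0 < 1 / (8 * P) by positivity) hint hI
  have hA := h.integral_g_pow_four_le hp hR hU hint hI
  have hF := intervalIntegral_le_integral hR0.le hint
    fun y => mul_nonneg (h.v_pos y).le (sq_nonneg _)
  have hM := intervalIntegral_le_integral hR0.le hmass fun y => (h.v_pos y).le
  have hS := intervalIntegral_le_integral hR0.le hmom
    fun y => mul_nonneg (sq_nonneg _) (h.v_pos y).le
  have hK0 : 0 ≤ ∫ y in (-R)..R, parabolicCutoff R y ^ 4 *
        (v y * (p * g y * g₁ y + u y * g₂ y) ^ 2) :=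
    intervalIntegral.integral_nonneg (by linarith) fun y _ =>
      mul_nonneg (by positivity) (mul_nonneg (h.v_pos y).le (by positivity))
  have hD0 : 0 ≤ ∫ y in (-R)..R, parabolicCutoff R y ^ 2 * (v y * u y * g₁ y ^ 2) :=
    intervalIntegral.integral_nonneg (by linarith) fun y _ =>
      mul_nonneg (by positivity)
        (mul_nonneg (mul_nonneg (h.v_pos y).le (h.u_pos y).le) (by positivity))
  rw [hI] at hF
  rw [hmass1] at hM
  rw [hmomΘ] at hS
  have hΘ0 : 0 ≤ Θ := hmomΘ ▸ integral_nonneg fun y => mul_nonneg (sq_nonneg _) (h.v_pos y).le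
  set K := ∫ y in (-R)..R, parabolicCutoff R y ^ 4 *
        (v y * (p * g y * g₁ y + u y * g₂ y) ^ 2)
  set D := ∫ y in (-R)..R, parabolicCutoff R y ^ 2 * (v y * u y * g₁ y ^ 2)
  set A := ∫ y in (-R)..R, parabolicCutoff R y ^ 2 * (v y * g y ^ 4)
  have hPI : (4224 * U / I + 8 * c) * I ≤ P := by
    rw [hP, add_mul, div_mul_cancel₀ _ hI0.ne']
    have := mul_le_mul_of_nonneg_left hI1 hc
    linarith
  have hPI' : 4224 * U / I + 8 * c ≤ P / I := by rwa [le_div_iff₀ hI0]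
  have s1 : 192 / I * A ≤ 192 / I * (18 * U * D + 64 * U ^ 2 * I) := by gcongr
  have s2 : (9408 * U ^ 2 / I + 36 * c) * (∫ y in (-R)..R, v y * g y ^ 2) ≤
      (9408 * U ^ 2 / I + 36 * c) * (2 * I) := by gcongr
  have s3 : c ^ 2 * I * (∫ y in (-R)..R, y ^ 2 * v y) ≤ c ^ 2 * I₁ * Θ := by
    have : 0 ≤ I₁ := hI0.le.trans hI1
    refine mul_le_mul (by gcongr) hS ?_ (by positivity)
    exact intervalIntegral.integral_nonneg (by linarith) fun y _ =>
      mul_nonneg (sq_nonneg _) (h.v_pos y).le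
  have s4 : c * (8 * U + 28 * U ^ 2) * (∫ y in (-R)..R, v y) ≤ c * (8 * U + 28 * U ^ 2) * 1 := by
    gcongr
  have s5 : (4224 * U / I + 8 * c) * D ≤ P / I * (2 * (1 / (8 * P)) * K +
      (1 / (1 / (8 * P)) + 32 * U) * I) := by gcongr
  have s6 : P / I * (2 * (1 / (8 * P)) * K + (1 / (1 / (8 * P)) + 32 * U) * I) =
      1 / (4 * I) * K + P * (8 * P + 32 * U) := by field_simp; ring
  have s7 : 1 / (4 * I₁) * K ≤ 1 / (4 * I) * K := by gcongr
  have s8 : 192 / I * (18 * U * D + 64 * U ^ 2 * I) = 3456 * U / I * D + 12288 * U ^ 2 := by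
    field_simp; ring
  have s9 : (9408 * U ^ 2 / I + 36 * c) * (2 * I) = 18816 * U ^ 2 + 72 * c * I := by
    field_simp; ring
  have s10 : (768 * U / I + 8 * c) * D + 3456 * U / I * D = (4224 * U / I + 8 * c) * D := by ring
  have s11 : -(1 / (2 * I)) * K + 1 / (4 * I) * K = -(1 / (4 * I) * K) := by field_simp; ring
  have s12 : c * I ≤ c * I₁ := by gcongr
  linarith

end IsPressureProfile

/-- A pressure profile of unit mass with second moment `Θ`, Fisher information `I` and
`∫ v^p = E`. -/
structure IsFiniteProfile (p Θ I E : ℝ) (v u g g₁ g₂ g₃ : ℝ → ℝ) : Prop extends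
    IsPressureProfile p v u g g₁ g₂ g₃ where
  u_eq : ∀ y, u y = v y ^ (p - 1)
  tendsto_v : Tendsto v (cocompact ℝ) (nhds 0)
  integrable_v : Integrable v
  integral_v : ∫ y, v y = 1
  integrable_moment : Integrable fun y => y ^ 2 * v y
  integral_moment : ∫ y, y ^ 2 * v y = Θ
  integrable_vu : Integrable fun y => v y * u y
  integral_vu : ∫ y, v y * u y = E
  integrable_fisher : Integrable fun y => v y * g y ^ 2
  integral_fisher : ∫ y, v y * g y ^ 2 = 2 * I
  fisher_pos : 0 < I

/-- Monotone transport of a positive density on the line to a density supported on `[-r, r]`. -/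
theorem exists_transport {v B : ℝ → ℝ} {r : ℝ} (hr : 0 < r) (hv : Continuous v)
    (hv0 : ∀ y, 0 < v y) (hvi : Integrable v) (hv1 : ∫ y, v y = 1) (hB : Continuous B)
    (hB0 : ∀ y, 0 ≤ B y) (hBpos : ∀ y ∈ Ioo (-r) r, 0 < B y) (hB1 : ∫ y in (-r)..r, B y = 1) :
    ∃ T : ℝ → ℝ, (∀ y, T y ∈ Ioo (-r) r) ∧ ∀ y, HasDerivAt T (v y / B (T y)) y := by
  set F : ℝ → ℝ := fun y => ∫ x in Iic y, v x with hF
  set G : ℝ → ℝ := fun y => ∫ x in (-r)..y, B x with hG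
  have hBi : ∀ a b, IntervalIntegrable B volume a b := fun a b => hB.intervalIntegrable _ _
  have hGd : ∀ y, HasDerivAt G (B y) y := fun y =>
    intervalIntegral.integral_hasDerivAt_right (hBi _ _) (hB.stronglyMeasurableAtFilter _ _)
      hB.continuousAt
  have hGc : Continuous G := continuous_iff_continuousAt.2 fun y => (hGd y).continuousAt
  have hFeq : ∀ y, F y = F 0 + ∫ x in (0 : ℝ)..y, v x := fun y => by
    rw [intervalIntegral.integral_Iic_sub_Iic hvi.integrableOn hvi.integrableOn |>.symm]
    ring
  have hFd : ∀ y, HasDerivAt F (v y) y := fun y => by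
    have : HasDerivAt (fun y => F 0 + ∫ x in (0 : ℝ)..y, v x) (v y) y :=
      (intervalIntegral.integral_hasDerivAt_right (hv.intervalIntegrable _ _)
        (hv.stronglyMeasurableAtFilter _ _) hv.continuousAt).const_add _
    exact this.congr_of_eventuallyEq (Eventually.of_forall hFeq)
  have hF0 : ∀ y, 0 < F y := fun y => by
    refine (setIntegral_pos_iff_support_of_nonneg_ae (Eventually.of_forall fun x => (hv0 x).le)
      hvi.integrableOn).2 ?_
    have : Function.support v = univ := by ext x; simp [(hv0 x).ne']
    rw [this]; simp
  have hF1 : ∀ y, F y < 1 := fun y => by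
    have h1 := integral_add_compl (measurableSet_Iic (a := y)) hvi
    have h2 : 0 < ∫ x in (Iic y)ᶜ, v x := by
      refine (setIntegral_pos_iff_support_of_nonneg_ae (Eventually.of_forall fun x => (hv0 x).le)
        hvi.integrableOn).2 ?_
      have : Function.support v = univ := by ext x; simp [(hv0 x).ne']
      rw [this]; simp
    rw [hv1] at h1
    simp only [hF]
    linarith
  have hGmono : Monotone G := monotone_of_hasDerivAt_nonneg hGd hB0
  have hGstrict : StrictMonoOn G (Icc (-r) r) := by
    refine strictMonoOn_of_deriv_pos (convex_Icc _ _) hGc.continuousOn fun x hx => ?_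
    rw [interior_Icc] at hx
    rw [(hGd x).deriv]
    exact hBpos x hx
  have hGr : G r = 1 := hB1
  have hGr' : G (-r) = 0 := by simp [hG]
  have hex : ∀ y, ∃ t ∈ Ioo (-r) r, G t = F y := fun y => by
    have := intermediate_value_Ioo (by linarith : -r ≤ r) hGc.continuousOn
    rw [hGr, hGr'] at this
    exact this ⟨hF0 y, hF1 y⟩
  choose T hT hGT using hex
  have hTc : Continuous T := by
    refine continuous_iff_continuousAt.2 fun y => tendsto_order.2 ⟨fun a ha => ?_, fun a ha => ?_⟩
    · have h1 : G a < F y := by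
        rw [← hGT y]
        refine (hGmono (le_max_left a (-r))).trans_lt (hGstrict ⟨le_max_right _ _, ?_⟩
          ⟨(hT y).1.le, (hT y).2.le⟩ (max_lt ha (hT y).1))
        exact max_le (ha.trans (hT y).2).le (by linarith)
      filter_upwards [(hFd y).continuousAt.eventually (lt_mem_nhds h1)] with z hz
      rw [← hGT z] at hz
      exact hGmono.reflect_lt hz
    · have h1 : F y < G a := by
        rw [← hGT y]
        refine (hGstrict ⟨(hT y).1.le, (hT y).2.le⟩ ⟨?_, min_le_right _ _⟩
          (lt_min ha (hT y).2)).trans_le (hGmono (min_le_left a r))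
        exact le_min ((hT y).1.trans ha).le (by linarith)
      filter_upwards [(hFd y).continuousAt.eventually (gt_mem_nhds h1)] with z hz
      rw [← hGT z] at hz
      exact hGmono.reflect_lt hz
  refine ⟨T, hT, fun y => ?_⟩
  have hBT := hBpos _ (hT y)
  have hsec : HasDerivAt (fun z => G (T z)) (v y) y :=
    (hFd y).congr_of_eventuallyEq (Eventually.of_forall hGT)
  have hslope := (hGd (T y))
  rw [hasDerivAt_iff_tendsto_slope] at hsec hslope ⊢
  have hTne : ∀ z, z ≠ y → T z ≠ T y := fun z hz he => by
    have hFs : StrictMono F := strictMono_of_deriv_pos fun x => by rw [(hFd x).deriv]; exact hv0 x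
    exact hz (hFs.injective (by rw [← hGT, ← hGT, he]))
  have hTt : Tendsto T (nhdsWithin y {y}ᶜ) (nhdsWithin (T y) {T y}ᶜ) :=
    tendsto_nhdsWithin_iff.2 ⟨hTc.continuousAt.tendsto.mono_left nhdsWithin_le_nhds,
      eventually_mem_nhdsWithin.mono fun z hz => hTne z hz⟩
  refine (hsec.div (hslope.comp hTt) hBT.ne').congr' ?_
  filter_upwards [eventually_mem_nhdsWithin, (hslope.comp hTt).eventually (lt_mem_nhds hBT)]
    with z hz hs
  have h1 : T z - T y ≠ 0 := sub_ne_zero.2 (hTne z hz)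
  have h2 : z - y ≠ 0 := sub_ne_zero.2 hz
  simp only [Function.comp, slope, vsub_eq_sub, smul_eq_mul] at hs ⊢
  have h3 : G (T z) - G (T y) ≠ 0 := fun h => by simp [h] at hs
  simp only [Pi.div_apply, Function.comp, slope, vsub_eq_sub, smul_eq_mul]
  field_simp

theorem rpow_div_mul_ge {p a t v : ℝ} (hp : 1 < p) (ha : 0 < a) (ht : 0 < t) (hv : 0 < v) :
    a ^ (1 - p) * (p * (v * v ^ (p - 1)) - (p - 1) / a * (v * v ^ (p - 1) * t)) ≤
      (v / t) ^ (p - 1) * v := by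
  have h1 : p - (p - 1) * (t / a) ≤ (t / a) ^ (1 - p) := by
    have hta : 0 < t / a := by positivity
    rw [Real.rpow_def_of_pos hta]
    have h2 := Real.add_one_le_exp (Real.log (t / a) * (1 - p))
    have h3 := Real.log_le_sub_one_of_pos hta
    nlinarith
  have h4 : (v / t) ^ (p - 1) = a ^ (1 - p) * v ^ (p - 1) * (t / a) ^ (1 - p) := by
    rw [Real.div_rpow hv.le ht.le, Real.div_rpow ht.le ha.le, ← neg_sub p 1, Real.rpow_neg ht.le,
      Real.rpow_neg ha.le]
    have := (Real.rpow_pos_of_pos ha (p - 1)).ne'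
    have := (Real.rpow_pos_of_pos ht (p - 1)).ne'
    field_simp
  rw [h4]
  have h5 : 0 < a ^ (1 - p) * v ^ (p - 1) * v := by positivity
  have := mul_le_mul_of_nonneg_left h1 h5.le
  refine (le_of_eq ?_).trans (this.trans (le_of_eq ?_)) <;> ring

theorem tendsto_neg_atTop_cocompact : Tendsto (fun R : ℝ => -R) atTop (cocompact ℝ) :=
  tendsto_neg_atTop_atBot.mono_right atBot_le_cocompact

namespace IsFiniteProfile

variable {p Θ I E : ℝ} {v u g g₁ g₂ g₃ : ℝ → ℝ}

theorem tendsto_vu (h : IsFiniteProfile p Θ I E v u g g₁ g₂ g₃) (hp : 1 < p) :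
    Tendsto (fun y => v y * u y) (cocompact ℝ) (nhds 0) := by
  have h1 := h.tendsto_v.rpow_const (p := p - 1) (Or.inr (by linarith))
  have h2 := h.tendsto_v.mul h1
  rw [zero_mul] at h2
  simpa only [h.u_eq] using h2

/-- The entropy production inequality: among profiles with second moment `Θ` and given entropy, the
Fisher information is bounded below through the entropy of any compactly supported density `B` with
the same mass and second moment. -/
theorem sharp_ineq (h : IsFiniteProfile p Θ I E v u g g₁ g₂ g₃) (hp : 1 < p) (hΘ : 0 < Θ)
    (hE : 0 < E) {B : ℝ → ℝ} {r : ℝ} (hr : 0 < r) (hB : Continuous B)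
    (hBpos : ∀ y ∈ Ioo (-r) r, 0 < B y) (hBzero : ∀ y, r ≤ |y| → B y = 0)
    (hB1 : ∫ y, B y = 1) (hBΘ : ∫ y, y ^ 2 * B y = Θ) :
    (p * √(2 * I * Θ) / E) ^ (1 - p) * E ≤ ∫ y, B y ^ p := by
  have hI := h.fisher_pos
  have hB0 : ∀ y, 0 ≤ B y := fun y => by
    by_cases hy : r ≤ |y|
    · exact (hBzero y hy).ge
    · exact (hBpos y (abs_lt.1 (not_le.1 hy))).le
  have hBBi : ∀ {φ : ℝ → ℝ}, Continuous φ → Integrable fun y => φ y * B y := fun {φ} hφ => by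
    refine (hφ.mul hB).integrable_of_hasCompactSupport ?_
    refine HasCompactSupport.intro (isCompact_Icc (a := -r) (b := r)) fun y hy => ?_
    rw [Pi.mul_apply, hBzero y, mul_zero]
    by_contra hc
    exact hy (abs_le.1 (not_le.1 hc).le)
  have hBi : Integrable B := by simpa using hBBi (continuous_const (y := (1 : ℝ)))
  have hB1' : ∫ y in (-r)..r, B y = 1 := by
    rw [← hB1, intervalIntegral.integral_of_le (by linarith)]
    refine setIntegral_eq_integral_of_forall_compl_eq_zero fun y hy => hBzero y ?_
    by_contra hc
    have := abs_lt.1 (not_le.1 hc)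
    exact hy ⟨this.1, this.2.le⟩
  obtain ⟨T, hT, hTd⟩ := exists_transport hr h.continuous_v h.v_pos h.integrable_v h.integral_v hB
    hB0 hBpos hB1'
  have hTc : Continuous T := continuous_iff_continuousAt.2 fun y => (hTd y).continuousAt
  have hBT : ∀ y, 0 < B (T y) := fun y => hBpos _ (hT y)
  have hv := h.continuous_v
  have hu := h.continuous_u
  have hg := h.continuous_g
  have hT'c : Continuous fun y => v y / B (T y) :=
    hv.div (hB.comp hTc) fun y => (hBT y).ne'
  have hTabs : ∀ y, |T y| ≤ r := fun y => abs_le.2 ⟨(hT y).1.le, (hT y).2.le⟩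
  have hTmono : Monotone T := monotone_of_hasDerivAt_nonneg hTd fun y =>
    (div_pos (h.v_pos y) (hBT y)).le
  -- change of variables
  have hcv : ∀ {φ : ℝ → ℝ}, Continuous φ → (∀ y, 0 ≤ φ y) → ∀ R, 0 ≤ R →
      ∫ y in (-R)..R, φ (T y) * v y ≤ ∫ y, φ y * B y := fun {φ} hφ hφ0 R hR => by
    have h1 := intervalIntegral.integral_comp_mul_deriv (a := -R) (b := R) (f := T)
      (f' := fun y => v y / B (T y)) (g := fun y => φ y * B y) (fun y _ => hTd y)
      hT'c.continuousOn (hφ.mul hB)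
    have h2 : ∫ y in (-R)..R, φ (T y) * v y = ∫ y in T (-R)..T R, φ y * B y := by
      rw [← h1]
      refine intervalIntegral.integral_congr fun y _ => ?_
      have := (hBT y).ne'
      simp only [Function.comp]
      field_simp
    rw [h2, intervalIntegral.integral_of_le (hTmono (by linarith))]
    exact setIntegral_le_integral (hBBi hφ)
      (Eventually.of_forall fun y => mul_nonneg (hφ0 y) (hB0 y))
  set J := √(2 * I * Θ) with hJ
  have hJ0 : 0 < J := by positivity
  have hJsq : J ^ 2 = 2 * I * Θ := Real.sq_sqrt (by positivity)
  set a := p * J / E with ha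
  have ha0 : 0 < a := by have : 0 < p := by linarith
                         positivity
  have hBp : ∀ y, B y ^ (p - 1) * B y = B y ^ p := fun y => by
    rcases (hB0 y).eq_or_lt with h0 | h0
    · rw [← h0, mul_zero, Real.zero_rpow (by linarith)]
    · rw [Real.rpow_sub_one h0.ne', div_mul_cancel₀ _ h0.ne']
  have hBpc : Continuous fun y => B y ^ (p - 1) :=
    hB.rpow_const fun y => Or.inr (by linarith)
  -- the inequality before passing to the limit
  have hfin : ∀ R, 0 ≤ R → a ^ (1 - p) * (p * (∫ y in (-R)..R, v y * u y) -
      (p - 1) / a * (r * (v R * u R) + r * (v (-R) * u (-R)) + p * J)) ≤ ∫ y, B y ^ p := by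
    intro R hR
    have hvi : ∀ {f : ℝ → ℝ}, Continuous f → IntervalIntegrable f volume (-R) R :=
      fun hf => hf.intervalIntegrable _ _
    have e1 := hcv hBpc (fun y => Real.rpow_nonneg (hB0 y) _) R hR
    simp only [hBp] at e1
    have e2 : ∫ y in (-R)..R, a ^ (1 - p) * (p * (v y * u y) -
        (p - 1) / a * (v y * u y * (v y / B (T y)))) ≤
        ∫ y in (-R)..R, B (T y) ^ (p - 1) * v y := by
      refine intervalIntegral_mono_of_continuous hR (by fun_prop)
        ((hBpc.comp hTc).mul hv) fun y _ => ?_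
      have := rpow_div_mul_ge hp ha0 (div_pos (h.v_pos y) (hBT y)) (h.v_pos y)
      rwa [div_div_cancel₀ (h.v_pos y).ne', ← h.u_eq] at this
    have e3 : ∫ y in (-R)..R, (p * (v y * g y) * T y + v y * u y * (v y / B (T y))) =
        v R * u R * T R - v (-R) * u (-R) * T (-R) :=
      intervalIntegral.integral_eq_sub_of_hasDerivAt
        (fun y _ => (h.hasDerivAt_vu y).mul (hTd y)) (hvi (by fun_prop))
    rw [intervalIntegral.integral_add (hvi (by fun_prop)) (hvi (by fun_prop))] at e3
    rw [intervalIntegral.integral_const_mul, intervalIntegral.integral_sub (hvi (by fun_prop))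
      (hvi (by fun_prop)), intervalIntegral.integral_const_mul,
      intervalIntegral.integral_const_mul] at e2
    have e4 : -∫ y in (-R)..R, p * (v y * g y) * T y ≤ p * J := by
      rw [← intervalIntegral.integral_neg]
      have e5 : ∫ y in (-R)..R, -(p * (v y * g y) * T y) ≤
          ∫ y in (-R)..R, (p * Θ / (2 * J) * (v y * g y ^ 2) + p * I / J * (T y ^ 2 * v y)) := by
        refine intervalIntegral_mono_of_continuous hR (by fun_prop) (by fun_prop) fun y _ => ?_
        have hv0 := h.v_pos y
        have hp0 : 0 < p := by linarith
        have e6 : 0 ≤ p * v y / (2 * J * Θ) * (Θ * g y + J * T y) ^ 2 := by positivity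
        have e7 : p * v y / (2 * J * Θ) * (Θ * g y + J * T y) ^ 2 =
            p * Θ / (2 * J) * (v y * g y ^ 2) + p * (2 * I * Θ) / (2 * J * Θ) * (T y ^ 2 * v y) +
            p * (v y * g y) * T y := by
          rw [← hJsq]; field_simp; ring
        have e8 : p * (2 * I * Θ) / (2 * J * Θ) = p * I / J := by field_simp
        rw [e8] at e7
        linarith
      rw [intervalIntegral.integral_add (hvi (by fun_prop)) (hvi (by fun_prop)),
        intervalIntegral.integral_const_mul, intervalIntegral.integral_const_mul] at e5
      have e9 := intervalIntegral_le_integral hR h.integrable_fisher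
        fun y => mul_nonneg (h.v_pos y).le (sq_nonneg _)
      have e10 := hcv (continuous_pow 2) (fun y => sq_nonneg y) R hR
      rw [h.integral_fisher] at e9
      rw [hBΘ] at e10
      have hp0 : 0 < p := by linarith
      have e11 := mul_le_mul_of_nonneg_left e9 (show 0 ≤ p * Θ / (2 * J) by positivity)
      have e12 := mul_le_mul_of_nonneg_left e10 (show 0 ≤ p * I / J by positivity)
      have e13 : p * Θ / (2 * J) * (2 * I) + p * I / J * Θ = p * J := by
        have : p * Θ / (2 * J) * (2 * I) + p * I / J * Θ = p * (2 * I * Θ) / J := by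
          field_simp; ring
        rw [this, ← hJsq]; field_simp
      linarith
    have e14 : v R * u R * T R - v (-R) * u (-R) * T (-R) ≤
        r * (v R * u R) + r * (v (-R) * u (-R)) := by
      have w1 := mul_pos (h.v_pos R) (h.u_pos R)
      have w2 := mul_pos (h.v_pos (-R)) (h.u_pos (-R))
      nlinarith [hT R, hT (-R), (hT R).2, (hT (-R)).1]
    refine le_trans ?_ (e2.trans e1)
    have hp1 : 0 < p - 1 := by linarith
    gcongr
    linarith
  have hlim : Tendsto (fun R => a ^ (1 - p) * (p * (∫ y in (-R)..R, v y * u y) -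
      (p - 1) / a * (r * (v R * u R) + r * (v (-R) * u (-R)) + p * J))) atTop
      (nhds (a ^ (1 - p) * (p * E - (p - 1) / a * (r * 0 + r * 0 + p * J)))) := by
    have t1 := intervalIntegral_tendsto_integral h.integrable_vu tendsto_neg_atTop_atBot tendsto_id
    rw [h.integral_vu] at t1
    have t2 := (h.tendsto_vu hp).comp (atTop_le_cocompact (α := ℝ))
    have t3 := (h.tendsto_vu hp).comp tendsto_neg_atTop_cocompact
    exact ((t1.const_mul p).sub ((((t2.const_mul r).add (t3.const_mul r)).add_const
      (p * J)).const_mul ((p - 1) / a))).const_mul _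
  have hle := le_of_tendsto hlim (eventually_atTop.2 ⟨0, hfin⟩)
  have hfinal : p * E - (p - 1) / a * (r * 0 + r * 0 + p * J) = E := by
    rw [ha]
    have : p ≠ 0 := by linarith
    field_simp; ring
  rwa [hfinal] at hle

end IsFiniteProfile

/-- The fourth power of the parabolic cutoff, extended by zero to the whole line. -/
noncomputable def cutoffWeight (R : ℝ) : ℝ → ℝ :=
  (Ioc (-R) R).indicator fun y => parabolicCutoff R y ^ 4

theorem cutoffWeight_mem {R : ℝ} (hR : 0 < R) (y : ℝ) :
    0 ≤ cutoffWeight R y ∧ cutoffWeight R y ≤ 1 := by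
  unfold cutoffWeight
  by_cases hy : y ∈ Ioc (-R) R
  · rw [indicator_of_mem hy]
    obtain ⟨h0, h1⟩ := parabolicCutoff_mem hR (Ioc_subset_Icc_self hy)
    exact ⟨by positivity, pow_le_one₀ h0 h1⟩
  · rw [indicator_of_notMem hy]
    simp

theorem one_sub_cutoffWeight_le {R : ℝ} (hR : 0 < R) (y : ℝ) :
    1 - cutoffWeight R y ≤ 4 * y ^ 2 / R ^ 2 := by
  unfold cutoffWeight
  by_cases hy : y ∈ Ioc (-R) R
  · rw [indicator_of_mem hy]
    have h1 := one_add_mul_le_pow (a := -(y ^ 2 / R ^ 2)) (by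
      linarith [sq_div_sq_le_one hR (Ioc_subset_Icc_self hy)]) 4
    have h2 : parabolicCutoff R y = 1 + -(y ^ 2 / R ^ 2) := by unfold parabolicCutoff; ring
    rw [h2, mul_div_assoc]
    push_cast at h1
    linarith
  · rw [indicator_of_notMem hy, le_div_iff₀ (by positivity)]
    have : R ^ 2 ≤ y ^ 2 := by
      by_contra hc
      have := abs_lt_of_sq_lt_sq (not_le.1 hc) hR.le
      exact hy ⟨(abs_lt.1 this).1, (abs_lt.1 this).2.le⟩
    nlinarith

theorem measurable_cutoffWeight (R : ℝ) : Measurable (cutoffWeight R) :=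
  Measurable.indicator ((continuous_parabolicCutoff R).pow 4).measurable measurableSet_Ioc

theorem intervalIntegral_cutoff_eq {R : ℝ} (hR : 0 ≤ R) (f : ℝ → ℝ) :
    ∫ y in (-R)..R, parabolicCutoff R y ^ 4 * f y = ∫ y, cutoffWeight R y * f y := by
  rw [intervalIntegral.integral_of_le (by linarith), ← integral_indicator measurableSet_Ioc]
  congr 1
  ext y
  unfold cutoffWeight
  by_cases hy : y ∈ Ioc (-R) R
  · rw [indicator_of_mem hy, indicator_of_mem hy]
  · rw [indicator_of_notMem hy, indicator_of_notMem hy, zero_mul]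

theorem integrable_cutoffWeight_mul {R : ℝ} (hR : 0 < R) {f : ℝ → ℝ} (hf : Integrable f) :
    Integrable fun y => cutoffWeight R y * f y := by
  refine hf.mono ((measurable_cutoffWeight R).aestronglyMeasurable.mul hf.1)
    (Eventually.of_forall fun y => ?_)
  rw [norm_mul, Real.norm_of_nonneg (cutoffWeight_mem hR y).1]
  exact mul_le_of_le_one_left (norm_nonneg _) (cutoffWeight_mem hR y).2

theorem integral_sub_cutoff {R : ℝ} (hR : 0 < R) {f : ℝ → ℝ} (hf : Integrable f) :
    (∫ y, f y) - ∫ y in (-R)..R, parabolicCutoff R y ^ 4 * f y =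
      ∫ y, (1 - cutoffWeight R y) * f y := by
  rw [intervalIntegral_cutoff_eq hR.le, ← integral_sub hf (integrable_cutoffWeight_mul hR hf)]
  congr 1
  ext y
  ring

theorem integrable_one_sub_cutoffWeight_mul {R : ℝ} (hR : 0 < R) {f : ℝ → ℝ} (hf : Integrable f) :
    Integrable fun y => (1 - cutoffWeight R y) * f y :=
  (hf.sub (integrable_cutoffWeight_mul hR hf)).congr (Eventually.of_forall fun y => by
    simp only [Pi.sub_apply]; ring)

theorem tendsto_integral_cutoff {f : ℝ → ℝ} (hf : Integrable f) :
    Tendsto (fun R : ℝ => ∫ y in (-R)..R, parabolicCutoff R y ^ 4 * f y) atTop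
      (nhds (∫ y, f y)) := by
  have h : Tendsto (fun R : ℝ => ∫ y, cutoffWeight R y * f y) atTop (nhds (∫ y, f y)) := by
    refine tendsto_integral_filter_of_dominated_convergence (fun y => ‖f y‖)
      (Eventually.of_forall fun R => (measurable_cutoffWeight R).aestronglyMeasurable.mul hf.1)
      ?_ hf.norm (Eventually.of_forall fun y => ?_)
    · filter_upwards [eventually_gt_atTop 0] with R hR
      refine Eventually.of_forall fun y => ?_
      rw [norm_mul, Real.norm_of_nonneg (cutoffWeight_mem hR y).1]
      exact mul_le_of_le_one_left (norm_nonneg _) (cutoffWeight_mem hR y).2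
    · have h1 : Tendsto (fun R : ℝ => cutoffWeight R y) atTop (nhds 1) := by
        have h2 : Tendsto (fun R : ℝ => 1 - 4 * y ^ 2 / R ^ 2) atTop (nhds (1 - 0)) :=
          ((tendsto_pow_atTop (two_ne_zero)).const_div_atTop (4 * y ^ 2)).const_sub 1
        rw [sub_zero] at h2
        refine tendsto_of_tendsto_of_tendsto_of_le_of_le' h2 tendsto_const_nhds ?_ ?_
        · filter_upwards [eventually_gt_atTop 0] with R hR
          linarith [one_sub_cutoffWeight_le hR y]
        · filter_upwards [eventually_gt_atTop 0] with R hR using (cutoffWeight_mem hR y).2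
      simpa using h1.mul_const (f y)
  refine h.congr' ?_
  filter_upwards [eventually_ge_atTop 0] with R hR
  rw [intervalIntegral_cutoff_eq hR]

theorem integral_cutoff_le {R : ℝ} (hR : 0 < R) {f : ℝ → ℝ} (hf : Integrable f)
    (h0 : ∀ y, 0 ≤ f y) :
    ∫ y in (-R)..R, parabolicCutoff R y ^ 4 * f y ≤ ∫ y, f y := by
  rw [intervalIntegral_cutoff_eq hR.le]
  exact integral_mono (integrable_cutoffWeight_mul hR hf) hf fun y =>
    mul_le_of_le_one_left (h0 y) (cutoffWeight_mem hR y).2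

/-- A nonnegative continuous function with bounded localized integrals is integrable. -/
theorem integrable_of_integral_cutoff_le {f : ℝ → ℝ} (hf : Continuous f) (h0 : ∀ y, 0 ≤ f y)
    {K : ℝ} (hK : ∀ R, 1 ≤ R → ∫ y in (-R)..R, parabolicCutoff R y ^ 4 * f y ≤ K) :
    Integrable f ∧ ∫ y, f y ≤ K := by
  have hi : Integrable f := by
    refine integrable_of_intervalIntegral_norm_bounded (a := fun R : ℝ => -R) (b := id)
      (l := atTop) ((4 / 3) ^ 4 * K) (fun R => (hf.integrableOn_Icc).mono_set Ioc_subset_Icc_self)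
      tendsto_neg_atTop_atBot tendsto_id ?_
    filter_upwards [eventually_ge_atTop 1] with R hR
    have h1 := hK (2 * R) (by linarith)
    have h2 : ∫ y in (-R)..R, (3 / 4) ^ 4 * f y ≤
        ∫ y in (-R)..R, parabolicCutoff (2 * R) y ^ 4 * f y := by
      refine intervalIntegral_mono_of_continuous (by linarith) (by fun_prop) (by fun_prop)
        fun y hy => ?_
      have h3 : 3 / 4 ≤ parabolicCutoff (2 * R) y := by
        have := sq_div_sq_le_one (by linarith) hy
        have h4 : y ^ 2 / (2 * R) ^ 2 = (y ^ 2 / R ^ 2) / 4 := by field_simp; norm_num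
        unfold parabolicCutoff
        rw [h4]
        linarith
      have := h0 y
      gcongr
    have h3 : ∫ y in (-R)..R, parabolicCutoff (2 * R) y ^ 4 * f y ≤
        ∫ y in (-(2 * R))..(2 * R), parabolicCutoff (2 * R) y ^ 4 * f y := by
      refine intervalIntegral.integral_mono_interval (by linarith) (by linarith) (by linarith)
        (Eventually.of_forall fun y => mul_nonneg (by positivity) (h0 y)) ?_
      exact Continuous.intervalIntegrable (by fun_prop) _ _
    rw [intervalIntegral.integral_const_mul] at h2
    simp only [id, Real.norm_of_nonneg (h0 _)]
    norm_num at h2 ⊢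
    linarith
  refine ⟨hi, le_of_tendsto (tendsto_integral_cutoff hi) (eventually_atTop.2 ⟨1, hK⟩)⟩

namespace IsFiniteProfile

variable {p Θ I E : ℝ} {v u g g₁ g₂ g₃ : ℝ → ℝ}

theorem u_le (h : IsFiniteProfile p Θ I E v u g g₁ g₂ g₃) (hp : 1 < p) (y : ℝ) :
    u y ≤ 1 + p * (1 + 2 * I) / 2 := by
  have hv := h.continuous_v
  have hg := h.continuous_g
  have hp0 : 0 < p := by linarith
  have hdom : ∀ y, |p * (v y * g y)| ≤ p / 2 * (v y + v y * g y ^ 2) := fun y => by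
    have := h.v_pos y
    rw [abs_le]
    constructor
    · nlinarith [mul_nonneg (mul_nonneg hp0.le this.le) (sq_nonneg (g y + 1))]
    · nlinarith [mul_nonneg (mul_nonneg hp0.le this.le) (sq_nonneg (g y - 1))]
  have hdi : Integrable fun y => p / 2 * (v y + v y * g y ^ 2) :=
    (h.integrable_v.add h.integrable_fisher).const_mul _
  have hi : Integrable fun y => p * (v y * g y) :=
    hdi.mono' (by fun_prop : Continuous fun y => p * (v y * g y)).aestronglyMeasurable
      (Eventually.of_forall hdom)
  have h1 := integral_Iic_of_hasDerivAt_of_tendsto' (a := y) (fun x _ => h.hasDerivAt_vu x)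
    hi.integrableOn ((h.tendsto_vu hp).mono_left atBot_le_cocompact)
  have h2 : v y * u y ≤ p * (1 + 2 * I) / 2 := by
    calc v y * u y = ∫ x in Iic y, p * (v x * g x) := by rw [h1, sub_zero]
      _ ≤ ∫ x in Iic y, p / 2 * (v x + v x * g x ^ 2) :=
        setIntegral_mono hi.integrableOn hdi.integrableOn fun x => (le_abs_self _).trans (hdom x)
      _ ≤ ∫ x, p / 2 * (v x + v x * g x ^ 2) :=
        setIntegral_le_integral hdi (Eventually.of_forall fun x => (abs_nonneg _).trans (hdom x))
      _ = p * (1 + 2 * I) / 2 := by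
        rw [integral_const_mul, integral_add h.integrable_v h.integrable_fisher, h.integral_v,
          h.integral_fisher]
        ring
  have h3 := h.u_pos y
  have h4 := h.v_pos y
  rcases le_total (v y) 1 with hle | hle
  · have : u y ≤ 1 := by
      rw [h.u_eq]
      exact Real.rpow_le_one h4.le hle (by linarith)
    have := h.fisher_pos
    nlinarith
  · nlinarith

/-- A bound for error terms carrying the derivative of the cutoff. -/
theorem integral_vug_error_le (h : IsFiniteProfile p Θ I E v u g g₁ g₂ g₃) {R U C : ℝ}
    (hR : 1 ≤ R) (hU : ∀ y, u y ≤ U) {d : ℝ → ℝ} (hd : Continuous d)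
    (hdR : ∀ y ∈ Icc (-R) R, |d y| ≤ C) :
    |∫ y in (-R)..R, d y * (v y * u y * g y)| ≤ C * ((U ^ 2 + 2 * I) / 2) := by
  have hR0 : 0 < R := by linarith
  have hv := h.continuous_v
  have hu := h.continuous_u
  have hg := h.continuous_g
  have hC : 0 ≤ C := (abs_nonneg _).trans (hdR 0 ⟨by linarith, hR0.le⟩)
  have hpt : ∀ y ∈ Icc (-R) R, |d y * (v y * u y * g y)| ≤
      C * (U ^ 2 / 2 * v y + v y * g y ^ 2 / 2) := fun y hy => by
    have hv0 := h.v_pos y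
    have hu0 := h.u_pos y
    have hUy := hU y
    rw [abs_mul]
    have : |v y * u y * g y| ≤ U ^ 2 / 2 * v y + v y * g y ^ 2 / 2 := by
      have h1 : u y ^ 2 * v y ≤ U ^ 2 * v y := by gcongr
      rw [abs_le]
      constructor
      · nlinarith [mul_nonneg hv0.le (sq_nonneg (g y + u y))]
      · nlinarith [mul_nonneg hv0.le (sq_nonneg (g y - u y))]
    have := hdR y hy
    gcongr
  have h1 : ∫ y in (-R)..R, C * (U ^ 2 / 2 * v y + v y * g y ^ 2 / 2) ≤
      C * ((U ^ 2 + 2 * I) / 2) := by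
    rw [intervalIntegral.integral_const_mul,
      intervalIntegral.integral_add (Continuous.intervalIntegrable (by fun_prop) _ _)
      (Continuous.intervalIntegrable (by fun_prop) _ _), intervalIntegral.integral_const_mul,
      intervalIntegral.integral_div]
    have e1 := intervalIntegral_le_integral hR0.le h.integrable_v fun y => (h.v_pos y).le
    have e2 := intervalIntegral_le_integral hR0.le h.integrable_fisher
      fun y => mul_nonneg (h.v_pos y).le (sq_nonneg _)
    rw [h.integral_v] at e1
    rw [h.integral_fisher] at e2
    refine mul_le_mul_of_nonneg_left ?_ hC
    nlinarith [sq_nonneg U]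
  refine (intervalIntegral.abs_integral_le_integral_abs (by linarith)).trans (le_trans ?_ h1)
  exact intervalIntegral_mono_of_continuous hR0.le (by fun_prop) (by fun_prop) hpt

/-- The derivative of the momentum `v (p g g₁ + u g₂)` cannot vanish identically. -/
theorem exists_flux_deriv_ne_zero (h : IsFiniteProfile p Θ I E v u g g₁ g₂ g₃) (hp : 1 < p) :
    ∃ y, v y * g y / u y * (p * g y * g₁ y + u y * g₂ y) +
        v y * (p * g₁ y ^ 2 + (2 * p - 1) * (g y * g₂ y) + u y * g₃ y) ≠ 0 := by
  by_contra! hzero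
  have hv := h.continuous_v
  have hu := h.continuous_u
  have hg := h.continuous_g
  have hg1 := h.continuous_g₁
  have hI := h.fisher_pos
  set b := v 0 * (p * g 0 * g₁ 0 + u 0 * g₂ 0) with hb
  have hmom : ∀ y, v y * (p * g y * g₁ y + u y * g₂ y) = b := fun y =>
    is_const_of_deriv_eq_zero (f := fun y => v y * (p * g y * g₁ y + u y * g₂ y))
      (fun x => (h.hasDerivAt_momentum x).differentiableAt)
      (fun x => by rw [(h.hasDerivAt_momentum x).deriv, hzero]) y 0
  set a := v 0 * u 0 * g₁ 0 with ha
  have hq : ∀ y, v y * u y * g₁ y = a + b * y := fun y => by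
    have hd : ∀ x, HasDerivAt (fun x => v x * u x * g₁ x - b * x) 0 x := fun x =>
      ((h.hasDerivAt_vug₁ x).sub ((hasDerivAt_id x).const_mul b)).congr_deriv (by
        rw [hmom]; ring)
    have := is_const_of_deriv_eq_zero (fun x => (hd x).differentiableAt) (fun x => (hd x).deriv)
      y 0
    simp only [mul_zero, sub_zero] at this
    linarith
  set U := 1 + p * (1 + 2 * I) / 2
  set C := (U ^ 2 + 2 * I) / 2 with hC
  have hkey : ∀ R, 1 ≤ R →
      |a * (4 * R / 3) + p * ∫ y in (-R)..R, parabolicCutoff R y * (v y * g y ^ 2)| ≤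
        2 / R * C := fun R hR => by
    have hR0 : 0 < R := by linarith
    have hη := continuous_parabolicCutoff R
    have h1 : ∫ y in (-R)..R, parabolicCutoff R y * (v y * u y * g₁ y) = a * (4 * R / 3) := by
      simp only [hq]
      have := intervalIntegral.integral_eq_sub_of_hasDerivAt (a := -R) (b := R)
        (f := fun y => a * (y - y ^ 3 / (3 * R ^ 2)) + b * (y ^ 2 / 2 - y ^ 4 / (4 * R ^ 2)))
        (f' := fun y => parabolicCutoff R y * (a + b * y)) (fun y _ =>
          ((((hasDerivAt_id y).sub ((hasDerivAt_pow 3 y).div_const (3 * R ^ 2))).const_mul a).add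
          ((((hasDerivAt_pow 2 y).div_const 2).sub
            ((hasDerivAt_pow 4 y).div_const (4 * R ^ 2))).const_mul b)).congr_deriv (by
            unfold parabolicCutoff; norm_num; field_simp))
        (Continuous.intervalIntegrable (by fun_prop) _ _)
      rw [this]
      field_simp
      ring
    have h2 := integral_eq_neg_of_hasDerivAt_add (R := R)
      (f := fun y => parabolicCutoff R y * (v y * u y * g y))
      (a := fun y => parabolicCutoff R y * (v y * u y * g₁ y))
      (b := fun y => p * (parabolicCutoff R y * (v y * g y ^ 2)) +
        -(2 * y / R ^ 2) * (v y * u y * g y))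
      (fun y => ((hasDerivAt_parabolicCutoff R y).mul
        ((h.hasDerivAt_vu y).mul (h.hasDerivAt_g y))).congr_deriv (by
          simp only [Pi.mul_apply]; ring)) (by fun_prop) (by fun_prop)
      (by simp [parabolicCutoff_self hR0]) (by simp [parabolicCutoff_neg_self hR0])
    rw [h1, intervalIntegral.integral_add (Continuous.intervalIntegrable (by fun_prop) _ _)
      (Continuous.intervalIntegrable (by fun_prop) _ _),
      intervalIntegral.integral_const_mul] at h2
    have h3 := h.integral_vug_error_le hR (h.u_le hp) (d := fun y => -(2 * y / R ^ 2))
      (C := 2 / R) (by fun_prop) fun y hy => by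
        rw [abs_neg]; exact abs_two_mul_div_sq_le hR hy
    rw [← abs_neg] at h3
    refine (congrArg abs ?_).trans_le h3
    linarith
  have hC0 : 0 < C := by positivity
  have hη0 : ∀ R, 1 ≤ R → ∫ y in (-R)..R, parabolicCutoff R y ^ 4 * (v y * g y ^ 2) ≤
      ∫ y in (-R)..R, parabolicCutoff R y * (v y * g y ^ 2) := fun R hR => by
    refine intervalIntegral_mono_of_continuous (by linarith) (by fun_prop) (by fun_prop)
      fun y hy => ?_
    obtain ⟨h0, h1⟩ := parabolicCutoff_mem (by linarith) hy
    exact mul_le_mul_of_nonneg_right (pow_le_of_le_one h0 h1 (by norm_num))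
      (mul_nonneg (h.v_pos y).le (sq_nonneg _))
  have hη1 : ∀ R, 1 ≤ R → ∫ y in (-R)..R, parabolicCutoff R y * (v y * g y ^ 2) ≤ 2 * I :=
    fun R hR => by
      rw [← h.integral_fisher]
      refine le_trans ?_ (intervalIntegral_le_integral (R := R) (by linarith) h.integrable_fisher
        fun y => mul_nonneg (h.v_pos y).le (sq_nonneg _))
      refine intervalIntegral_mono_of_continuous (by linarith) (by fun_prop) (by fun_prop)
        fun y hy => ?_
      obtain ⟨h0, h1⟩ := parabolicCutoff_mem (by linarith) hy
      exact mul_le_of_le_one_left (mul_nonneg (h.v_pos y).le (sq_nonneg _)) h1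
  have ha0 : 0 ≤ a := by
    by_contra! hneg
    obtain ⟨R, hR1, hR⟩ : ∃ R, 1 ≤ R ∧ (p * (2 * I) + 2 * C) / (-a) ≤ R :=
      ⟨max 1 ((p * (2 * I) + 2 * C) / (-a)), le_max_left _ _, le_max_right _ _⟩
    have h1 := (abs_le.1 (hkey R hR1)).1
    have h2 := hη1 R hR1
    rw [div_le_iff₀ (by linarith)] at hR
    have h3 : 2 / R * C ≤ 2 * C := by
      gcongr
      exact div_le_self (by norm_num) hR1
    have h4 : p * ∫ y in (-R)..R, parabolicCutoff R y * (v y * g y ^ 2) ≤ p * (2 * I) := by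
      gcongr
    nlinarith
  have hlim := (tendsto_integral_cutoff h.integrable_fisher).const_mul p
  have hlim2 : Tendsto (fun R : ℝ => 2 / R * C) atTop (nhds (0 * C)) :=
    (tendsto_id.const_div_atTop 2).mul_const C
  have := le_of_tendsto_of_tendsto hlim hlim2 (eventually_atTop.2 ⟨1, fun R hR => by
    have h1 := (abs_le.1 (hkey R hR)).2
    have h2 : 0 ≤ a * (4 * R / 3) := by positivity
    have h3 := mul_le_mul_of_nonneg_left (hη0 R hR) (by linarith : (0 : ℝ) ≤ p)
    linarith⟩)
  rw [h.integral_fisher] at this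
  nlinarith

end IsFiniteProfile

theorem abs_mul_mul_le {v a b δ : ℝ} (hv : 0 ≤ v) (hδ : 0 < δ) :
    |v * (a * b)| ≤ δ * (v * b ^ 2) + 1 / (4 * δ) * (v * a ^ 2) := by
  have h1 : 0 ≤ v * (1 / δ) * (δ * b - a / 2) ^ 2 := by positivity
  have h2 : 0 ≤ v * (1 / δ) * (δ * b + a / 2) ^ 2 := by positivity
  have e1 : v * (1 / δ) * (δ * b - a / 2) ^ 2 = δ * (v * b ^ 2) + 1 / (4 * δ) * (v * a ^ 2) -
    v * (a * b) := by field_simp; ring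
  have e2 : v * (1 / δ) * (δ * b + a / 2) ^ 2 = δ * (v * b ^ 2) + 1 / (4 * δ) * (v * a ^ 2) +
    v * (a * b) := by field_simp; ring
  rw [abs_le]
  constructor <;> linarith

namespace IsFiniteProfile

variable {p Θ I E : ℝ} {v u g g₁ g₂ g₃ : ℝ → ℝ}

theorem integrable_dissipation (h : IsFiniteProfile p Θ I E v u g g₁ g₂ g₃) {K : ℝ}
    (hK : ∀ R, 1 ≤ R → ∫ y in (-R)..R, parabolicCutoff R y ^ 4 *
      (v y * (p * g y * g₁ y + u y * g₂ y) ^ 2) ≤ K) :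
    Integrable (fun y => v y * (p * g y * g₁ y + u y * g₂ y) ^ 2) ∧
      ∫ y, v y * (p * g y * g₁ y + u y * g₂ y) ^ 2 ≤ K := by
  have hv := h.continuous_v
  have hu := h.continuous_u
  have hg := h.continuous_g
  have hg1 := h.continuous_g₁
  have hg2 := h.continuous_g₂
  exact integrable_of_integral_cutoff_le (by fun_prop)
    (fun y => mul_nonneg (h.v_pos y).le (sq_nonneg _)) hK

theorem integrable_vgj (h : IsFiniteProfile p Θ I E v u g g₁ g₂ g₃) {K : ℝ}
    (hK : ∀ R, 1 ≤ R → ∫ y in (-R)..R, parabolicCutoff R y ^ 4 *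
      (v y * (p * g y * g₁ y + u y * g₂ y) ^ 2) ≤ K) :
    Integrable (fun y => v y * (g y * (p * g y * g₁ y + u y * g₂ y))) := by
  have hv := h.continuous_v
  have hu := h.continuous_u
  have hg := h.continuous_g
  have hg1 := h.continuous_g₁
  have hg2 := h.continuous_g₂
  refine (((h.integrable_dissipation hK).1.const_mul 1).add
    (h.integrable_fisher.const_mul (1 / (4 * 1)))).mono'
    (by fun_prop : Continuous _).aestronglyMeasurable
    (Eventually.of_forall fun y => abs_mul_mul_le (h.v_pos y).le one_pos)

/-- `∫ v g j ≤ -4 p² I² / ∫ v^p`. -/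
theorem integral_vgj_le (h : IsFiniteProfile p Θ I E v u g g₁ g₂ g₃) (hp : 1 < p) (hE : 0 < E)
    {K : ℝ} (hK : ∀ R, 1 ≤ R → ∫ y in (-R)..R, parabolicCutoff R y ^ 4 *
      (v y * (p * g y * g₁ y + u y * g₂ y) ^ 2) ≤ K) :
    ∫ y, v y * (g y * (p * g y * g₁ y + u y * g₂ y)) ≤ -(4 * p ^ 2 * I ^ 2 / E) := by
  have hv := h.continuous_v
  have hu := h.continuous_u
  have hg := h.continuous_g
  have hg1 := h.continuous_g₁
  have hg2 := h.continuous_g₂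
  have hI := h.fisher_pos
  set U := 1 + p * (1 + 2 * I) / 2 with hUdef
  have hU := h.u_le hp
  rw [← hUdef] at hU
  have hU0 : 0 < U := (h.u_pos 0).trans_le (hU 0)
  set D := 2 * 1 * K + (1 / 1 + 32 * U) * I with hD
  set lam := 2 * p * I / E with hlam
  have hlam0 : 0 < lam := by positivity
  have hpre : ∀ R, 1 ≤ R → 0 ≤
      (-(∫ y in (-R)..R, parabolicCutoff R y ^ 4 *
        (v y * (g y * (p * g y * g₁ y + u y * g₂ y)))) +
      2 * lam * (-(p * ∫ y in (-R)..R, parabolicCutoff R y ^ 4 * (v y * g y ^ 2))) +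
      lam ^ 2 * ∫ y in (-R)..R, parabolicCutoff R y ^ 4 * (v y * u y)) +
      8 / R * ((U * (2 * I) + D) / 2 + 2 * lam * ((U ^ 2 + 2 * I) / 2)) := by
    intro R hR
    have hR0 : 0 < R := by linarith
    have hη := continuous_parabolicCutoff R
    have hvi : ∀ {f : ℝ → ℝ}, Continuous f → IntervalIntegrable f volume (-R) R :=
      fun hf => hf.intervalIntegrable _ _
    have hχ' : ∀ y ∈ Icc (-R) R, |4 * parabolicCutoff R y ^ 3 * -(2 * y / R ^ 2)| ≤ 8 / R :=
      fun y hy => by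
        obtain ⟨h0, h1⟩ := parabolicCutoff_mem hR0 hy
        have h2 := abs_two_mul_div_sq_le hR hy
        have h3 : parabolicCutoff R y ^ 3 ≤ 1 := pow_le_one₀ h0 h1
        rw [abs_mul, abs_neg, abs_of_nonneg (by positivity)]
        calc 4 * parabolicCutoff R y ^ 3 * |2 * y / R ^ 2| ≤ 4 * 1 * (2 / R) := by gcongr
          _ = 8 / R := by ring
    have e1 := integral_eq_neg_of_hasDerivAt_add (R := R)
      (f := fun y => parabolicCutoff R y ^ 4 * (v y * u y * g₁ y * g y))
      (a := fun y => parabolicCutoff R y ^ 4 * (v y * u y * g₁ y ^ 2))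
      (b := fun y => parabolicCutoff R y ^ 4 *
          (v y * (g y * (p * g y * g₁ y + u y * g₂ y))) +
        4 * parabolicCutoff R y ^ 3 * -(2 * y / R ^ 2) * (v y * u y * (g y * g₁ y)))
      (fun y => (((hasDerivAt_parabolicCutoff R y).pow 4).mul
        ((h.hasDerivAt_vug₁ y).mul (h.hasDerivAt_g y))).congr_deriv (by
          simp only [Pi.mul_apply, Pi.pow_apply]; norm_num; ring)) (by fun_prop) (by fun_prop)
      (by simp [parabolicCutoff_self hR0]) (by simp [parabolicCutoff_neg_self hR0])
    have e2 := integral_eq_neg_of_hasDerivAt_add (R := R)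
      (f := fun y => parabolicCutoff R y ^ 4 * (v y * u y * g y))
      (a := fun y => parabolicCutoff R y ^ 4 * (v y * u y * g₁ y))
      (b := fun y => p * (parabolicCutoff R y ^ 4 * (v y * g y ^ 2)) +
        4 * parabolicCutoff R y ^ 3 * -(2 * y / R ^ 2) * (v y * u y * g y))
      (fun y => (((hasDerivAt_parabolicCutoff R y).pow 4).mul
        ((h.hasDerivAt_vu y).mul (h.hasDerivAt_g y))).congr_deriv (by
          simp only [Pi.mul_apply, Pi.pow_apply]; norm_num; ring)) (by fun_prop) (by fun_prop)
      (by simp [parabolicCutoff_self hR0]) (by simp [parabolicCutoff_neg_self hR0])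
    rw [intervalIntegral.integral_add (hvi (by fun_prop)) (hvi (by fun_prop))] at e1 e2
    rw [intervalIntegral.integral_const_mul] at e2
    have e3 := h.integral_vug_error_le hR hU
      (d := fun y => 4 * parabolicCutoff R y ^ 3 * -(2 * y / R ^ 2)) (by fun_prop) hχ'
    have e4 : -∫ y in (-R)..R, 4 * parabolicCutoff R y ^ 3 * -(2 * y / R ^ 2) *
        (v y * u y * (g y * g₁ y)) ≤ 8 / R * ((U * (2 * I) + D) / 2) := by
      rw [← intervalIntegral.integral_neg]
      have e5 : ∫ y in (-R)..R, -(4 * parabolicCutoff R y ^ 3 * -(2 * y / R ^ 2) *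
        (v y * u y * (g y * g₁ y))) ≤ ∫ y in (-R)..R, 8 / R *
          (U / 2 * (v y * g y ^ 2) + 1 / 2 * (parabolicCutoff R y ^ 2 *
            (v y * u y * g₁ y ^ 2))) := by
        refine intervalIntegral_mono_of_continuous hR0.le (by fun_prop) (by fun_prop)
          fun y hy => ?_
        have hv0 := h.v_pos y
        have hu0 := h.u_pos y
        have hUy := hU y
        obtain ⟨h0, h1⟩ := parabolicCutoff_mem hR0 hy
        have h2 := abs_two_mul_div_sq_le hR hy
        set e := parabolicCutoff R y
        have e6 : |v y * u y * (g y * (e * g₁ y))| ≤ U / 2 * (v y * g y ^ 2) +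
            1 / 2 * (e ^ 2 * (v y * u y * g₁ y ^ 2)) := by
          have := abs_mul_mul_le (a := g y) (b := e * g₁ y) (mul_pos hv0 hu0).le
            (show (0 : ℝ) < 1 / 2 by norm_num)
          have h3 : u y * (v y * g y ^ 2) ≤ U * (v y * g y ^ 2) := by gcongr
          norm_num at this ⊢
          nlinarith
        have e7 : -(4 * e ^ 3 * -(2 * y / R ^ 2) * (v y * u y * (g y * g₁ y))) =
          (4 * e ^ 2) * (2 * y / R ^ 2) * (v y * u y * (g y * (e * g₁ y))) := by ring
        rw [e7]
        refine (le_abs_self _).trans ?_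
        rw [abs_mul]
        have e8 : |4 * e ^ 2 * (2 * y / R ^ 2)| ≤ 8 / R := by
          rw [abs_mul, abs_of_nonneg (by positivity)]
          have h3 : e ^ 2 ≤ 1 := pow_le_one₀ h0 h1
          calc 4 * e ^ 2 * |2 * y / R ^ 2| ≤ 4 * 1 * (2 / R) := by gcongr
            _ = 8 / R := by ring
        gcongr
      refine e5.trans ?_
      rw [intervalIntegral.integral_const_mul,
        intervalIntegral.integral_add (hvi (by fun_prop)) (hvi (by fun_prop)),
        intervalIntegral.integral_const_mul, intervalIntegral.integral_const_mul]
      have e9 := intervalIntegral_le_integral hR0.le h.integrable_fisher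
        fun y => mul_nonneg (h.v_pos y).le (sq_nonneg _)
      rw [h.integral_fisher] at e9
      have e10 := h.integral_sq_g₁_le hR hU one_pos h.integrable_fisher h.integral_fisher
      have e11 := hK R hR
      refine mul_le_mul_of_nonneg_left ?_ (by positivity)
      have := mul_le_mul_of_nonneg_left e9 hU0.le
      rw [hD]
      linarith
    have e12 : 0 ≤ ∫ y in (-R)..R, (parabolicCutoff R y ^ 4 * (v y * u y * g₁ y ^ 2) +
        2 * lam * (parabolicCutoff R y ^ 4 * (v y * u y * g₁ y)) +
        lam ^ 2 * (parabolicCutoff R y ^ 4 * (v y * u y))) := by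
      refine intervalIntegral.integral_nonneg (by linarith) fun y _ => ?_
      have hv0 := h.v_pos y
      have hu0 := h.u_pos y
      have : 0 ≤ parabolicCutoff R y ^ 4 * (v y * u y) * (g₁ y + lam) ^ 2 := by positivity
      linarith
    rw [intervalIntegral.integral_add (hvi (by fun_prop)) (hvi (by fun_prop)),
      intervalIntegral.integral_add (hvi (by fun_prop)) (hvi (by fun_prop)),
      intervalIntegral.integral_const_mul, intervalIntegral.integral_const_mul, e1, e2] at e12
    have e13 := (abs_le.1 e3).1
    nlinarith
  have hlim : Tendsto (fun R => (-(∫ y in (-R)..R, parabolicCutoff R y ^ 4 *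
        (v y * (g y * (p * g y * g₁ y + u y * g₂ y)))) +
      2 * lam * (-(p * ∫ y in (-R)..R, parabolicCutoff R y ^ 4 * (v y * g y ^ 2))) +
      lam ^ 2 * ∫ y in (-R)..R, parabolicCutoff R y ^ 4 * (v y * u y)) +
      8 / R * ((U * (2 * I) + D) / 2 + 2 * lam * ((U ^ 2 + 2 * I) / 2))) atTop
      (nhds ((-(∫ y, v y * (g y * (p * g y * g₁ y + u y * g₂ y))) +
        2 * lam * (-(p * (2 * I))) + lam ^ 2 * E) +
        0 * ((U * (2 * I) + D) / 2 + 2 * lam * ((U ^ 2 + 2 * I) / 2)))) := by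
    have t1 := tendsto_integral_cutoff (h.integrable_vgj hK)
    have t2 := tendsto_integral_cutoff h.integrable_fisher
    have t3 := tendsto_integral_cutoff h.integrable_vu
    rw [h.integral_fisher] at t2
    rw [h.integral_vu] at t3
    exact ((t1.neg.add ((t2.const_mul p).neg.const_mul (2 * lam))).add (t3.const_mul _)).add
      ((tendsto_id.const_div_atTop 8).mul_const _)
  have hfin := ge_of_tendsto hlim (eventually_atTop.2 ⟨1, hpre⟩)
  have : 2 * lam * (-(p * (2 * I))) + lam ^ 2 * E = -(4 * p ^ 2 * I ^ 2 / E) := by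
    rw [hlam]; field_simp; ring
  linarith

/-- The localized entropy production converges to the entropy production, with an explicit rate. -/
theorem abs_entropy_production_sub_le (h : IsFiniteProfile p Θ I E v u g g₁ g₂ g₃) (hp : 1 < p)
    (hp2 : p ≤ 3 / 2) {R U I₀ c K δ : ℝ} (hR : 1 ≤ R) (hU : ∀ y, u y ≤ U) (hc : 0 ≤ c)
    (hI₀ : 0 < I₀) (hI₀I : I₀ ≤ I) (hδ : 0 < δ)
    (hK : ∀ R, 1 ≤ R → ∫ y in (-R)..R, parabolicCutoff R y ^ 4 *
      (v y * (p * g y * g₁ y + u y * g₂ y) ^ 2) ≤ K) {m : ℝ → ℝ}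
    (hm : ∀ y, HasDerivAt
      (fun y => v y * ((p * g y * g₁ y + u y * g₂ y) / I - c * y)) (-m y) y)
    (hmc : Continuous m) :
    |(∫ y in (-R)..R, parabolicCutoff R y ^ 4 * (p * (u y * m y))) -
      (p * (p - 1) / I * (∫ y, v y * (g y * (p * g y * g₁ y + u y * g₂ y))) +
        c * (p - 1) * E)| ≤
      p * (p - 1) / I₀ * (δ * K +
        1 / (4 * δ) * (2 * I - ∫ y in (-R)..R, parabolicCutoff R y ^ 4 * (v y * g y ^ 2))) +
      (p / I₀ * 4 * (K + U ^ 2) + 12 * (c * (U * Θ))) / R := by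
  have hv := h.continuous_v
  have hu := h.continuous_u
  have hg := h.continuous_g
  have hg1 := h.continuous_g₁
  have hg2 := h.continuous_g₂
  have hI := h.fisher_pos
  have hR0 : 0 < R := by linarith
  have hp0 : 0 < p := by linarith
  have hp1 : 0 < p - 1 := by linarith
  have hη := continuous_parabolicCutoff R
  have hU0 : 0 < U := (h.u_pos 0).trans_le (hU 0)
  have hK0 : 0 ≤ K := (integral_nonneg fun y => mul_nonneg (h.v_pos y).le (sq_nonneg _)).trans
    (h.integrable_dissipation hK).2
  have hΘ0 : 0 ≤ Θ := h.integral_moment ▸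
    integral_nonneg fun y => mul_nonneg (sq_nonneg _) (h.v_pos y).le
  have hvi : ∀ {f : ℝ → ℝ}, Continuous f → IntervalIntegrable f volume (-R) R :=
    fun hf => hf.intervalIntegrable _ _
  have hχ' : ∀ y ∈ Icc (-R) R, |4 * parabolicCutoff R y ^ 3 * -(2 * y / R ^ 2)| ≤ 8 / R :=
    fun y hy => by
      obtain ⟨h0, h1⟩ := parabolicCutoff_mem hR0 hy
      have h2 := abs_two_mul_div_sq_le hR hy
      have h3 : parabolicCutoff R y ^ 3 ≤ 1 := pow_le_one₀ h0 h1
      rw [abs_mul, abs_neg, abs_of_nonneg (by positivity)]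
      calc 4 * parabolicCutoff R y ^ 3 * |2 * y / R ^ 2| ≤ 4 * 1 * (2 / R) := by gcongr
        _ = 8 / R := by ring
  set X := ∫ y in (-R)..R, parabolicCutoff R y ^ 4 *
    (v y * (g y * (p * g y * g₁ y + u y * g₂ y))) with hX
  set Y := ∫ y in (-R)..R, 4 * parabolicCutoff R y ^ 3 * -(2 * y / R ^ 2) *
    (v y * (u y * (p * g y * g₁ y + u y * g₂ y))) with hY
  set Z := ∫ y in (-R)..R, 4 * parabolicCutoff R y ^ 3 * -(2 * y / R ^ 2) *
    (y * (v y * u y)) with hZ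
  set W := ∫ y in (-R)..R, parabolicCutoff R y ^ 4 * (v y * u y) with hW
  have hid : ∫ y in (-R)..R, parabolicCutoff R y ^ 4 * (p * (u y * m y)) =
      p / I * Y + p * (p - 1) / I * X - c * Z + c * (p - 1) * W := by
    have e1 := intervalIntegral.integral_eq_sub_of_hasDerivAt (a := -R) (b := R)
      (f := fun y => p * (parabolicCutoff R y ^ 4 *
        (u y * (v y * ((p * g y * g₁ y + u y * g₂ y) / I - c * y)))) +
        c * (p - 1) * (parabolicCutoff R y ^ 4 * (y * (v y * u y))))
      (f' := fun y => -(parabolicCutoff R y ^ 4 * (p * (u y * m y))) +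
        (p / I * (4 * parabolicCutoff R y ^ 3 * -(2 * y / R ^ 2) *
          (v y * (u y * (p * g y * g₁ y + u y * g₂ y)))) +
        (p * (p - 1) / I * (parabolicCutoff R y ^ 4 *
          (v y * (g y * (p * g y * g₁ y + u y * g₂ y)))) +
        (-c * (4 * parabolicCutoff R y ^ 3 * -(2 * y / R ^ 2) * (y * (v y * u y))) +
        c * (p - 1) * (parabolicCutoff R y ^ 4 * (v y * u y))))))
      (fun y _ => ((((((hasDerivAt_parabolicCutoff R y).pow 4).mul
        ((h.hasDerivAt_u y).mul (hm y))).const_mul p).add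
        ((((hasDerivAt_parabolicCutoff R y).pow 4).mul
        ((hasDerivAt_id y).mul (h.hasDerivAt_vu y))).const_mul (c * (p - 1))))).congr_deriv (by
          simp only [Pi.mul_apply, Pi.pow_apply, id]; norm_num; ring)) (hvi (by fun_prop))
    rw [intervalIntegral.integral_add (hvi (by fun_prop)) (hvi (by fun_prop)),
      intervalIntegral.integral_add (hvi (by fun_prop)) (hvi (by fun_prop)),
      intervalIntegral.integral_add (hvi (by fun_prop)) (hvi (by fun_prop)),
      intervalIntegral.integral_add (hvi (by fun_prop)) (hvi (by fun_prop)),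
      intervalIntegral.integral_neg, intervalIntegral.integral_const_mul,
      intervalIntegral.integral_const_mul, intervalIntegral.integral_const_mul,
      intervalIntegral.integral_const_mul, ← hX, ← hY, ← hZ, ← hW,
      parabolicCutoff_self hR0, parabolicCutoff_neg_self hR0] at e1
    norm_num at e1
    linarith
  obtain ⟨hji, hjK⟩ := h.integrable_dissipation hK
  set G := ∫ y, v y * (g y * (p * g y * g₁ y + u y * g₂ y)) with hG
  set F := ∫ y in (-R)..R, parabolicCutoff R y ^ 4 * (v y * g y ^ 2) with hF
  have bX : |X - G| ≤ δ * K + 1 / (4 * δ) * (2 * I - F) := by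
    rw [abs_sub_comm, hX, hG, integral_sub_cutoff hR0 (h.integrable_vgj hK)]
    have e1 := integral_sub_cutoff hR0 h.integrable_fisher
    rw [h.integral_fisher, ← hF] at e1
    have i1 := integrable_one_sub_cutoffWeight_mul hR0 hji
    have i2 := integrable_one_sub_cutoffWeight_mul hR0 h.integrable_fisher
    have e2 : ∫ y, (1 - cutoffWeight R y) * (v y * (p * g y * g₁ y + u y * g₂ y) ^ 2) ≤ K := by
      refine (integral_mono i1 hji fun y => ?_).trans hjK
      exact mul_le_of_le_one_left (mul_nonneg (h.v_pos y).le (sq_nonneg _))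
        (by linarith [(cutoffWeight_mem hR0 y).1])
    calc _ ≤ ∫ y, ‖(1 - cutoffWeight R y) * (v y * (g y * (p * g y * g₁ y + u y * g₂ y)))‖ :=
          norm_integral_le_integral_norm _
      _ ≤ ∫ y, (δ * ((1 - cutoffWeight R y) * (v y * (p * g y * g₁ y + u y * g₂ y) ^ 2)) +
          1 / (4 * δ) * ((1 - cutoffWeight R y) * (v y * g y ^ 2))) := by
        refine integral_mono (integrable_one_sub_cutoffWeight_mul hR0 (h.integrable_vgj hK)).norm
          ((i1.const_mul _).add (i2.const_mul _)) fun y => ?_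
        have hw : 0 ≤ 1 - cutoffWeight R y := by linarith [(cutoffWeight_mem hR0 y).2]
        have := mul_le_mul_of_nonneg_left (abs_mul_mul_le (a := g y)
          (b := p * g y * g₁ y + u y * g₂ y) (h.v_pos y).le hδ) hw
        refine (le_of_eq ?_).trans (this.trans (le_of_eq (by ring)))
        exact (norm_mul _ _).trans (by rw [Real.norm_of_nonneg hw, Real.norm_eq_abs])
      _ ≤ δ * K + 1 / (4 * δ) * (2 * I - F) := by
        rw [integral_add (i1.const_mul _) (i2.const_mul _), integral_const_mul,
          integral_const_mul, ← e1]
        gcongr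
  have bY : |Y| ≤ 8 / R * (1 / 2 * (K + U ^ 2)) := by
    refine (intervalIntegral.abs_integral_le_integral_abs (by linarith)).trans ?_
    have e1 : ∫ y in (-R)..R, |4 * parabolicCutoff R y ^ 3 * -(2 * y / R ^ 2) *
        (v y * (u y * (p * g y * g₁ y + u y * g₂ y)))| ≤ ∫ y in (-R)..R, 8 / R *
          (1 / 2 * (v y * (p * g y * g₁ y + u y * g₂ y) ^ 2) + U ^ 2 / 2 * v y) := by
      refine intervalIntegral_mono_of_continuous hR0.le (by fun_prop) (by fun_prop)
        fun y hy => ?_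
      have hv0 := h.v_pos y
      have hu0 := h.u_pos y
      have hUy := hU y
      rw [abs_mul]
      have e2 := abs_mul_mul_le (a := u y) (b := p * g y * g₁ y + u y * g₂ y) hv0.le
        (show (0 : ℝ) < 1 / 2 by norm_num)
      have e3 : v y * u y ^ 2 ≤ v y * U ^ 2 := by gcongr
      have e4 := hχ' y hy
      have e5 : |v y * (u y * (p * g y * g₁ y + u y * g₂ y))| ≤
        1 / 2 * (v y * (p * g y * g₁ y + u y * g₂ y) ^ 2) + U ^ 2 / 2 * v y := by
        norm_num at e2 ⊢
        linarith
      gcongr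
    refine e1.trans ?_
    rw [intervalIntegral.integral_const_mul,
      intervalIntegral.integral_add (hvi (by fun_prop)) (hvi (by fun_prop)),
      intervalIntegral.integral_const_mul, intervalIntegral.integral_const_mul]
    have e6 := (intervalIntegral_le_integral hR0.le hji
      fun y => mul_nonneg (h.v_pos y).le (sq_nonneg _)).trans hjK
    have e7 := intervalIntegral_le_integral hR0.le h.integrable_v fun y => (h.v_pos y).le
    rw [h.integral_v] at e7
    refine mul_le_mul_of_nonneg_left ?_ (by positivity)
    nlinarith [sq_nonneg U]
  have bZ : |Z| ≤ 8 / R ^ 2 * (U * Θ) := by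
    refine (intervalIntegral.abs_integral_le_integral_abs (by linarith)).trans ?_
    have e1 : ∫ y in (-R)..R, |4 * parabolicCutoff R y ^ 3 * -(2 * y / R ^ 2) *
        (y * (v y * u y))| ≤ ∫ y in (-R)..R, 8 / R ^ 2 * (U * (y ^ 2 * v y)) := by
      refine intervalIntegral_mono_of_continuous hR0.le (by fun_prop) (by fun_prop)
        fun y hy => ?_
      have hv0 := h.v_pos y
      have hu0 := h.u_pos y
      have hUy := hU y
      obtain ⟨h0, h1⟩ := parabolicCutoff_mem hR0 hy
      have h3 : parabolicCutoff R y ^ 3 ≤ 1 := pow_le_one₀ h0 h1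
      have e2 : 4 * parabolicCutoff R y ^ 3 * -(2 * y / R ^ 2) * (y * (v y * u y)) =
        -(8 / R ^ 2 * (parabolicCutoff R y ^ 3 * u y * (y ^ 2 * v y))) := by ring
      rw [e2, abs_neg, abs_of_nonneg (by positivity)]
      calc 8 / R ^ 2 * (parabolicCutoff R y ^ 3 * u y * (y ^ 2 * v y)) ≤
          8 / R ^ 2 * (1 * U * (y ^ 2 * v y)) := by gcongr
        _ = _ := by ring
    refine e1.trans ?_
    rw [intervalIntegral.integral_const_mul, intervalIntegral.integral_const_mul]
    have e6 := intervalIntegral_le_integral hR0.le h.integrable_moment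
      fun y => mul_nonneg (sq_nonneg _) (h.v_pos y).le
    rw [h.integral_moment] at e6
    gcongr
  have bW : |W - E| ≤ 4 / R ^ 2 * (U * Θ) := by
    rw [abs_sub_comm, hW, ← h.integral_vu, integral_sub_cutoff hR0 h.integrable_vu]
    have hw : ∀ y, 0 ≤ 1 - cutoffWeight R y := fun y => by linarith [(cutoffWeight_mem hR0 y).2]
    rw [abs_of_nonneg (integral_nonneg fun y =>
      mul_nonneg (hw y) (mul_pos (h.v_pos y) (h.u_pos y)).le)]
    calc _ ≤ ∫ y, 4 / R ^ 2 * (U * (y ^ 2 * v y)) := by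
          refine integral_mono (integrable_one_sub_cutoffWeight_mul hR0 h.integrable_vu)
            ((h.integrable_moment.const_mul U).const_mul _) fun y => ?_
          have hv0 := h.v_pos y
          have hu0 := h.u_pos y
          have hUy := hU y
          calc (1 - cutoffWeight R y) * (v y * u y) ≤ 4 * y ^ 2 / R ^ 2 * (v y * U) := by
                have := one_sub_cutoffWeight_le hR0 y
                gcongr
            _ = _ := by ring
      _ = 4 / R ^ 2 * (U * Θ) := by
        rw [integral_const_mul, integral_const_mul, h.integral_moment]
  have hF2 : 0 ≤ 2 * I - F := by
    have := integral_cutoff_le hR0 h.integrable_fisher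
      fun y => mul_nonneg (h.v_pos y).le (sq_nonneg _)
    rw [h.integral_fisher] at this
    linarith
  rw [hid]
  have hsplit : p / I * Y + p * (p - 1) / I * X - c * Z + c * (p - 1) * W -
      (p * (p - 1) / I * G + c * (p - 1) * E) =
      p * (p - 1) / I * (X - G) + (p / I * Y + (-(c * Z) + c * (p - 1) * (W - E))) := by ring
  rw [hsplit]
  have a1 : |p * (p - 1) / I * (X - G)| ≤ p * (p - 1) / I₀ * (δ * K + 1 / (4 * δ) *
      (2 * I - F)) := by
    rw [abs_mul, abs_of_pos (by positivity : 0 < p * (p - 1) / I)]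
    gcongr
  have a2 : |p / I * Y| ≤ p / I₀ * (8 / R * (1 / 2 * (K + U ^ 2))) := by
    rw [abs_mul, abs_of_pos (by positivity : 0 < p / I)]
    gcongr
  have hR2 : 1 / R ^ 2 ≤ 1 / R := by
    apply one_div_le_one_div_of_le hR0; nlinarith
  have hUΘ : 0 ≤ U * Θ := by positivity
  have a3 : |-(c * Z)| ≤ 8 * (c * (U * Θ)) * (1 / R) := by
    rw [abs_neg, abs_mul, abs_of_nonneg hc]
    calc c * |Z| ≤ c * (8 / R ^ 2 * (U * Θ)) := by gcongr
      _ = 8 * (c * (U * Θ)) * (1 / R ^ 2) := by ring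
      _ ≤ _ := by gcongr
  have a4 : |c * (p - 1) * (W - E)| ≤ 4 * (c * (U * Θ)) * (1 / R) := by
    rw [abs_mul, abs_of_nonneg (by positivity : 0 ≤ c * (p - 1))]
    have : c * (p - 1) ≤ c * 1 := by gcongr; linarith
    calc c * (p - 1) * |W - E| ≤ c * 1 * (4 / R ^ 2 * (U * Θ)) := by gcongr
      _ = 4 * (c * (U * Θ)) * (1 / R ^ 2) := by ring
      _ ≤ _ := by gcongr
  have b1 := abs_add_le (p * (p - 1) / I * (X - G))
    (p / I * Y + (-(c * Z) + c * (p - 1) * (W - E)))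
  have b2 := abs_add_le (p / I * Y) (-(c * Z) + c * (p - 1) * (W - E))
  have b3 := abs_add_le (-(c * Z)) (c * (p - 1) * (W - E))
  have hfin : p / I₀ * (8 / R * (1 / 2 * (K + U ^ 2))) + (8 * (c * (U * Θ)) * (1 / R) +
      4 * (c * (U * Θ)) * (1 / R)) =
      (p / I₀ * 4 * (K + U ^ 2) + 12 * (c * (U * Θ))) / R := by ring
  linarith

end IsFiniteProfile

/-- Space derivative of a function of `(y, s)`. -/
noncomputable def spaceDeriv (f : ℝ × ℝ → ℝ) (x : ℝ × ℝ) : ℝ := fderiv ℝ f x (1, 0)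

/-- Time derivative of a function of `(y, s)`. -/
noncomputable def timeDeriv (f : ℝ × ℝ → ℝ) (x : ℝ × ℝ) : ℝ := fderiv ℝ f x (0, 1)

/-- Smoothness on the strip `ℝ × (0, T)`. -/
def SmoothOnStrip (T : ℝ) (f : ℝ × ℝ → ℝ) : Prop :=
  ContDiffOn ℝ (⊤ : ℕ∞) f (univ ×ˢ Ioo 0 T)

theorem isOpen_strip (T : ℝ) : IsOpen ((univ : Set ℝ) ×ˢ Ioo 0 T) := isOpen_univ.prod isOpen_Ioo

namespace SmoothOnStrip

variable {T s : ℝ} {f : ℝ × ℝ → ℝ}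

theorem contDiffAt (hf : SmoothOnStrip T f) {x : ℝ × ℝ} (hx : x.2 ∈ Ioo 0 T) :
    ContDiffAt ℝ (⊤ : ℕ∞) f x :=
  ContDiffOn.contDiffAt hf ((isOpen_strip T).mem_nhds ⟨mem_univ _, hx⟩)

theorem differentiableAt (hf : SmoothOnStrip T f) {x : ℝ × ℝ} (hx : x.2 ∈ Ioo 0 T) :
    DifferentiableAt ℝ f x :=
  (hf.contDiffAt hx).differentiableAt (by simp)

theorem continuousAt (hf : SmoothOnStrip T f) {x : ℝ × ℝ} (hx : x.2 ∈ Ioo 0 T) :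
    ContinuousAt f x := (hf.differentiableAt hx).continuousAt

theorem fderiv_apply (hf : SmoothOnStrip T f) (w : ℝ × ℝ) :
    SmoothOnStrip T fun x => fderiv ℝ f x w :=
  (ContDiffOn.fderiv_of_isOpen hf (isOpen_strip T) (by simp)).clm_apply contDiffOn_const

theorem spaceDeriv (hf : SmoothOnStrip T f) : SmoothOnStrip T (spaceDeriv f) :=
  hf.fderiv_apply _

theorem timeDeriv (hf : SmoothOnStrip T f) : SmoothOnStrip T (timeDeriv f) :=
  hf.fderiv_apply _

theorem hasDerivAt_space (hf : SmoothOnStrip T f) (hs : s ∈ Ioo 0 T) (y : ℝ) :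
    HasDerivAt (fun z => f (z, s)) (_root_.spaceDeriv f (y, s)) y :=
  (hf.differentiableAt (x := (y, s)) hs).hasFDerivAt.comp_hasDerivAt y
    ((hasDerivAt_id y).prodMk (hasDerivAt_const y s))

theorem hasDerivAt_time (hf : SmoothOnStrip T f) (hs : s ∈ Ioo 0 T) (y : ℝ) :
    HasDerivAt (fun t => f (y, t)) (_root_.timeDeriv f (y, s)) s :=
  (hf.differentiableAt (x := (y, s)) hs).hasFDerivAt.comp_hasDerivAt s
    ((hasDerivAt_const s y).prodMk (hasDerivAt_id s))

theorem continuous_slice (hf : SmoothOnStrip T f) (hs : s ∈ Ioo 0 T) :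
    Continuous fun y => f (y, s) :=
  continuous_iff_continuousAt.2 fun y => (hf.hasDerivAt_space hs y).continuousAt

theorem space_time_comm (hf : SmoothOnStrip T f) {x : ℝ × ℝ} (hx : x.2 ∈ Ioo 0 T) :
    _root_.spaceDeriv (_root_.timeDeriv f) x = _root_.timeDeriv (_root_.spaceDeriv f) x := by
  have h1 : DifferentiableAt ℝ (fderiv ℝ f) x :=
    ((hf.contDiffAt hx).fderiv_right (m := 1) (by
      norm_num; exact WithTop.coe_le_coe.2 (le_top : (2 : ℕ∞) ≤ ⊤))).differentiableAt
      (by simp)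
  have h2 : IsSymmSndFDerivAt ℝ f x := (hf.contDiffAt hx).isSymmSndFDerivAt (by
    simp only [minSmoothness_of_isRCLikeNormedField]
    exact WithTop.coe_le_coe.2 (le_top : (2 : ℕ∞) ≤ ⊤))
  have h3 : ∀ w w' : ℝ × ℝ, fderiv ℝ (fun x => fderiv ℝ f x w) x w' =
      fderiv ℝ (fderiv ℝ f) x w' w := fun w w' => by
    rw [fderiv_clm_apply h1 (differentiableAt_const w)]
    simp
  unfold _root_.spaceDeriv _root_.timeDeriv
  rw [h3, h3]
  exact h2 _ _

theorem add {g : ℝ × ℝ → ℝ} (hf : SmoothOnStrip T f) (hg : SmoothOnStrip T g) :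
    SmoothOnStrip T fun x => f x + g x := ContDiffOn.add hf hg

theorem mul {g : ℝ × ℝ → ℝ} (hf : SmoothOnStrip T f) (hg : SmoothOnStrip T g) :
    SmoothOnStrip T fun x => f x * g x := ContDiffOn.mul hf hg

theorem const_mul (hf : SmoothOnStrip T f) (a : ℝ) :
    SmoothOnStrip T fun x => a * f x := contDiffOn_const.mul hf

theorem pow (hf : SmoothOnStrip T f) (n : ℕ) :
    SmoothOnStrip T fun x => f x ^ n := ContDiffOn.pow hf n

/-- Differentiation under the integral sign for smooth functions on the strip. -/
theorem hasDerivAt_integral (hf : SmoothOnStrip T f) (hs : s ∈ Ioo 0 T) {φ : ℝ → ℝ}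
    (hφ : Continuous φ) (a b : ℝ) :
    HasDerivAt (fun t => ∫ y in a..b, φ y * f (y, t))
      (∫ y in a..b, φ y * _root_.timeDeriv f (y, s)) s := by
  obtain ⟨ε, hε, hball⟩ := Metric.isOpen_iff.1 (isOpen_Ioo (a := (0 : ℝ)) (b := T)) s hs
  have hsub : ∀ t ∈ Metric.closedBall s (ε / 2), t ∈ Ioo 0 T := fun t ht =>
    hball (Metric.closedBall_subset_ball (by linarith) ht)
  have hcompact : IsCompact (uIcc a b ×ˢ Metric.closedBall s (ε / 2)) :=
    isCompact_uIcc.prod (isCompact_closedBall _ _)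
  have hcont : ContinuousOn (fun x : ℝ × ℝ => φ x.1 * _root_.timeDeriv f x)
      (uIcc a b ×ˢ Metric.closedBall s (ε / 2)) := fun x hx =>
    ((hφ.comp continuous_fst).continuousAt.mul
      (hf.timeDeriv.continuousAt (hsub _ hx.2))).continuousWithinAt
  obtain ⟨M, hM⟩ := hcompact.exists_bound_of_continuousOn hcont
  refine (intervalIntegral.hasDerivAt_integral_of_dominated_loc_of_deriv_le
    (s := Metric.ball s (ε / 2)) (bound := fun _ => M) (F := fun t y => φ y * f (y, t))
    (F' := fun t y => φ y * _root_.timeDeriv f (y, t))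
    (Metric.ball_mem_nhds _ (by linarith)) ?_ ?_ ?_ ?_ ?_ ?_).2
  · filter_upwards [Ioo_mem_nhds hs.1 hs.2] with t ht
    exact (hφ.mul (hf.continuous_slice ht)).aestronglyMeasurable
  · exact (hφ.mul (hf.continuous_slice hs)).intervalIntegrable _ _
  · exact (hφ.mul (hf.timeDeriv.continuous_slice hs)).aestronglyMeasurable
  · refine Eventually.of_forall fun y hy t ht => ?_
    exact hM (y, t) ⟨uIoc_subset_uIcc hy, Metric.ball_subset_closedBall ht⟩
  · exact intervalIntegrable_const
  · refine Eventually.of_forall fun y _ t ht => ?_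
    exact (hf.hasDerivAt_time (hsub t (Metric.ball_subset_closedBall ht)) y).const_mul _

end SmoothOnStrip

theorem SmoothOnStrip.contDiffAt_time {T s : ℝ} {f : ℝ × ℝ → ℝ} (hf : SmoothOnStrip T f)
    (hs : s ∈ Ioo 0 T) (y : ℝ) : ContDiffAt ℝ 1 (fun t => f (y, t)) s :=
  ((hf.contDiffAt (x := (y, s)) hs).of_le
    (WithTop.coe_le_coe.2 (le_top : (1 : ℕ∞) ≤ ⊤))).comp s
    (contDiffAt_const.prodMk contDiffAt_id)

theorem integral_cutoff_mono {f : ℝ → ℝ} (hf : Continuous f) (h0 : ∀ y, 0 ≤ f y) {R₀ R : ℝ}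
    (hR₀ : 0 < R₀) (hR : R₀ ≤ R) :
    ∫ y in (-R₀)..R₀, parabolicCutoff R₀ y ^ 4 * f y ≤
      ∫ y in (-R)..R, parabolicCutoff R y ^ 4 * f y := by
  have hR0 : 0 < R := hR₀.trans_le hR
  calc ∫ y in (-R₀)..R₀, parabolicCutoff R₀ y ^ 4 * f y
      ≤ ∫ y in (-R₀)..R₀, parabolicCutoff R y ^ 4 * f y := by
        refine intervalIntegral_mono_of_continuous hR₀.le (by fun_prop) (by fun_prop)
          fun y hy => mul_le_mul_of_nonneg_right ?_ (h0 y)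
        refine pow_le_pow_left₀ (parabolicCutoff_mem hR₀ hy).1 ?_ 4
        unfold parabolicCutoff
        gcongr
    _ ≤ ∫ y in (-R)..R, parabolicCutoff R y ^ 4 * f y := by
        refine intervalIntegral.integral_mono_interval (by linarith) (by linarith) hR
          ((ae_restrict_mem measurableSet_Ioc).mono fun y hy => ?_)
          (Continuous.intervalIntegrable (by fun_prop) _ _)
        exact mul_nonneg (pow_nonneg (parabolicCutoff_mem hR0 (Ioc_subset_Icc_self hy)).1 4) (h0 y)

/-- A smooth flow of finite pressure profiles solving
`∂ₛV = -∂_y (V ((p g g₁ + u g₂) / I - (2p/Θ) y))`. -/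
structure IsPressureFlow (p Θ T : ℝ) (I E : ℝ → ℝ) (V u g g₁ g₂ g₃ : ℝ × ℝ → ℝ) : Prop where
  smooth_V : SmoothOnStrip T V
  smooth_u : SmoothOnStrip T u
  smooth_g : SmoothOnStrip T g
  smooth_g₁ : SmoothOnStrip T g₁
  smooth_g₂ : SmoothOnStrip T g₂
  smooth_g₃ : SmoothOnStrip T g₃
  profile : ∀ s ∈ Ioo 0 T, IsFiniteProfile p Θ (I s) (E s) (fun y => V (y, s))
    (fun y => u (y, s)) (fun y => g (y, s)) (fun y => g₁ (y, s)) (fun y => g₂ (y, s))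
    (fun y => g₃ (y, s))
  hasDerivAt_flux : ∀ s ∈ Ioo 0 T, ∀ y, HasDerivAt (fun z => V (z, s) *
    ((p * g (z, s) * g₁ (z, s) + u (z, s) * g₂ (z, s)) / I s - 2 * p / Θ * z))
    (-timeDeriv V (y, s)) y
  hasDerivAt_potential : ∀ s ∈ Ioo 0 T, ∀ y, HasDerivAt
    (fun z => u (z, s) * timeDeriv V (z, s) / V (z, s)) (timeDeriv g (y, s)) y
  timeDeriv_vu : ∀ s ∈ Ioo 0 T, ∀ y,
    timeDeriv (fun x => V x * u x) (y, s) = p * (u (y, s) * timeDeriv V (y, s))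

namespace IsPressureFlow

variable {p Θ T τ : ℝ} {I E : ℝ → ℝ} {V u g g₁ g₂ g₃ : ℝ × ℝ → ℝ}

theorem exists_lipschitzOnWith (h : IsPressureFlow p Θ T I E V u g g₁ g₂ g₃) (hp : 1 < p)
    (hτ : τ ∈ Ioo 0 T) : ∃ M, ∃ t ∈ nhds τ, LipschitzOnWith M I t := by
  obtain ⟨y, hy⟩ := (h.profile τ hτ).exists_flux_deriv_ne_zero hp
  set N : ℝ → ℝ := fun s => V (y, s) * g (y, s) / u (y, s) *
    (p * g (y, s) * g₁ (y, s) + u (y, s) * g₂ (y, s)) + V (y, s) *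
    (p * g₁ (y, s) ^ 2 + (2 * p - 1) * (g (y, s) * g₂ (y, s)) + u (y, s) * g₃ (y, s)) with hN
  set D : ℝ → ℝ := fun s => 2 * p / Θ * (V (y, s) + y * (V (y, s) * g (y, s) / u (y, s))) -
    timeDeriv V (y, s) with hD
  have hND : ∀ s ∈ Ioo 0 T, N s = I s * D s := fun s hs => by
    have hI := (h.profile s hs).fisher_pos
    have h1 := ((h.profile s hs).hasDerivAt_momentum y).div_const (I s)
    have h2 := (((h.profile s hs).hasDerivAt_v y).mul (hasDerivAt_id y)).const_mul (2 * p / Θ)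
    have h3 := (h.hasDerivAt_flux s hs y).unique
      ((h1.sub h2).congr_of_eventuallyEq (Eventually.of_forall fun z => by
        simp only [Pi.sub_apply, Pi.mul_apply, id]; ring))
    have h4 : N s / I s = D s := by
      simp only [hN, hD]
      simp only [id, mul_one] at h3
      linear_combination -h3
    field_simp at h4
    linarith
  have hu := (h.profile τ hτ).u_pos y
  have hV := h.smooth_V.contDiffAt_time hτ y
  have hud := h.smooth_u.contDiffAt_time hτ y
  have hg := h.smooth_g.contDiffAt_time hτ y
  have hg1 := h.smooth_g₁.contDiffAt_time hτ y
  have hg2 := h.smooth_g₂.contDiffAt_time hτ y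
  have hg3 := h.smooth_g₃.contDiffAt_time hτ y
  have hVg := (hV.mul hg).div hud hu.ne'
  have hNc : ContDiffAt ℝ 1 N τ := (hVg.mul (((contDiffAt_const.mul hg).mul hg1).add
    (hud.mul hg2))).add (hV.mul (((contDiffAt_const.mul (hg1.pow 2)).add
      (contDiffAt_const.mul (hg.mul hg2))).add (hud.mul hg3)))
  have hDc : ContDiffAt ℝ 1 D τ := (contDiffAt_const.mul (hV.add
    (contDiffAt_const.mul hVg))).sub (h.smooth_V.timeDeriv.contDiffAt_time hτ y)
  have hDτ : D τ ≠ 0 := fun h0 => hy (by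
    have := hND τ hτ
    rw [h0, mul_zero] at this
    exact this)
  have hIc : ContDiffAt ℝ 1 I τ := by
    refine (hNc.div hDc hDτ).congr_of_eventuallyEq ?_
    filter_upwards [Ioo_mem_nhds hτ.1 hτ.2, hDc.continuousAt.eventually_ne hDτ] with s hs hs0
    rw [Pi.div_apply, hND s hs]
    field_simp
  exact hIc.exists_lipschitzOnWith

theorem hasDerivAt_integral_fisher (h : IsPressureFlow p Θ T I E V u g g₁ g₂ g₃) {s : ℝ}
    (hs : s ∈ Ioo 0 T) (R : ℝ) :
    HasDerivAt (fun t => ∫ y in (-R)..R, parabolicCutoff R y ^ 4 * (V (y, t) * g (y, t) ^ 2))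
      (2 * ∫ y in (-R)..R, parabolicCutoff R y ^ 4 *
        (timeDeriv V (y, s) * g (y, s) ^ 2 / 2 + V (y, s) * g (y, s) * timeDeriv g (y, s))) s := by
  have hη : Continuous fun y => parabolicCutoff R y ^ 4 := by fun_prop
  have hsm := h.smooth_V.mul (h.smooth_g.pow 2)
  refine (hsm.hasDerivAt_integral hs hη (-R) R).congr_deriv ?_
  rw [← intervalIntegral.integral_const_mul]
  congr 1
  ext y
  have h1 := (hsm.hasDerivAt_time hs y).unique
    ((h.smooth_V.hasDerivAt_time hs y).mul ((h.smooth_g.hasDerivAt_time hs y).pow 2))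
  rw [h1]
  push_cast
  ring

theorem smooth_dissipation (h : IsPressureFlow p Θ T I E V u g g₁ g₂ g₃) :
    SmoothOnStrip T fun x => V x * (p * g x * g₁ x + u x * g₂ x) ^ 2 :=
  h.smooth_V.mul ((((h.smooth_g.const_mul p).mul h.smooth_g₁).add
    (h.smooth_u.mul h.smooth_g₂)).pow 2)

/-- A Lipschitz bound on the Fisher information bounds the dissipation. -/
theorem dissipation_le (h : IsPressureFlow p Θ T I E V u g g₁ g₂ g₃) (hp : 1 < p)
    (hp2 : p ≤ 3 / 2) (hΘ : 0 < Θ) {a b I₁ M U : ℝ} (hab : Ioo a b ⊆ Ioo 0 T) (hU1 : 1 ≤ U)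
    (hI₁ : ∀ s ∈ Ioo a b, I s ≤ I₁) (hU : ∀ s ∈ Ioo a b, ∀ y, u (y, s) ≤ U)
    (hM : ∀ s ∈ Ioo a b, ∀ t ∈ Ioo a b, |I s - I t| ≤ M * |s - t|) :
    ∃ K, ∀ s ∈ Ioo a b, ∀ R, 1 ≤ R → ∫ y in (-R)..R, parabolicCutoff R y ^ 4 *
      (V (y, s) * (p * g (y, s) * g₁ (y, s) + u (y, s) * g₂ (y, s)) ^ 2) ≤ K := by
  set c := 2 * p / Θ with hc
  have hc0 : 0 ≤ c := by positivity
  set C := (4224 * U + 8 * c * I₁) * (8 * (4224 * U + 8 * c * I₁) + 32 * U) + 31104 * U ^ 2 +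
        c ^ 2 * I₁ * Θ + c * (72 * I₁ + 8 * U + 28 * U ^ 2) with hC
  refine ⟨4 * I₁ * (C + M), fun s hs R₀ hR₀ => ?_⟩
  have hI₁0 : 0 < I₁ := ((h.profile s (hab hs)).fisher_pos).trans_le (hI₁ s hs)
  set k : ℝ → ℝ → ℝ := fun R t => ∫ y in (-R)..R, parabolicCutoff R y ^ 4 *
    (V (y, t) * (p * g (y, t) * g₁ (y, t) + u (y, t) * g₂ (y, t)) ^ 2) with hk
  by_contra! hcon
  change 4 * I₁ * (C + M) < k R₀ s at hcon
  obtain ⟨κ, hκ1, hκ2⟩ := exists_between hcon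
  have hcont : ContinuousAt (k R₀) s :=
    (h.smooth_dissipation.hasDerivAt_integral (hab hs)
      (φ := fun y => parabolicCutoff R₀ y ^ 4) (by fun_prop) (-R₀) R₀).continuousAt
  obtain ⟨δ, hδ, hδs⟩ := Metric.eventually_nhds_iff_ball.1
    ((hcont.tendsto.eventually_const_lt hκ2).and (Ioo_mem_nhds hs.1 hs.2))
  set t := s + δ / 2 with ht
  have hball : ∀ x ∈ Icc s t, x ∈ Metric.ball s δ := fun x hx => by
    rw [Metric.mem_ball, Real.dist_eq, abs_of_nonneg (by linarith [hx.1])]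
    linarith [hx.2]
  have hJ : ∀ x ∈ Icc s t, x ∈ Ioo a b := fun x hx => (hδs x (hball x hx)).2
  have htI : t ∈ Icc s t := ⟨by linarith, le_rfl⟩
  have hsI : s ∈ Icc s t := ⟨le_rfl, by linarith⟩
  have hdec : ∀ R, R₀ ≤ R →
      (∫ y in (-R)..R, parabolicCutoff R y ^ 4 * (V (y, t) * g (y, t) ^ 2)) -
        (∫ y in (-R)..R, parabolicCutoff R y ^ 4 * (V (y, s) * g (y, s) ^ 2)) ≤
      2 * (C - κ / (4 * I₁)) * (t - s) := fun R hR => by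
    have hd : ∀ x ∈ Icc s t, _ := fun x hx => h.hasDerivAt_integral_fisher (hab (hJ x hx)) R
    refine Convex.image_sub_le_mul_sub_of_deriv_le (convex_Icc s t)
      (fun x hx => (hd x hx).continuousAt.continuousWithinAt)
      (fun x hx => (hd x (interior_subset hx)).differentiableAt.differentiableWithinAt)
      (fun x hx => ?_) s hsI t htI (by linarith)
    have hx' := interior_subset hx
    have hxT := hab (hJ x hx')
    have hP := h.profile x hxT
    rw [(hd x hx').deriv]
    have h1 := hP.integral_fisher_variation_le hp hp2 (hR₀.trans hR) (hU x (hJ x hx')) hU1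
      hP.fisher_pos (hI₁ x (hJ x hx')) hc0 hP.integrable_fisher hP.integral_fisher
      hP.integrable_v hP.integral_v hP.integrable_moment hP.integral_moment
      (h.hasDerivAt_flux x hxT) (h.smooth_V.timeDeriv.continuous_slice hxT)
      (h.hasDerivAt_potential x hxT) (h.smooth_g.timeDeriv.continuous_slice hxT)
    have h2 : κ ≤ k R x := (hδs x (hball x hx')).1.le.trans
      (integral_cutoff_mono (h.smooth_dissipation.continuous_slice hxT)
        (fun y => mul_nonneg (hP.v_pos y).le (sq_nonneg _)) (by linarith) hR)
    have h3 : κ / (4 * I₁) ≤ 1 / (4 * I₁) * k R x := by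
      rw [div_eq_mul_one_div, mul_comm]
      gcongr
    rw [← hC] at h1
    change _ ≤ -(1 / (4 * I₁)) * k R x + C at h1
    linarith
  have hlim := le_of_tendsto
    ((tendsto_integral_cutoff (h.profile t (hab (hJ t htI))).integrable_fisher).sub
      (tendsto_integral_cutoff (h.profile s (hab (hJ s hsI))).integrable_fisher))
    ((eventually_ge_atTop R₀).mono hdec)
  rw [(h.profile t (hab (hJ t htI))).integral_fisher,
    (h.profile s (hab (hJ s hsI))).integral_fisher] at hlim
  have hL := hM t (hJ t htI) s (hJ s hsI)
  have hts : t - s = δ / 2 := by rw [ht]; ring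
  rw [hts, abs_of_pos (by linarith : 0 < δ / 2)] at hL
  rw [hts] at hlim
  have hL' := (abs_le.1 hL).1
  have h4 : C + M < κ / (4 * I₁) := by
    rw [lt_div_iff₀ (by positivity)]
    linarith
  nlinarith

theorem exists_local_bounds (h : IsPressureFlow p Θ T I E V u g g₁ g₂ g₃) (hp : 1 < p)
    (hp2 : p ≤ 3 / 2) (hΘ : 0 < Θ) (hτ : τ ∈ Ioo 0 T) :
    ∃ a b I₀ U K, τ ∈ Ioo a b ∧ Ioo a b ⊆ Ioo 0 T ∧ 0 < I₀ ∧ ContinuousOn I (Ioo a b) ∧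
      ∀ s ∈ Ioo a b, I₀ ≤ I s ∧ (∀ y, u (y, s) ≤ U) ∧
        ∀ R, 1 ≤ R → ∫ y in (-R)..R, parabolicCutoff R y ^ 4 *
          (V (y, s) * (p * g (y, s) * g₁ (y, s) + u (y, s) * g₂ (y, s)) ^ 2) ≤ K := by
  obtain ⟨M, t, ht, hLip⟩ := h.exists_lipschitzOnWith hp hτ
  have hI := (h.profile τ hτ).fisher_pos
  have hIc : ContinuousAt I τ := hLip.continuousOn.continuousAt ht
  obtain ⟨a, b, hτab, hab⟩ := mem_nhds_iff_exists_Ioo_subset.1 (inter_mem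
    (inter_mem ht (Ioo_mem_nhds hτ.1 hτ.2))
    ((hIc.tendsto.eventually_const_lt (show I τ / 2 < I τ by linarith)).and
      (hIc.tendsto.eventually_lt_const (show I τ < 2 * I τ by linarith))))
  have habT : Ioo a b ⊆ Ioo 0 T := fun s hs => (hab hs).1.2
  have hU : ∀ s ∈ Ioo a b, ∀ y, u (y, s) ≤ 1 + p * (1 + 2 * (2 * I τ)) / 2 := fun s hs y => by
    refine ((h.profile s (habT hs)).u_le hp y).trans ?_
    have := (hab hs).2.2
    gcongr
  obtain ⟨K, hK⟩ := h.dissipation_le hp hp2 hΘ (M := M) habT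
    (by have : 0 ≤ p * (1 + 2 * (2 * I τ)) / 2 := by positivity
        linarith)
    (fun s hs => (hab hs).2.2.le) hU (fun s hs t ht => by
      simpa [Real.dist_eq] using hLip.dist_le_mul s (hab hs).1.1 t (hab ht).1.1)
  exact ⟨a, b, I τ / 2, _, K, hτab, habT, by linarith,
    hLip.continuousOn.mono fun s hs => (hab hs).1.1,
    fun s hs => ⟨(hab hs).2.1.le, hU s hs, hK s hs⟩⟩

end IsPressureFlow

namespace IsPressureFlow

variable {p Θ T τ : ℝ} {I E : ℝ → ℝ} {V u g g₁ g₂ g₃ : ℝ × ℝ → ℝ}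

theorem tendstoLocallyUniformlyOn_integral_fisher (h : IsPressureFlow p Θ T I E V u g g₁ g₂ g₃)
    {a b : ℝ} (hab : Ioo a b ⊆ Ioo 0 T) (hI : ContinuousOn I (Ioo a b)) :
    TendstoLocallyUniformlyOn (fun (n : ℕ) s => ∫ y in (-((n : ℝ) + 1))..((n : ℝ) + 1),
      parabolicCutoff ((n : ℝ) + 1) y ^ 4 * (V (y, s) * g (y, s) ^ 2)) (fun s => 2 * I s)
      atTop (Ioo a b) := by
  refine Monotone.tendstoLocallyUniformlyOn_of_forall_tendsto
    (fun n s hs => (h.hasDerivAt_integral_fisher (hab hs) _).continuousAt.continuousWithinAt)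
    (fun s hs n n' hnn => ?_) (continuousOn_const.mul hI) fun s hs => ?_
  · have hP := h.profile s (hab hs)
    have hn : (n : ℝ) ≤ n' := by exact_mod_cast hnn
    exact integral_cutoff_mono (hP.continuous_v.mul (hP.continuous_g.pow 2))
      (fun y => mul_nonneg (hP.v_pos y).le (sq_nonneg _)) (by positivity) (by linarith)
  · have hP := h.profile s (hab hs)
    rw [← hP.integral_fisher]
    exact (tendsto_integral_cutoff hP.integrable_fisher).comp
      (tendsto_atTop_add_const_right _ _ tendsto_natCast_atTop_atTop)

/-- Entropy production along the flow. -/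
theorem hasDerivAt_entropy (h : IsPressureFlow p Θ T I E V u g g₁ g₂ g₃) (hp : 1 < p)
    (hp2 : p ≤ 3 / 2) (hΘ : 0 < Θ) (hτ : τ ∈ Ioo 0 T) :
    HasDerivAt E (p * (p - 1) / I τ * (∫ y, V (y, τ) * (g (y, τ) *
      (p * g (y, τ) * g₁ (y, τ) + u (y, τ) * g₂ (y, τ)))) + 2 * p / Θ * (p - 1) * E τ) τ := by
  obtain ⟨a, b, I₀, U, K, hτab, hab, hI₀, hIc, hbd⟩ := h.exists_local_bounds hp hp2 hΘ hτ
  have hp1 : 0 < p - 1 := by linarith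
  have hp0 : 0 < p := by linarith
  set c := 2 * p / Θ with hc
  have hc0 : 0 ≤ c := by positivity
  refine hasDerivAt_of_tendstoLocallyUniformlyOn (l := (atTop : Filter ℕ))
    (f := fun n s => ∫ y in (-((n : ℝ) + 1))..((n : ℝ) + 1),
      parabolicCutoff ((n : ℝ) + 1) y ^ 4 * (V (y, s) * u (y, s)))
    (f' := fun n s => ∫ y in (-((n : ℝ) + 1))..((n : ℝ) + 1),
      parabolicCutoff ((n : ℝ) + 1) y ^ 4 * (p * (u (y, s) * timeDeriv V (y, s))))
    (g' := fun s => p * (p - 1) / I s * (∫ y, V (y, s) * (g (y, s) *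
      (p * g (y, s) * g₁ (y, s) + u (y, s) * g₂ (y, s)))) + c * (p - 1) * E s)
    isOpen_Ioo ?_ (Eventually.of_forall fun n s hs => ?_) (fun s hs => ?_) hτab
  · rw [Metric.tendstoLocallyUniformlyOn_iff]
    intro ε hε x hx
    set A := p * (p - 1) / I₀ with hA
    have hA0 : 0 < A := by positivity
    set C := p / I₀ * 4 * (K + U ^ 2) + 12 * (c * (U * Θ)) with hC
    set δ := ε / (3 * (A * (|K| + 1))) with hδ
    have hδ0 : 0 < δ := by positivity
    obtain ⟨t, ht, hevt⟩ := Metric.tendstoLocallyUniformlyOn_iff.1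
      (h.tendstoLocallyUniformlyOn_integral_fisher hab hIc) (ε * (4 * δ) / (3 * A))
      (by positivity) x hx
    have hlim : Tendsto (fun n : ℕ => C / ((n : ℝ) + 1)) atTop (nhds 0) :=
      (tendsto_atTop_add_const_right _ _ tendsto_natCast_atTop_atTop).const_div_atTop C
    refine ⟨t ∩ Ioo a b, inter_mem ht self_mem_nhdsWithin, ?_⟩
    filter_upwards [hevt, hlim.eventually_lt_const (show 0 < ε / 3 by positivity)] with n hn hnC
    rintro s ⟨hst, hs⟩
    obtain ⟨hIs, hUs, hKs⟩ := hbd s hs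
    have hsT := hab hs
    have hmain := (h.profile s hsT).abs_entropy_production_sub_le hp hp2
      (R := (n : ℝ) + 1) (by linarith [n.cast_nonneg (α := ℝ)]) hUs hc0 hI₀ hIs hδ0 hKs
      (h.hasDerivAt_flux s hsT) (h.smooth_V.timeDeriv.continuous_slice hsT)
    rw [dist_comm, Real.dist_eq]
    refine hmain.trans_lt ?_
    have h1 := (le_abs_self _).trans_lt (hn s hst)
    rw [← hA, ← hC, mul_add]
    have h2 : A * (δ * K) ≤ ε / 3 := by
      have : A * (δ * (|K| + 1)) = ε / 3 := by rw [hδ]; field_simp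
      rw [← this]
      gcongr
      linarith [le_abs_self K]
    have h3 : A * (1 / (4 * δ) * (2 * I s - ∫ y in (-((n : ℝ) + 1))..((n : ℝ) + 1),
        parabolicCutoff ((n : ℝ) + 1) y ^ 4 * (V (y, s) * g (y, s) ^ 2))) < ε / 3 := by
      calc _ < A * (1 / (4 * δ) * (ε * (4 * δ) / (3 * A))) := by gcongr
        _ = ε / 3 := by field_simp
    linarith
  · refine ((h.smooth_V.mul h.smooth_u).hasDerivAt_integral (hab hs)
      (φ := fun y => parabolicCutoff ((n : ℝ) + 1) y ^ 4) (by fun_prop) _ _).congr_deriv ?_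
    simp only [h.timeDeriv_vu s (hab hs)]
  · have hP := h.profile s (hab hs)
    rw [← hP.integral_vu]
    exact (tendsto_integral_cutoff hP.integrable_vu).comp
      (tendsto_atTop_add_const_right _ _ tendsto_natCast_atTop_atTop)

theorem deriv_entropy_le (h : IsPressureFlow p Θ T I E V u g g₁ g₂ g₃) (hp : 1 < p)
    (hp2 : p ≤ 3 / 2) (hΘ : 0 < Θ) (hτ : τ ∈ Ioo 0 T) (hE : 0 < E τ) :
    deriv E τ ≤ (p - 1) * (2 * p / Θ * E τ - 4 * p ^ 3 * I τ / E τ) := by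
  obtain ⟨a, b, I₀, U, K, hτab, hab, hI₀, hIc, hbd⟩ := h.exists_local_bounds hp hp2 hΘ hτ
  have hP := h.profile τ hτ
  have hI := hP.fisher_pos
  have hp1 : 0 < p - 1 := by linarith
  rw [(h.hasDerivAt_entropy hp hp2 hΘ hτ).deriv]
  have h1 := hP.integral_vgj_le hp hE (hbd τ hτab).2.2
  have h2 := mul_le_mul_of_nonneg_left h1 (show 0 ≤ p * (p - 1) / I τ by positivity)
  have h3 : p * (p - 1) / I τ * -(4 * p ^ 2 * I τ ^ 2 / E τ) =
      -((p - 1) * (4 * p ^ 3 * I τ / E τ)) := by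
    field_simp
  rw [h3] at h2
  linarith

end IsPressureFlow

theorem HasDerivAt.lnp_comp {p : ℝ} (hp : 1 < p) {f : ℝ → ℝ} {f' x : ℝ} (hf : HasDerivAt f f' x)
    (hx : 0 < f x) :
    HasDerivAt (fun x => (f x ^ (p - 1) - 1) / (p - 1)) (f x ^ (p - 1) * f' / f x) x := by
  have hp1 : p - 1 ≠ 0 := by linarith
  refine (((hf.rpow_const (p := p - 1) (Or.inl hx.ne')).sub_const 1).div_const (p - 1)).congr_deriv
    ?_
  rw [Real.rpow_sub_one hx.ne']
  field_simp

theorem isPressureFlow_of_pde {p Θ T : ℝ} (hp : 1 < p) {v : ℝ → ℝ → ℝ}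
    (hsmooth : ContDiffOn ℝ (⊤ : ℕ∞) (Function.uncurry v) (univ ×ˢ Ioo 0 T))
    (hpos : ∀ y τ, τ ∈ Ioo 0 T → 0 < v y τ)
    (hpde : ∀ y τ, τ ∈ Ioo 0 T →
      deriv (fun s => v y s) τ =
        -(1 / fisherP p (fun z => v z τ)) *
            deriv (deriv (fun z =>
              (v z τ) ^ p * deriv (deriv (fun w => lnp p (v w τ))) z)) y
        + (2 * p / Θ) * deriv (fun z => z * v z τ) y)
    (hdens : ∀ τ ∈ Ioo 0 T,
      Integrable (fun y => v y τ) ∧ (∫ y : ℝ, v y τ) = 1)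
    (hdecay : ∀ τ ∈ Ioo 0 T, RapidDecay (fun y => v y τ))
    (hI : ∀ τ ∈ Ioo 0 T, 0 < fisherP p (fun y => v y τ))
    (hvp : ∀ τ ∈ Ioo 0 T, Integrable (fun y => v y τ ^ p))
    (hmom : ∀ τ ∈ Ioo 0 T,
      Integrable (fun y => y ^ 2 * v y τ) ∧ (∫ y : ℝ, y ^ 2 * v y τ) = Θ) :
    ∃ u g g₁ g₂ g₃, IsPressureFlow p Θ T (fun s => fisherP p fun y => v y s)
      (fun s => ∫ y, v y s ^ p) (Function.uncurry v) u g g₁ g₂ g₃ := by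
  have hp1 : p - 1 ≠ 0 := by linarith
  set V := Function.uncurry v with hV
  have hVs : SmoothOnStrip T V := hsmooth
  have hus : SmoothOnStrip T fun x => V x ^ (p - 1) :=
    hsmooth.rpow_const_of_ne fun x hx => (hpos x.1 x.2 hx.2).ne'
  set u : ℝ × ℝ → ℝ := fun x => V x ^ (p - 1) with hu
  have hLs : SmoothOnStrip T fun x => (u x - 1) / (p - 1) :=
    (ContDiffOn.sub hus contDiffOn_const).div_const _
  set L : ℝ × ℝ → ℝ := fun x => (u x - 1) / (p - 1) with hL
  set g := spaceDeriv L with hg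
  set g₁ := spaceDeriv g with hg1
  set g₂ := spaceDeriv g₁ with hg2
  set g₃ := spaceDeriv g₂ with hg3
  have hgs : SmoothOnStrip T g := hLs.spaceDeriv
  have hg1s : SmoothOnStrip T g₁ := hgs.spaceDeriv
  have hg2s : SmoothOnStrip T g₂ := hg1s.spaceDeriv
  have hg3s : SmoothOnStrip T g₃ := hg2s.spaceDeriv
  have hVpos : ∀ s ∈ Ioo 0 T, ∀ y, 0 < V (y, s) := fun s hs y => hpos y s hs
  have hupos : ∀ s ∈ Ioo 0 T, ∀ y, 0 < u (y, s) := fun s hs y =>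
    Real.rpow_pos_of_pos (hVpos s hs y) _
  have hgV : ∀ s ∈ Ioo 0 T, ∀ y, g (y, s) = u (y, s) * spaceDeriv V (y, s) / V (y, s) :=
    fun s hs y => (hLs.hasDerivAt_space hs y).unique
      ((hVs.hasDerivAt_space hs y).lnp_comp hp (hVpos s hs y))
  have hLt : ∀ s ∈ Ioo 0 T, ∀ y,
      timeDeriv L (y, s) = u (y, s) * timeDeriv V (y, s) / V (y, s) :=
    fun s hs y => (hLs.hasDerivAt_time hs y).unique
      ((hVs.hasDerivAt_time hs y).lnp_comp hp (hVpos s hs y))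
  have hVu : ∀ s ∈ Ioo 0 T, ∀ y, V (y, s) * u (y, s) = v y s ^ p := fun s hs y => by
    have := hpos y s hs
    change v y s * v y s ^ (p - 1) = _
    rw [Real.rpow_sub_one this.ne']
    field_simp
  have hlnp : ∀ s ∈ Ioo 0 T, deriv (fun w => lnp p (v w s)) = fun y => g (y, s) :=
    fun s hs => by
      ext y
      refine Eq.trans ?_ (hLs.hasDerivAt_space hs y).deriv
      simp only [lnp, if_neg hp.ne']
      rfl
  have hlnp' : ∀ s ∈ Ioo 0 T, deriv (deriv (fun w => lnp p (v w s))) = fun y => g₁ (y, s) :=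
    fun s hs => by
      rw [hlnp s hs]
      ext y
      exact (hgs.hasDerivAt_space hs y).deriv
  have hfisher : ∀ s ∈ Ioo 0 T,
      ∫ y, V (y, s) * g (y, s) ^ 2 = 2 * fisherP p fun y => v y s := fun s hs => by
    rw [fisherP, hlnp s hs]
    change _ = 2 * (1 / 2 * ∫ y, V (y, s) * g (y, s) ^ 2)
    ring
  have hprof : ∀ s ∈ Ioo 0 T, IsFiniteProfile p Θ (fisherP p fun y => v y s) (∫ y, v y s ^ p)
      (fun y => V (y, s)) (fun y => u (y, s)) (fun y => g (y, s)) (fun y => g₁ (y, s))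
      (fun y => g₂ (y, s)) (fun y => g₃ (y, s)) := fun s hs =>
    { v_pos := hVpos s hs
      u_pos := hupos s hs
      hasDerivAt_v := fun y => (hVs.hasDerivAt_space hs y).congr_deriv (by
        have h1 := hVpos s hs y
        have h2 := hupos s hs y
        rw [hgV s hs y]
        field_simp)
      hasDerivAt_u := fun y =>
        (((hLs.hasDerivAt_space hs y).const_mul (p - 1)).add_const 1).congr_of_eventuallyEq
          (Eventually.of_forall fun z => by simp only [hL]; field_simp; ring)
      hasDerivAt_g := hgs.hasDerivAt_space hs
      hasDerivAt_g₁ := hg1s.hasDerivAt_space hs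
      hasDerivAt_g₂ := hg2s.hasDerivAt_space hs
      continuous_g₃ := hg3s.continuous_slice hs
      u_eq := fun y => rfl
      tendsto_v := by
        have h1 := hdecay s hs 0 0
        simp only [pow_zero, one_mul, iteratedDeriv_zero] at h1
        exact h1
      integrable_v := (hdens s hs).1
      integral_v := (hdens s hs).2
      integrable_moment := (hmom s hs).1
      integral_moment := (hmom s hs).2
      integrable_vu := by simpa only [hVu s hs] using hvp s hs
      integral_vu := by simp only [hVu s hs]
      integrable_fisher := by
        by_contra hcon
        have h1 := hfisher s hs
        rw [integral_undef hcon] at h1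
        linarith [hI s hs]
      integral_fisher := hfisher s hs
      fisher_pos := hI s hs }
  refine ⟨u, g, g₁, g₂, g₃, hVs, hus, hgs, hg1s, hg2s, hg3s, hprof, fun s hs y => ?_,
    fun s hs y => ?_, fun s hs y => ?_⟩
  · have hP := hprof s hs
    have h1 : deriv (fun z => v z s ^ p * deriv (deriv (fun w => lnp p (v w s))) z) =
        fun y => V (y, s) * (p * g (y, s) * g₁ (y, s) + u (y, s) * g₂ (y, s)) := by
      ext z
      rw [hlnp' s hs, ← (hP.hasDerivAt_vug₁ z).deriv]
      simp only [hVu s hs]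
    have h2 := (hP.hasDerivAt_v y).mul (hasDerivAt_id y)
    have h3 := (hVs.hasDerivAt_time hs y).deriv
    have h4 : deriv (fun z => z * v z s) y = _ := (h2.congr_of_eventuallyEq
      (Eventually.of_forall fun z => mul_comm z (v z s))).deriv
    have h5 := hpde y s hs
    rw [h1, (hP.hasDerivAt_momentum y).deriv, h4] at h5
    refine (((hP.hasDerivAt_momentum y).div_const (fisherP p fun y => v y s)).sub
      (h2.const_mul (2 * p / Θ))).congr_of_eventuallyEq (Eventually.of_forall fun z => ?_)
      |>.congr_deriv ?_
    · simp only [Pi.sub_apply, Pi.mul_apply, id]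
      ring
    · rw [← h3]
      change _ = -deriv (fun t => v y t) s
      rw [h5]
      ring
  · have h1 : timeDeriv g (y, s) = spaceDeriv (timeDeriv L) (y, s) :=
      (hLs.space_time_comm (x := (y, s)) hs).symm
    rw [h1]
    exact (hLs.timeDeriv.hasDerivAt_space hs y).congr_of_eventuallyEq
      (Eventually.of_forall fun z => (hLt s hs z).symm)
  · have h1 := (hVs.hasDerivAt_time hs y).mul
      ((((hLs.hasDerivAt_time hs y).const_mul (p - 1)).add_const 1).congr_of_eventuallyEq
          (f₁ := fun t => u (y, t)) (Eventually.of_forall fun z => by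
            simp only [hL]; field_simp; ring))
    rw [((hVs.mul hus).hasDerivAt_time hs y).unique h1, hLt s hs y]
    have := hVpos s hs y
    field_simp
    ring

/-- the differential inequality for the relative Rényi entropy along
solutions of the nonlocal rescaled equation:
`(d/dτ)[R_p(B_p) − R_p(v(·,τ))] ≤ −(2p/Θ₀)(exp(2(R_p(B_p) − R_p(v(·,τ)))) − 1)`. -/
theorem relative_renyi_differential_inequality
    (p Θ₀ T : ℝ) (hp1 : 1 < p) (hp2 : p ≤ 3 / 2) (hΘ₀ : 0 < Θ₀) (hT : 0 < T)
    (v : ℝ → ℝ → ℝ)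
    (hsmooth : ContDiffOn ℝ (⊤ : ℕ∞) (Function.uncurry v) (univ ×ˢ Ioo 0 T))
    (hpos : ∀ y τ, τ ∈ Ioo 0 T → 0 < v y τ)
    (hpde : ∀ y τ, τ ∈ Ioo 0 T →
      deriv (fun s => v y s) τ =
        -(1 / fisherP p (fun z => v z τ)) *
            deriv (deriv (fun z =>
              (v z τ) ^ p * deriv (deriv (fun w => lnp p (v w τ))) z)) y
        + (2 * p / Θ₀) * deriv (fun z => z * v z τ) y)
    (hdens : ∀ τ ∈ Ioo 0 T,
      Integrable (fun y => v y τ) ∧ (∫ y : ℝ, v y τ) = 1)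
    (hdecay : ∀ τ ∈ Ioo 0 T, RapidDecay (fun y => v y τ))
    (hI : ∀ τ ∈ Ioo 0 T, 0 < fisherP p (fun y => v y τ))
    (hvp : ∀ τ ∈ Ioo 0 T,
      Integrable (fun y => v y τ ^ p) ∧ 0 < ∫ y : ℝ, v y τ ^ p)
    (hmom : ∀ τ ∈ Ioo 0 T,
      Integrable (fun y => y ^ 2 * v y τ) ∧ (∫ y : ℝ, y ^ 2 * v y τ) = Θ₀)
    (Cp σ : ℝ) (hCp : 0 < Cp) (hσ : 0 < σ)
    (B : ℝ → ℝ)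
    (hBdef : ∀ y, B y = (max (Cp - (p - 1) / p * y ^ 2 / (2 * σ)) 0) ^ (1 / (p - 1)))
    (hBmass : (∫ y : ℝ, B y) = 1)
    (hBmom : (∫ y : ℝ, y ^ 2 * B y) = Θ₀)
    (hσdef : σ = Real.sqrt Θ₀ / (p * Real.sqrt (2 * fisherP p B))) :
    ∀ τ ∈ Ioo 0 T,
      deriv (fun s => renyi p B - renyi p (fun y => v y s)) τ ≤
        -(2 * p / Θ₀) *
          (Real.exp (2 * (renyi p B - renyi p (fun y => v y τ))) - 1) := by
  intro τ hτ
  have hpm : 0 < p - 1 := by linarith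
  obtain ⟨u, g, g₁, g₂, g₃, hflow⟩ := isPressureFlow_of_pde hp1 hsmooth hpos hpde hdens hdecay hI
    (fun s hs => (hvp s hs).1) hmom
  have hE := (hvp τ hτ).2
  have hIτ := hI τ hτ
  set E : ℝ → ℝ := fun s => ∫ y, v y s ^ p with hEdef
  set I : ℝ → ℝ := fun s => fisherP p fun y => v y s with hIdef
  change 0 < E τ at hE
  change 0 < I τ at hIτ
  have hdE := hflow.hasDerivAt_entropy hp1 hp2 hΘ₀ hτ
  have hle := hflow.deriv_entropy_le hp1 hp2 hΘ₀ hτ hE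
  have hsharp : (p * √(2 * I τ * Θ₀) / E τ) ^ (1 - p) * E τ ≤ ∫ y, B y ^ p := by
    have hκ : 0 < (p - 1) / (2 * σ * p) := by positivity
    have hB : ∀ y, B y = (max ((p - 1) / (2 * σ * p) *
        (√(2 * σ * p * Cp / (p - 1)) ^ 2 - |y| ^ 2)) 0) ^ (1 / (p - 1)) := fun y => by
      rw [hBdef, Real.sq_sqrt (by positivity), sq_abs]
      congr 2
      field_simp
    have hr : 0 < √(2 * σ * p * Cp / (p - 1)) := by positivity
    refine (hflow.profile τ hτ).sharp_ineq hp1 hΘ₀ hE hr ?_ (fun y hy => ?_) (fun y hy => ?_)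
      hBmass hBmom
    · rw [funext hB]
      exact Continuous.rpow_const (by fun_prop) fun _ => Or.inr (by positivity)
    · rw [hB]
      have := abs_lt.2 hy
      exact Real.rpow_pos_of_pos (lt_max_of_lt_left (mul_pos hκ (sub_pos.2 (by gcongr)))) _
    · rw [hB, max_eq_right (mul_nonpos_of_nonneg_of_nonpos hκ.le (sub_nonpos.2 (by gcongr))),
        Real.zero_rpow (by positivity)]
  set X := p * √(2 * I τ * Θ₀) / E τ with hX
  have hX0 : 0 < X := by positivity
  set EB := ∫ y, B y ^ p with hEB
  have hEB0 : 0 < EB := (mul_pos (Real.rpow_pos_of_pos hX0 _) hE).trans_le hsharp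
  have hlog : (1 - p) * Real.log X + Real.log (E τ) ≤ Real.log EB := by
    rw [← Real.log_rpow hX0, ← Real.log_mul (Real.rpow_pos_of_pos hX0 _).ne' hE.ne']
    exact Real.log_le_log (mul_pos (Real.rpow_pos_of_pos hX0 _) hE) hsharp
  have hexp : Real.exp (2 * (renyi p B - renyi p fun y => v y τ)) ≤ X ^ 2 := by
    rw [← Real.exp_log (pow_pos hX0 2), Real.exp_le_exp, Real.log_pow]
    change 2 * (1 / (1 - p) * Real.log EB - 1 / (1 - p) * Real.log (E τ)) ≤ _
    have h1 : 1 / (1 - p) * Real.log EB - 1 / (1 - p) * Real.log (E τ) =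
        (Real.log (E τ) - Real.log EB) / (p - 1) := by
      have : 1 - p ≠ 0 := by linarith
      field_simp
      ring
    have h2 : (Real.log (E τ) - Real.log EB) / (p - 1) ≤ Real.log X := by
      rw [div_le_iff₀ hpm]
      linarith
    rw [h1]
    push_cast
    linarith
  have hX2 : 2 * p / Θ₀ * X ^ 2 = 4 * p ^ 3 * I τ / E τ ^ 2 := by
    rw [hX, div_pow, mul_pow, Real.sq_sqrt (by positivity)]
    field_simp
    ring
  have hderiv : deriv (fun s => renyi p B - renyi p fun y => v y s) τ =
      deriv E τ / E τ / (p - 1) := by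
    have h1 := ((hdE.log hE.ne').const_mul (1 / (1 - p))).const_sub (renyi p B)
    rw [hdE.deriv]
    refine (h1.deriv).trans ?_
    have : 1 - p ≠ 0 := by linarith
    field_simp
    ring
  rw [hderiv]
  calc deriv E τ / E τ / (p - 1)
      ≤ (p - 1) * (2 * p / Θ₀ * E τ - 4 * p ^ 3 * I τ / E τ) / E τ / (p - 1) := by gcongr
    _ = 2 * p / Θ₀ - 2 * p / Θ₀ * X ^ 2 := by
      rw [hX2]
      field_simp
    _ ≤ _ := by
      have := mul_le_mul_of_nonneg_left hexp (show 0 ≤ 2 * p / Θ₀ by positivity)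
      linarith
end

section
/- Let 1 < p ≤ 3/2 and let u : ℝ × (0, ∞) → ℝ be a smooth nonnegative solution of ∂_t u = −(1/(p−1)) ∂_x²( u^p ∂_x²(u^{p−1}) ) with initial data u₀ satisfying ∫_ℝ u₀ dx = 1, ∫_ℝ x u₀ dx = 0, ∫_ℝ x² u₀ dx = Θ₀ ∈ (0,∞), and R_p(u₀) < +∞; assume that for every t > 0 the function u(·,t) is a probability density with zero first moment, finite second moment Θ_t = ∫_ℝ x² u(x,t) dx ≥ Θ₀, and ∫_ℝ u(·,t)^p dx ∈ (0,∞). Then there exists a constant C > 0, independent of u, such that for all t > 0: ‖u(·,t) − U_p(·,t)‖_{L¹(ℝ)} ≤ C ( R_p(U_p(·,t)) − R_p(u(·,t)) )^{1/2}, where U_p(x,t) = (Θ_t/Θ₀)^{−1/2} ( C_p − ((p−1)/p) (Θ₀/Θ_t) x²/(2σ_t) )_+^{1/(p−1)} is the rescaled Barenblatt profile of unit mass with second moment Θ_t, the parameter σ_t > 0 being chosen so that the second moment of U_p(·,t) equals Θ_t. -/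
open MeasureTheory Filter Set

/-- Second-order lower Taylor bound for `s ↦ s ^ p` at `1` on `[0, 1]`, for `1 < p ≤ 2`. -/
theorem taylor_two_le_rpow {p s : ℝ} (hp1 : 1 < p) (hp2 : p ≤ 2) (hs0 : 0 ≤ s) (hs1 : s ≤ 1) :
    1 + p * (s - 1) + p * (p - 1) / 2 * (s - 1) ^ 2 ≤ s ^ p := by
  let g : ℝ → ℝ := fun s => s ^ p - (1 + p * (s - 1) + p * (p - 1) / 2 * (s - 1) ^ 2)
  have hg : ∀ x : ℝ, HasDerivAt g (p * x ^ (p - 1) - (p + p * (p - 1) * (x - 1))) x := by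
    intro x
    have h1 : HasDerivAt (fun s : ℝ => s ^ p) (p * x ^ (p - 1)) x :=
      Real.hasDerivAt_rpow_const (Or.inr hp1.le)
    have h2 : HasDerivAt (fun s : ℝ => s - 1) 1 x := (hasDerivAt_id x).sub_const 1
    have h3 := ((h2.const_mul p).const_add 1).add ((h2.pow 2).const_mul (p * (p - 1) / 2))
    refine (h1.sub h3).congr_deriv ?_
    simp
    ring
  have hanti : AntitoneOn g (Icc 0 1) := by
    refine antitoneOn_of_deriv_nonpos (convex_Icc 0 1)
      (fun x _ => (hg x).continuousAt.continuousWithinAt)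
      (fun x _ => (hg x).differentiableAt.differentiableWithinAt) ?_
    intro x hx
    rw [interior_Icc] at hx
    rw [(hg x).deriv]
    have h := rpow_one_add_le_one_add_mul_self (s := x - 1) (p := p - 1)
      (by linarith [hx.1]) (by linarith) (by linarith)
    rw [add_sub_cancel] at h
    nlinarith
  have h := hanti ⟨hs0, hs1⟩ (right_mem_Icc.2 zero_le_one) hs1
  simp only [g, Real.one_rpow] at h
  linarith

/-- Quantitative strict convexity of `a ↦ a ^ p` around `b`, for `1 < p ≤ 2` and `b ≤ H`. -/
theorem rpow_bregman_lower {p a b H : ℝ} (hp1 : 1 < p) (hp2 : p ≤ 2) (ha : 0 ≤ a) (hb : 0 ≤ b)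
    (hbH : b ≤ H) :
    b ^ p + p * b ^ (p - 1) * (a - b) + p * (p - 1) / 2 * H ^ (p - 2) * (max (b - a) 0) ^ 2
      ≤ a ^ p := by
  rcases hb.eq_or_lt with rfl | hb
  · rw [Real.zero_rpow (by linarith), Real.zero_rpow (by linarith), max_eq_right (by linarith)]
    simpa using Real.rpow_nonneg ha p
  have hs : 0 ≤ a / b := by positivity
  have hab : a = b * (a / b) := by field_simp
  have hap : a ^ p = b ^ p * (a / b) ^ p := by
    rw [← Real.mul_rpow hb.le hs, ← hab]
  have hbp : b ^ p = b ^ (p - 1) * b := by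
    rw [← Real.rpow_add_one hb.ne']; congr 1; ring
  have hbp2 : b ^ p = b ^ (p - 2) * b ^ 2 := by
    rw [← Real.rpow_natCast b 2, ← Real.rpow_add hb]; congr 1; push_cast; ring
  have hlin : p * b ^ (p - 1) * (a - b) = b ^ p * (p * (a / b - 1)) := by
    rw [hbp]; field_simp
  have hbpos : 0 < b ^ p := Real.rpow_pos_of_pos hb p
  rcases le_total a b with h | h
  · have h1 := taylor_two_le_rpow hp1 hp2 hs ((div_le_one hb).2 h)
    have hH : H ^ (p - 2) ≤ b ^ (p - 2) :=
      Real.rpow_le_rpow_of_nonpos hb hbH (by linarith)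
    have hquad : b ^ p * (a / b - 1) ^ 2 = b ^ (p - 2) * (b - a) ^ 2 := by
      rw [hbp2]; field_simp; ring
    rw [max_eq_left (by linarith), hlin, hap]
    have h2 := mul_le_mul_of_nonneg_left h1 hbpos.le
    have hc : 0 ≤ p * (p - 1) / 2 * (b - a) ^ 2 := by
      have : 0 ≤ p - 1 := by linarith
      positivity
    have h3 := mul_le_mul_of_nonneg_left hH hc
    have h4 : b ^ p * (p * (p - 1) / 2 * (a / b - 1) ^ 2)
        = p * (p - 1) / 2 * (b - a) ^ 2 * b ^ (p - 2) := by
      linear_combination (p * (p - 1) / 2) * hquad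
    linarith
  · have h1 := one_add_mul_self_le_rpow_one_add (s := a / b - 1) (by linarith) hp1.le
    rw [add_sub_cancel] at h1
    rw [max_eq_right (by linarith), hlin, hap]
    have h2 := mul_le_mul_of_nonneg_left h1 hbpos.le
    linarith

/-- The Barenblatt profile of height `H` and support `[-L, L]`. -/
noncomputable def barenblattProfile (p H L : ℝ) (x : ℝ) : ℝ :=
  H * (max (1 - x ^ 2 / L ^ 2) 0) ^ (1 / (p - 1))

section barenblattProfile

variable {p H L : ℝ}

theorem barenblattProfile_nonneg (hH : 0 < H) (x : ℝ) : 0 ≤ barenblattProfile p H L x :=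
  mul_nonneg hH.le (Real.rpow_nonneg (le_max_right _ _) _)

theorem barenblattProfile_le (hp : 1 < p) (hH : 0 < H) (x : ℝ) :
    barenblattProfile p H L x ≤ H := by
  have h0 : 0 ≤ x ^ 2 / L ^ 2 := by positivity
  exact mul_le_of_le_one_right hH.le (Real.rpow_le_one (le_max_right _ _)
    (max_le (by linarith) zero_le_one) (one_div_nonneg.2 (by linarith)))

theorem barenblattProfile_eq_zero (hp : 1 < p) (hL : 0 < L) {x : ℝ} (hx : x ∉ Icc (-L) L) :
    barenblattProfile p H L x = 0 := by
  have h1 : 1 ≤ x ^ 2 / L ^ 2 := by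
    rw [one_le_div (by positivity)]
    refine sq_le_sq' ?_ ?_ |>.trans (sq_abs x).le
    · linarith [abs_nonneg x]
    · by_contra! h
      exact hx (abs_le.1 h.le)
  have hq : 1 / (p - 1) ≠ 0 := (one_div_pos.2 (by linarith)).ne'
  rw [barenblattProfile, max_eq_right (by linarith), Real.zero_rpow hq, mul_zero]

theorem barenblattProfile_rpow (hp : 1 < p) (hH : 0 < H) (x : ℝ) :
    barenblattProfile p H L x ^ (p - 1) = H ^ (p - 1) * max (1 - x ^ 2 / L ^ 2) 0 := by
  have hm : 0 ≤ max (1 - x ^ 2 / L ^ 2) 0 := le_max_right _ _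
  rw [barenblattProfile, Real.mul_rpow hH.le (Real.rpow_nonneg hm _), ← Real.rpow_mul hm,
    one_div_mul_cancel (by linarith), Real.rpow_one]

theorem barenblattProfile_continuous (hp : 1 < p) : Continuous (barenblattProfile p H L) := by
  unfold barenblattProfile
  refine continuous_const.mul (Continuous.rpow_const (by fun_prop) fun x => Or.inr ?_)
  exact one_div_nonneg.2 (by linarith)

theorem barenblattProfile_rpow_le_indicator (hp : 1 < p) (hH : 0 < H) (hL : 0 < L) (x : ℝ) :
    barenblattProfile p H L x ^ p ≤ (Icc (-L) L).indicator (fun _ => H ^ p) x := by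
  by_cases hx : x ∈ Icc (-L) L
  · rw [indicator_of_mem hx]
    exact Real.rpow_le_rpow (barenblattProfile_nonneg hH x) (barenblattProfile_le hp hH x)
      (by linarith)
  · rw [indicator_of_notMem hx, barenblattProfile_eq_zero hp hL hx, Real.zero_rpow (by linarith)]

theorem integrable_indicator_Icc_const (L c : ℝ) :
    Integrable ((Icc (-L) L).indicator fun _ : ℝ => c) :=
  (integrable_indicator_iff measurableSet_Icc).2 (integrableOn_const (by simp))

theorem integral_indicator_Icc_const (hL : 0 < L) (c : ℝ) :
    ∫ x : ℝ, (Icc (-L) L).indicator (fun _ => c) x = 2 * L * c := by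
  rw [integral_indicator measurableSet_Icc, setIntegral_const, Real.volume_real_Icc, smul_eq_mul,
    max_eq_left (by linarith)]
  ring

theorem barenblattProfile_rpow_integrable (hp : 1 < p) (hH : 0 < H) (hL : 0 < L) :
    Integrable fun x => barenblattProfile p H L x ^ p := by
  refine (integrable_indicator_Icc_const L (H ^ p)).mono'
    ((barenblattProfile_continuous hp).rpow_const fun x =>
      Or.inr (by linarith)).aestronglyMeasurable
    (ae_of_all _ fun x => ?_)
  rw [Real.norm_of_nonneg (Real.rpow_nonneg (barenblattProfile_nonneg hH x) _)]
  exact barenblattProfile_rpow_le_indicator hp hH hL x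

theorem integral_barenblattProfile_rpow_le (hp : 1 < p) (hH : 0 < H) (hL : 0 < L) :
    ∫ x, barenblattProfile p H L x ^ p ≤ 2 * L * H ^ p := by
  rw [← integral_indicator_Icc_const hL]
  exact integral_mono (barenblattProfile_rpow_integrable hp hH hL)
    (integrable_indicator_Icc_const L _) (barenblattProfile_rpow_le_indicator hp hH hL)

theorem mul_le_integral_barenblattProfile (hp : 1 < p) (hH : 0 < H) (hL : 0 < L)
    (hint : Integrable (barenblattProfile p H L)) :
    L * H * (3 / 4) ^ (1 / (p - 1)) ≤ ∫ x, barenblattProfile p H L x := by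
  have h := integral_indicator_Icc_const (half_pos hL) (H * (3 / 4) ^ (1 / (p - 1)))
  calc L * H * (3 / 4) ^ (1 / (p - 1))
      = 2 * (L / 2) * (H * (3 / 4) ^ (1 / (p - 1))) := by ring
    _ ≤ _ := by
      rw [← h]
      refine integral_mono (integrable_indicator_Icc_const _ _) hint fun x => ?_
      by_cases hx : x ∈ Icc (-(L / 2)) (L / 2)
      · rw [indicator_of_mem hx]
        refine mul_le_mul_of_nonneg_left (Real.rpow_le_rpow (by norm_num) (le_max_of_le_left ?_)
          (one_div_nonneg.2 (by linarith))) hH.le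
        have h1 : x ^ 2 / L ^ 2 ≤ 1 / 4 := by
          rw [div_le_iff₀ (by positivity)]
          nlinarith [hx.1, hx.2]
        linarith
      · rw [indicator_of_notMem hx]
        exact barenblattProfile_nonneg hH x

/-- Pointwise comparison of `f ^ p` with its expansion at the Barenblatt profile, in which the
first-order term is a quadratic polynomial times the difference. -/
theorem barenblattProfile_bregman_lower (hp1 : 1 < p) (hp2 : p ≤ 2) (hH : 0 < H)
    {a : ℝ} (ha : 0 ≤ a) (x : ℝ) :
    barenblattProfile p H L x ^ p
      + p * H ^ (p - 1) * ((1 - x ^ 2 / L ^ 2) * (a - barenblattProfile p H L x))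
      + p * (p - 1) / 2 * H ^ (p - 2) * (max (barenblattProfile p H L x - a) 0) ^ 2 ≤ a ^ p := by
  have h := rpow_bregman_lower hp1 hp2 ha (barenblattProfile_nonneg (L := L) (p := p) hH x)
    (barenblattProfile_le hp1 hH x)
  have hc : 0 ≤ p * H ^ (p - 1) := by positivity
  have key : (1 - x ^ 2 / L ^ 2) * (a - barenblattProfile p H L x)
      ≤ max (1 - x ^ 2 / L ^ 2) 0 * (a - barenblattProfile p H L x) := by
    rcases le_total 0 (1 - x ^ 2 / L ^ 2) with h0 | h0
    · rw [max_eq_left h0]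
    · have hB : barenblattProfile p H L x = 0 := by
        rw [barenblattProfile, max_eq_right h0,
          Real.zero_rpow (one_div_pos.2 (by linarith)).ne', mul_zero]
      rw [max_eq_right h0, hB]
      nlinarith
  rw [barenblattProfile_rpow hp1 hH] at h
  have := mul_le_mul_of_nonneg_left key hc
  linarith

/-- Csiszár–Kullback type inequality: a density with the mass and second moment of a Barenblatt
profile is controlled in `L¹` by the difference of the integrals of the `p`-th powers. -/
theorem sq_integral_abs_sub_barenblattProfile_le {f : ℝ → ℝ} (hp1 : 1 < p) (hp2 : p ≤ 2)
    (hH : 0 < H) (hL : 0 < L) (hf0 : ∀ x, 0 ≤ f x)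
    (hf : Integrable f) (hf2 : Integrable fun x => x ^ 2 * f x) (hfp : Integrable fun x => f x ^ p)
    (hB : Integrable (barenblattProfile p H L))
    (hB2 : Integrable fun x => x ^ 2 * barenblattProfile p H L x)
    (hmass : ∫ x, f x = ∫ x, barenblattProfile p H L x)
    (hmom : ∫ x, x ^ 2 * f x = ∫ x, x ^ 2 * barenblattProfile p H L x) :
    p * (p - 1) / 2 * H ^ (p - 2) * (∫ x, |f x - barenblattProfile p H L x|) ^ 2
      ≤ 8 * L * ((∫ x, f x ^ p) - ∫ x, barenblattProfile p H L x ^ p) := by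
  set B := barenblattProfile p H L with hBdef
  set m : ℝ → ℝ := fun x => max (B x - f x) 0 with hm
  have hm0 : ∀ x, 0 ≤ m x := fun x => le_max_right _ _
  have hmB : ∀ x, m x ≤ B x := fun x =>
    max_le (by linarith [hf0 x]) (barenblattProfile_nonneg hH x)
  have hmi : Integrable m := (hB.sub hf).pos_part
  have hd : Integrable fun x => f x - B x := hf.sub hB
  have hd2 : Integrable fun x => x ^ 2 * f x - x ^ 2 * B x := hf2.sub hB2
  have hm2i : Integrable fun x => m x ^ 2 := by
    refine (hmi.const_mul H).mono' (hmi.aestronglyMeasurable.pow 2) (ae_of_all _ fun x => ?_)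
    rw [Real.norm_of_nonneg (sq_nonneg _), sq]
    exact mul_le_mul_of_nonneg_right ((hmB x).trans (barenblattProfile_le hp1 hH x)) (hm0 x)
  have habs : ∫ x, |f x - B x| = 2 * ∫ x, m x := by
    have h1 : ∀ x, |f x - B x| = (f x - B x) + 2 * m x := by
      intro x
      simp only [hm]
      rcases le_total (f x) (B x) with h | h
      · rw [abs_of_nonpos (by linarith), max_eq_left (by linarith)]; ring
      · rw [abs_of_nonneg (by linarith), max_eq_right (by linarith)]; ring
    simp_rw [h1]
    rw [integral_add hd (hmi.const_mul 2), integral_sub hf hB, hmass, sub_self, zero_add,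
      integral_const_mul]
  have hcs : (∫ x, m x) ^ 2 ≤ 2 * L * ∫ x, m x ^ 2 := by
    have h1 : ∀ l : ℝ, 2 * l * (∫ x, m x) ≤ (∫ x, m x ^ 2) + 2 * L * l ^ 2 := by
      intro l
      rw [← integral_const_mul, ← integral_indicator_Icc_const hL,
        ← integral_add hm2i (integrable_indicator_Icc_const L _)]
      refine integral_mono (hmi.const_mul _)
        (hm2i.add (integrable_indicator_Icc_const L _)) fun x => ?_
      by_cases hx : x ∈ Icc (-L) L
      · simp only [indicator_of_mem hx]
        nlinarith [sq_nonneg (m x - l)]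
      · have h0 : m x = 0 :=
          le_antisymm ((hmB x).trans (barenblattProfile_eq_zero hp1 hL hx).le) (hm0 x)
        simp [indicator_of_notMem hx, h0]
    have h2 := h1 ((∫ x, m x) / (2 * L))
    have h3 : 2 * ((∫ x, m x) / (2 * L)) * (∫ x, m x) - 2 * L * ((∫ x, m x) / (2 * L)) ^ 2
        = (∫ x, m x) ^ 2 / (2 * L) := by
      field_simp
      ring
    have h4 : (∫ x, m x) ^ 2 / (2 * L) ≤ ∫ x, m x ^ 2 := by linarith
    rw [div_le_iff₀ (by positivity)] at h4
    linarith
  have hlin : Integrable fun x => (1 - x ^ 2 / L ^ 2) * (f x - B x) := by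
    refine (hd.sub (hd2.div_const (L ^ 2))).congr (ae_of_all _ fun x => ?_)
    simp only [Pi.sub_apply]
    ring
  have hlin0 : ∫ x, (1 - x ^ 2 / L ^ 2) * (f x - B x) = 0 := by
    have h1 : ∀ x, (1 - x ^ 2 / L ^ 2) * (f x - B x)
        = (f x - B x) - (x ^ 2 * f x - x ^ 2 * B x) / L ^ 2 := fun x => by ring
    simp_rw [h1]
    rw [integral_sub hd (hd2.div_const _), integral_div, integral_sub hf hB,
      integral_sub hf2 hB2, hmass, hmom]
    simp
  have hBp : Integrable fun x => B x ^ p := barenblattProfile_rpow_integrable hp1 hH hL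
  have hent : p * (p - 1) / 2 * H ^ (p - 2) * (∫ x, m x ^ 2)
      ≤ (∫ x, f x ^ p) - ∫ x, B x ^ p := by
    have h1 := integral_mono ((hBp.add (hlin.const_mul (p * H ^ (p - 1)))).add
      (hm2i.const_mul (p * (p - 1) / 2 * H ^ (p - 2)))) hfp
      fun x => barenblattProfile_bregman_lower (L := L) hp1 hp2 hH (hf0 x) x
    have h2 := integral_add (hBp.add (hlin.const_mul (p * H ^ (p - 1))))
      (hm2i.const_mul (p * (p - 1) / 2 * H ^ (p - 2)))
    have h3 := integral_add hBp (hlin.const_mul (p * H ^ (p - 1)))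
    simp only [Pi.add_apply, integral_const_mul, hlin0] at h1 h2 h3
    linarith
  have hc : 0 ≤ p * (p - 1) / 2 * H ^ (p - 2) := by
    have : 0 ≤ p - 1 := by linarith
    positivity
  rw [habs]
  nlinarith [mul_le_mul_of_nonneg_left hcs hc, mul_le_mul_of_nonneg_left hent hL.le]

/-- Scale-invariant form of `sq_integral_abs_sub_barenblattProfile_le` for probability densities. -/
theorem sq_integral_abs_sub_barenblattProfile_le_ratio {f : ℝ → ℝ} (hp1 : 1 < p) (hp2 : p ≤ 2)
    (hH : 0 < H) (hL : 0 < L) (hf0 : ∀ x, 0 ≤ f x)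
    (hf : Integrable f) (hf2 : Integrable fun x => x ^ 2 * f x) (hfp : Integrable fun x => f x ^ p)
    (hB : Integrable (barenblattProfile p H L))
    (hB2 : Integrable fun x => x ^ 2 * barenblattProfile p H L x)
    (hf1 : ∫ x, f x = 1) (hB1 : ∫ x, barenblattProfile p H L x = 1)
    (hmom : ∫ x, x ^ 2 * f x = ∫ x, x ^ 2 * barenblattProfile p H L x)
    (hBp : 0 < ∫ x, barenblattProfile p H L x ^ p) :
    1 ≤ (∫ x, f x ^ p) / (∫ x, barenblattProfile p H L x ^ p) ∧
    (∫ x, |f x - barenblattProfile p H L x|) ^ 2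
      ≤ 32 / (p * (p - 1)) * (((4 / 3) ^ (1 / (p - 1))) ^ 2) *
        ((∫ x, f x ^ p) / (∫ x, barenblattProfile p H L x ^ p) - 1) := by
  have h1 := sq_integral_abs_sub_barenblattProfile_le hp1 hp2 hH hL hf0 hf hf2 hfp hB hB2
    (hf1.trans hB1.symm) hmom
  have h2 := integral_barenblattProfile_rpow_le hp1 hH hL
  have h3 := mul_le_integral_barenblattProfile hp1 hH hL hB
  rw [hB1] at h3
  set T := ∫ x, |f x - barenblattProfile p H L x|
  set F := ∫ x, f x ^ p
  set G := ∫ x, barenblattProfile p H L x ^ p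
  have hp0 : 0 < p - 1 := by linarith
  have hc : 0 < p * (p - 1) / 2 * H ^ (p - 2) := by positivity
  have hFG : G ≤ F := by
    have h4 := (mul_nonneg hc.le (sq_nonneg T)).trans h1
    have h5 := nonneg_of_mul_nonneg_right h4 (by positivity : 0 < 8 * L)
    linarith
  have hr : 1 ≤ F / G := (one_le_div hBp).2 hFG
  refine ⟨hr, ?_⟩
  have hFr : F - G = G * (F / G - 1) := by field_simp
  have hr0 : 0 ≤ F / G - 1 := by linarith
  have hHp : H ^ p = H ^ (p - 2) * H ^ 2 := by
    rw [← Real.rpow_natCast H 2, ← Real.rpow_add hH]; congr 1; push_cast; ring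
  have hq : (0 : ℝ) < (4 / 3) ^ (1 / (p - 1)) := by positivity
  have hLH : L * H ≤ (4 / 3) ^ (1 / (p - 1)) := by
    have h4 : ((3 : ℝ) / 4) ^ (1 / (p - 1)) * (4 / 3) ^ (1 / (p - 1)) = 1 := by
      rw [← Real.mul_rpow (by norm_num) (by norm_num)]; norm_num
    have h5 := mul_le_mul_of_nonneg_right h3 hq.le
    rw [mul_assoc, h4] at h5
    linarith
  have hLH2 : (L * H) ^ 2 ≤ ((4 / 3) ^ (1 / (p - 1))) ^ 2 :=
    pow_le_pow_left₀ (by positivity) hLH 2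
  have h6 : p * (p - 1) / 2 * H ^ (p - 2) * T ^ 2
      ≤ p * (p - 1) / 2 * H ^ (p - 2) *
        (32 / (p * (p - 1)) * (((4 / 3) ^ (1 / (p - 1))) ^ 2) * (F / G - 1)) := by
    calc _ ≤ 8 * L * (F - G) := h1
      _ = 8 * L * (G * (F / G - 1)) := by rw [hFr]
      _ ≤ 8 * L * (2 * L * H ^ p * (F / G - 1)) := by gcongr
      _ = 16 * H ^ (p - 2) * (L * H) ^ 2 * (F / G - 1) := by rw [hHp]; ring
      _ ≤ 16 * H ^ (p - 2) * ((4 / 3) ^ (1 / (p - 1))) ^ 2 * (F / G - 1) := by gcongr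
      _ = _ := by field_simp; ring
  exact le_of_mul_le_mul_left h6 hc

end barenblattProfile

/-- A quantity bounded both by `4` and by a multiple of `r - 1` is bounded by a multiple of
`log r`. -/
theorem le_mul_log_of_le_sub_one {T K r : ℝ} (hK : 0 ≤ K) (hr : 1 ≤ r) (hT4 : T ≤ 4)
    (hT : T ≤ K * (r - 1)) : T ≤ (2 * K + 8) * Real.log r := by
  have hlog := Real.log_nonneg hr
  rcases le_total r 2 with h | h
  · have h1 := Real.one_sub_inv_le_log_of_pos (by linarith : 0 < r)
    have h2 : r - 1 ≤ 2 * Real.log r := by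
      have h3 : r - 1 = r * (1 - r⁻¹) := by field_simp
      have h4 := mul_le_mul_of_nonneg_left h1 (by linarith : 0 ≤ r)
      nlinarith
    nlinarith
  · have h1 : Real.log 2 ≤ Real.log r := Real.log_le_log (by norm_num) h
    have h2 := Real.log_two_gt_d9
    nlinarith

/-- A Barenblatt profile in its usual parametrization, written through height and support. -/
theorem mul_max_sub_rpow_eq_barenblattProfile {p A M k : ℝ} (hM : 0 < M) (hk : 0 < k) (x : ℝ) :
    A * (max (M - k * x ^ 2) 0) ^ (1 / (p - 1))
      = barenblattProfile p (A * M ^ (1 / (p - 1))) (Real.sqrt (M / k)) x := by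
  have h : max (M - k * x ^ 2) 0 = M * max (1 - x ^ 2 / Real.sqrt (M / k) ^ 2) 0 := by
    rw [Real.sq_sqrt (by positivity), mul_max_of_nonneg _ _ hM.le, mul_zero]
    congr 1
    field_simp
  rw [h, Real.mul_rpow hM.le (le_max_right _ _), barenblattProfile, mul_assoc]

/-- The `L¹` distance of a probability density to the Barenblatt profile with the same second
moment is controlled by the square root of the relative Rényi entropy. -/
theorem integral_abs_sub_barenblattProfile_le_sqrt_renyi {p H L : ℝ} {f : ℝ → ℝ} (hp1 : 1 < p)
    (hp2 : p ≤ 2) (hH : 0 < H) (hL : 0 < L) (hf0 : ∀ x, 0 ≤ f x)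
    (hf : Integrable f) (hf2 : Integrable fun x => x ^ 2 * f x) (hfp : Integrable fun x => f x ^ p)
    (hB : Integrable (barenblattProfile p H L))
    (hB2 : Integrable fun x => x ^ 2 * barenblattProfile p H L x)
    (hf1 : ∫ x, f x = 1) (hB1 : ∫ x, barenblattProfile p H L x = 1)
    (hmom : ∫ x, x ^ 2 * f x = ∫ x, x ^ 2 * barenblattProfile p H L x)
    (hFp : 0 < ∫ x, f x ^ p) :
    (∫ x, |f x - barenblattProfile p H L x|) ≤
      Real.sqrt ((2 * (32 / (p * (p - 1)) * (((4 / 3) ^ (1 / (p - 1))) ^ 2)) + 8) * (p - 1)) *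
        Real.sqrt (renyi p (barenblattProfile p H L) - renyi p f) := by
  have hp0 : 0 < p - 1 := by linarith
  have hB0 : ∀ x, 0 ≤ barenblattProfile p H L x := barenblattProfile_nonneg hH
  have hBp : 0 < ∫ x, barenblattProfile p H L x ^ p := by
    have hBpi := barenblattProfile_rpow_integrable hp1 hH hL
    refine (integral_nonneg fun x => Real.rpow_nonneg (hB0 x) p).lt_of_ne' fun h0 => ?_
    rw [integral_eq_zero_iff_of_nonneg (fun x => Real.rpow_nonneg (hB0 x) p) hBpi] at h0
    have h1 : ∫ x, barenblattProfile p H L x = 0 := by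
      refine integral_eq_zero_of_ae (h0.mono fun x hx => ?_)
      exact (Real.rpow_eq_zero (hB0 x) (by linarith)).1 hx
    linarith
  obtain ⟨hr, hT⟩ := sq_integral_abs_sub_barenblattProfile_le_ratio hp1 hp2 hH hL hf0 hf hf2 hfp
    hB hB2 hf1 hB1 hmom hBp
  have hT0 : 0 ≤ ∫ x, |f x - barenblattProfile p H L x| := integral_nonneg fun x => abs_nonneg _
  have hT2 : ∫ x, |f x - barenblattProfile p H L x| ≤ 2 := by
    calc _ ≤ ∫ x, (f x + barenblattProfile p H L x) := by
          refine integral_mono (hf.sub hB).abs (hf.add hB) fun x => ?_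
          exact abs_le.2 ⟨by linarith [hf0 x], by linarith [hB0 x]⟩
      _ = 2 := by rw [integral_add hf hB, hf1, hB1]; norm_num
  have h := le_mul_log_of_le_sub_one (by positivity) hr (by nlinarith) hT
  have hren : Real.log ((∫ x, f x ^ p) / ∫ x, barenblattProfile p H L x ^ p)
      = (p - 1) * (renyi p (barenblattProfile p H L) - renyi p f) := by
    rw [Real.log_div hFp.ne' hBp.ne', renyi, renyi]
    have : 1 - p ≠ 0 := by linarith
    field_simp
    ring
  rw [hren, ← mul_assoc] at h
  rw [← Real.sqrt_mul (by positivity)]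
  exact Real.le_sqrt_of_sq_le h

/-- Theorem 3.1 of the paper: for `1 < p ≤ 3/2`, smooth nonnegative
solutions of `∂_t u = −(1/(p−1)) ∂_x²(u^p ∂_x²(u^{p−1}))` with unit-mass, centered
initial data of finite second moment and finite Rényi entropy converge in `L¹` to the
rescaled Barenblatt profile `U_p(·,t)` of the same second moment, at the rate given by
the square root of the relative Rényi entropy, with a constant independent of `u`. -/
theorem thm_L1_convergence_renyi
    (p : ℝ) (hp1 : 1 < p) (hp2 : p ≤ 3 / 2) :
    ∃ C : ℝ, 0 < C ∧
      ∀ (u : ℝ → ℝ → ℝ) (u₀ : ℝ → ℝ) (Θ₀ : ℝ) (Θ : ℝ → ℝ) (Cp : ℝ)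
        (σt : ℝ → ℝ) (Up : ℝ → ℝ → ℝ),
        ContDiffOn ℝ (⊤ : ℕ∞) (Function.uncurry u) (univ ×ˢ Ioi 0) →
        (∀ x t, 0 < t → 0 ≤ u x t) →
        (∀ x t, 0 < t →
          deriv (fun s => u x s) t =
            -(1 / (p - 1)) * deriv (deriv (fun z =>
              (u z t) ^ p * deriv (deriv (fun w => (u w t) ^ (p - 1))) z)) x) →
        (∀ x, 0 ≤ u₀ x) →
        Integrable u₀ → (∫ x : ℝ, u₀ x) = 1 →
        Integrable (fun x => x * u₀ x) → (∫ x : ℝ, x * u₀ x) = 0 →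
        Integrable (fun x => x ^ 2 * u₀ x) → (∫ x : ℝ, x ^ 2 * u₀ x) = Θ₀ →
        0 < Θ₀ →
        Integrable (fun x => u₀ x ^ p) → 0 < (∫ x : ℝ, u₀ x ^ p) →
        (∀ x, Tendsto (fun t => u x t) (nhdsWithin 0 (Ioi 0)) (nhds (u₀ x))) →
        (∀ t : ℝ, 0 < t →
          Integrable (fun x => u x t) ∧ (∫ x : ℝ, u x t) = 1 ∧
          Integrable (fun x => x * u x t) ∧ (∫ x : ℝ, x * u x t) = 0 ∧
          Integrable (fun x => x ^ 2 * u x t) ∧ (∫ x : ℝ, x ^ 2 * u x t) = Θ t ∧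
          Θ₀ ≤ Θ t ∧
          Integrable (fun x => u x t ^ p) ∧ 0 < (∫ x : ℝ, u x t ^ p)) →
        0 < Cp →
        (∀ t : ℝ, 0 < t → 0 < σt t) →
        (∀ x t, Up x t =
          (Θ t / Θ₀) ^ (-(1 : ℝ) / 2) *
            (max (Cp - (p - 1) / p * (Θ₀ / Θ t) * x ^ 2 / (2 * σt t)) 0) ^
              (1 / (p - 1))) →
        (∀ t : ℝ, 0 < t →
          (∫ x : ℝ, Up x t) = 1 ∧ (∫ x : ℝ, x ^ 2 * Up x t) = Θ t) →
        ∀ t : ℝ, 0 < t →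
          (∫ x : ℝ, |u x t - Up x t|) ≤
            C * Real.sqrt (renyi p (fun x => Up x t) - renyi p (fun x => u x t)) := by
  refine ⟨Real.sqrt ((2 * (32 / (p * (p - 1)) * (((4 / 3) ^ (1 / (p - 1))) ^ 2)) + 8) * (p - 1)),
    ?_, ?_⟩
  · have : 0 < p - 1 := by linarith
    positivity
  intro u u₀ Θ₀ Θ Cp σt Up _ hu0 _ _ _ _ _ _ _ _ hΘ₀ _ _ _ hu hCp hσ hUp hUpint t ht
  obtain ⟨hf, hf1, _, _, hf2, hfm, hΘ, hfp, hFp⟩ := hu t ht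
  obtain ⟨hU1, hU2⟩ := hUpint t ht
  have hp0 : 0 < p - 1 := by linarith
  have hσt := hσ t ht
  have hΘt : 0 < Θ t := hΘ₀.trans_le hΘ
  have hk : 0 < (p - 1) / p * (Θ₀ / Θ t) / (2 * σt t) := by positivity
  have hUeq : (fun x => Up x t) = barenblattProfile p
      ((Θ t / Θ₀) ^ (-(1 : ℝ) / 2) * Cp ^ (1 / (p - 1)))
      (Real.sqrt (Cp / ((p - 1) / p * (Θ₀ / Θ t) / (2 * σt t)))) := by
    funext x
    rw [hUp, ← mul_max_sub_rpow_eq_barenblattProfile hCp hk]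
    congr 5
    ring
  have hUx := fun x => congrFun hUeq x
  simp only [hUx] at hU1 hU2 ⊢
  exact integral_abs_sub_barenblattProfile_le_sqrt_renyi hp1 (by linarith) (by positivity)
    (by positivity) (fun x => hu0 x t ht) hf hf2 hfp
    (.of_integral_ne_zero (by rw [hU1]; exact one_ne_zero))
    (.of_integral_ne_zero (by rw [hU2]; exact hΘt.ne')) hf1 hU1 (hfm.trans hU2.symm) hFp
end
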